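/- Quantitative Brunn–Minkowski inequality: there exists a constant C(n) > 0, depending only on the dimension n, such that for every bounded measurable set F ⊆ ℝⁿ and every bounded convex set K ⊆ ℝⁿ with 0 < |F| < ∞ and 0 < |K| < ∞, one has |F ⊕ K|^{1/n} − |F|^{1/n} − |K|^{1/n} ≥ C(n) · min(|F|^{1/n}, |K|^{1/n}) · α(F,K)², where α(F,K) := inf_{x∈ℝⁿ} |F Δ (x + λK)| / |F| and λ := (|F|/|K|)^{1/n}. -/

import Mathlib

open MeasureTheory Metric Set Filter Bornology
open scoped ENNReal NNReal Pointwise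

noncomputable section

/-- The set of points of Lebesgue density one of `E ⊆ ℝⁿ`. -/
def densityOnePoints (n : ℕ) (E : Set (EuclideanSpace ℝ (Fin n))) :
    Set (EuclideanSpace ℝ (Fin n)) :=
  {x | Tendsto (fun ρ : ℝ => volume (E ∩ ball x ρ) / volume (ball x ρ))
        (nhdsWithin 0 (Ioi 0)) (nhds 1)}

/-- Minkowski sum `A ⊕ B_r = ⋃_{x ∈ A} B_r(x)`. -/
def minkSum (n : ℕ) (r : ℝ) (A : Set (EuclideanSpace ℝ (Fin n))) :
    Set (EuclideanSpace ℝ (Fin n)) :=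
  ⋃ x ∈ A, ball x r

/-- The nonlocal Minkowski perimeter `Per_r(E) = (1/(2r)) |(∂E) ⊕ B_r|`, where `∂E`
is the topological boundary of the density-one representative of `E`. -/
def perR (n : ℕ) (r : ℝ) (E : Set (EuclideanSpace ℝ (Fin n))) : ℝ≥0∞ :=
  volume (minkSum n r (frontier (densityOnePoints n E))) / ENNReal.ofReal (2 * r)

/-- The inner set `E ⊖ B_r = E \ ((∂E) ⊕ B_r)` (for the density-one representative). -/
def minkSub (n : ℕ) (r : ℝ) (E : Set (EuclideanSpace ℝ (Fin n))) :
    Set (EuclideanSpace ℝ (Fin n)) :=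
  densityOnePoints n E \ minkSum n r (frontier (densityOnePoints n E))

/-- The Riesz energy `Φ_α(E) = ∫_E ∫_E |x-y|^{-α} dx dy`. -/
def rieszEnergy (n : ℕ) (α : ℝ) (E : Set (EuclideanSpace ℝ (Fin n))) : ℝ≥0∞ :=
  ∫⁻ x in E, ∫⁻ y in E, edist x y ^ (-α)

/-- The radius of the ball in `ℝⁿ` with unit volume. -/
def unitRadius (n : ℕ) : ℝ :=
  (volume (ball (0 : EuclideanSpace ℝ (Fin n)) 1)).toReal ^ (-(n : ℝ)⁻¹)

/-- A rigid motion of `ℝⁿ`: a rotation followed by a translation. -/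
def IsRigidMotion (n : ℕ) (g : EuclideanSpace ℝ (Fin n) → EuclideanSpace ℝ (Fin n)) : Prop :=
  ∃ (R : EuclideanSpace ℝ (Fin n) ≃ₗᵢ[ℝ] EuclideanSpace ℝ (Fin n))
    (v : EuclideanSpace ℝ (Fin n)),
    LinearMap.det (R.toLinearEquiv : EuclideanSpace ℝ (Fin n) →ₗ[ℝ] EuclideanSpace ℝ (Fin n)) = 1 ∧
    ∀ x, g x = R x + v

namespace QBM
set_option linter.unusedSectionVars false
set_option linter.style.longLine false

/-- slices space -/
abbrev Y (m : ℕ) := Fin m → ℝ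
abbrev X (m : ℕ) := ℝ × Y m

instance instHaarX (m : ℕ) : (volume : Measure (X m)).IsAddHaarMeasure :=
  inferInstanceAs ((volume : Measure ℝ).prod (volume : Measure (Y m))).IsAddHaarMeasure

section general
variable {E : Type*} [NormedAddCommGroup E] [NormedSpace ℝ E] [MeasureSpace E]

structure Pair (F K : Set E) : Prop where
  bF : IsBounded F
  mF : MeasurableSet F
  oK : IsOpen K
  cK : Convex ℝ K
  bK : IsBounded K
  ne : K.Nonempty
  vol : volume.real F = volume.real K

/-- equal volume Brunn-Minkowski -/
def BMp (E : Type*) [NormedAddCommGroup E] [NormedSpace ℝ E] [MeasureSpace E] (n : ℕ) : Prop :=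
  ∀ F K : Set E, Pair F K → ∀ t : ℝ, 0 < t →
    (1 + t) ^ n * volume.real K ≤ volume.real (F + t • K)

def Stp (E : Type*) [NormedAddCommGroup E] [NormedSpace ℝ E] [MeasureSpace E] (n : ℕ) : Prop :=
  ∃ C : ℝ, 0 < C ∧ ∀ F K : Set E, Pair F K → ∀ t ε : ℝ, 0 < t → 0 < ε →
    volume.real (F + t • K) ≤ (1 + t + min t 1 * ε ^ 2) ^ n * volume.real K →
    ∃ x : E, volume.real (symmDiff F (x +ᵥ K)) ≤ C * volume.real K * ε

variable [BorelSpace E] [FiniteDimensional ℝ E] [(volume : Measure E).IsAddHaarMeasure]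

lemma fin {s : Set E} (h : IsBounded s) : volume s ≠ ⊤ := by
  have := FiniteDimensional.proper ℝ E
  exact h.measure_lt_top.ne

lemma mono {s t : Set E} (h : s ⊆ t) (ht : IsBounded t) : volume.real s ≤ volume.real t :=
  measureReal_mono h (fin ht)

lemma bdd_vadd {x : E} {K : Set E} (h : IsBounded K) : IsBounded (x +ᵥ K) := by
  have : x +ᵥ K = {x} + K := by rw [Set.singleton_add]; rfl
  rw [this]; exact isBounded_singleton.add h

lemma vol_vadd (x : E) (K : Set E) : volume.real (x +ᵥ K) = volume.real K := by
  simp [Measure.real, measure_vadd]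

lemma vol_smul {n : ℕ} (hn : Module.finrank ℝ E = n) {t : ℝ} (ht : 0 ≤ t) (K : Set E) :
    volume.real (t • K) = t ^ n * volume.real K := by
  rw [Measure.real, Measure.addHaar_smul, ENNReal.toReal_mul, hn,
    ENNReal.toReal_ofReal (abs_nonneg _), abs_of_nonneg (by positivity)]; rfl

lemma vol_pos {K : Set E} (o : IsOpen K) (ne : K.Nonempty) (b : IsBounded K) :
    0 < volume.real K := by
  rw [Measure.real]
  exact ENNReal.toReal_pos (o.measure_pos volume ne).ne' (fin b)

lemma nonempty_of_pos {K : Set E} (h : 0 < volume.real K) : K.Nonempty := by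
  by_contra h'
  rw [not_nonempty_iff_eq_empty] at h'
  simp [h'] at h

lemma BM_gen {n : ℕ} (hn0 : n ≠ 0) (hn : Module.finrank ℝ E = n) (h : BMp E n) {F K : Set E}
    (bF : IsBounded F) (mF : MeasurableSet F) (oK : IsOpen K) (cK : Convex ℝ K) (bK : IsBounded K)
    {A B : ℝ} (hA : 0 < A) (hB : 0 < B) (hFA : A ^ n ≤ volume.real F)
    (hKB : B ^ n ≤ volume.real K) : (A + B) ^ n ≤ volume.real (F + K) := by
  set a := volume.real F
  set b := volume.real K
  have ha : 0 < a := lt_of_lt_of_le (by positivity) hFA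
  have hb : 0 < b := lt_of_lt_of_le (by positivity) hKB
  set a' := a ^ ((n:ℝ)⁻¹)
  set b' := b ^ ((n:ℝ)⁻¹)
  have ha' : 0 < a' := Real.rpow_pos_of_pos ha _
  have hb' : 0 < b' := Real.rpow_pos_of_pos hb _
  have hae : a' ^ n = a := Real.rpow_inv_natCast_pow ha.le hn0
  have hbe : b' ^ n = b := Real.rpow_inv_natCast_pow hb.le hn0
  have hAa : A ≤ a' := by
    rw [← pow_le_pow_iff_left₀ hA.le ha'.le hn0, hae]; exact hFA
  have hBb : B ≤ b' := by
    rw [← pow_le_pow_iff_left₀ hB.le hb'.le hn0, hbe]; exact hKB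
  have hl : 0 < a' / b' := by positivity
  have ne : K.Nonempty := nonempty_of_pos hb
  have hv : volume.real ((a'/b') • K) = a := by
    rw [vol_smul hn hl.le, div_pow, hae, hbe]; field_simp; rfl
  have P : Pair F ((a' / b') • K) :=
    ⟨bF, mF, oK.smul₀ hl.ne', cK.smul _, bK.smul₀ _, ne.smul_set, hv.symm⟩
  have := h F _ P (b' / a') (by positivity)
  rw [smul_smul, show b'/a' * (a'/b') = 1 by field_simp, one_smul, hv] at this
  calc (A + B) ^ n ≤ (a' + b') ^ n := by gcongr
    _ = (1 + b' / a') ^ n * a := by rw [← hae, ← mul_pow]; congr 1; field_simp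
    _ ≤ _ := this

section Pair
variable {F K : Set E}
lemma Pair.bS (P : Pair F K) (t : ℝ) : IsBounded (F + t • K) := P.bF.add (P.bK.smul₀ t)
lemma Pair.oS (P : Pair F K) {t : ℝ} (ht : 0 < t) : IsOpen (F + t • K) :=
  (P.oK.smul₀ ht.ne').add_left
lemma Pair.pos (P : Pair F K) : 0 < volume.real K := vol_pos P.oK P.ne P.bK
end Pair

section transfer
variable {E' : Type*} [NormedAddCommGroup E'] [NormedSpace ℝ E'] [MeasureSpace E']
  [BorelSpace E'] [FiniteDimensional ℝ E'] [(volume : Measure E').IsAddHaarMeasure]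

lemma Pair.image (e : E ≃L[ℝ] E') {d : ℝ} 
    (he : ∀ S : Set E, volume.real (e '' S) = d * volume.real S) {F K : Set E} (P : Pair F K) :
    Pair (e '' F) (e '' K) where
  bF := e.lipschitz.isBounded_image P.bF
  mF := e.toHomeomorph.measurableEmbedding.measurableSet_image' P.mF
  oK := e.toHomeomorph.isOpenMap _ P.oK
  cK := P.cK.linear_image e.toLinearMap
  bK := e.lipschitz.isBounded_image P.bK
  ne := P.ne.image _
  vol := by rw [he, he, P.vol]

lemma image_sum (e : E ≃L[ℝ] E') (F K : Set E) (t : ℝ) :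
    e '' (F + t • K) = e '' F + t • (e '' K) := by
  rw [Set.image_add, image_smul_set]

lemma image_vadd (e : E ≃L[ℝ] E') (K : Set E) (x : E) :
    e '' (x +ᵥ K) = e x +ᵥ (e '' K) := by
  ext y; simp only [mem_image, mem_vadd_set, vadd_eq_add]
  constructor
  · rintro ⟨_, ⟨z, hz, rfl⟩, rfl⟩; exact ⟨e z, ⟨z, hz, rfl⟩, by simp⟩
  · rintro ⟨_, ⟨z, hz, rfl⟩, rfl⟩; exact ⟨x + z, ⟨z, hz, rfl⟩, by simp⟩

lemma BMp.transfer {n : ℕ} (e : E ≃L[ℝ] E') 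
    (he : ∀ S : Set E, volume.real (e '' S) = volume.real S) (h : BMp E' n) : BMp E n := by
  intro F K P t ht
  have := h _ _ (P.image e (d := 1) (by simpa using he)) t ht
  rwa [← image_sum, he, he] at this

/-- stability conclusion for a given pair transfers -/
lemma stab_transfer {n : ℕ} (e : E ≃L[ℝ] E') {d : ℝ} (hd : 0 < d)
    (he : ∀ S : Set E, volume.real (e '' S) = d * volume.real S) {F K : Set E} {t ε C : ℝ}
    (hv : volume.real (F + t • K) ≤ (1 + t + min t 1 * ε ^ 2) ^ n * volume.real K)
    (h : volume.real (e '' F + t • (e '' K)) ≤ (1 + t + min t 1 * ε ^ 2) ^ n * volume.real (e '' K) →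
      ∃ x : E', volume.real (symmDiff (e '' F) (x +ᵥ (e '' K))) ≤ C * volume.real (e '' K) * ε) :
    ∃ x : E, volume.real (symmDiff F (x +ᵥ K)) ≤ C * volume.real K * ε := by
  rw [← image_sum, he, he] at h
  obtain ⟨x, hx⟩ := h (by nlinarith)
  refine ⟨e.symm x, ?_⟩
  have h2 : symmDiff (e '' F) (x +ᵥ (e '' K)) = e '' (symmDiff F (e.symm x +ᵥ K)) := by
    rw [Set.image_symmDiff e.injective, image_vadd]; simp
  rw [h2, he] at hx
  have : d * volume.real (symmDiff F (e.symm x +ᵥ K)) ≤ d * (C * volume.real K * ε) := by linarith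
  exact le_of_mul_le_mul_left this hd

lemma Stp.transfer {n : ℕ} (e : E ≃L[ℝ] E') 
    (he : ∀ S : Set E, volume.real (e '' S) = volume.real S) (h : Stp E' n) : Stp E n := by
  obtain ⟨C, hC, h⟩ := h
  refine ⟨C, hC, fun F K P t ε ht hε hv => ?_⟩
  have he' : ∀ S : Set E, volume.real (e '' S) = 1 * volume.real S := by simpa using he
  exact stab_transfer e one_pos he' hv (h _ _ (P.image e he') t ε ht hε)

lemma mp_image (e : E ≃L[ℝ] E') (h : MeasurePreserving e) (S : Set E) :
    volume.real (e '' S) = volume.real S := by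
  have h2 : MeasurePreserving e.toHomeomorph.toMeasurableEquiv := h
  have : e '' S = e.toHomeomorph.toMeasurableEquiv.symm ⁻¹' S := by
    rw [MeasurableEquiv.preimage_symm]; rfl
  rw [this, Measure.real, (h2.symm _).measure_preimage_equiv]; rfl

end transfer
end general
end QBM

namespace QBM
set_option linter.unusedSectionVars false
set_option linter.style.longLine false

lemma real_Ioo {K : Set ℝ} (o : IsOpen K) (c : Convex ℝ K) (b : IsBounded K) (ne : K.Nonempty) :
    ∃ p q : ℝ, p < q ∧ K = Ioo p q := by
  obtain ⟨hbb, hba⟩ := isBounded_iff_bddBelow_bddAbove.1 b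
  have hsub : Ioo (sInf K) (sSup K) ⊆ K :=
    IsConnected.Ioo_csInf_csSup_subset ⟨ne, c.isPreconnected⟩ hbb hba
  have hsup : K ⊆ Ioo (sInf K) (sSup K) := by
    intro x hx
    obtain ⟨δ, hδ, hb⟩ := Metric.isOpen_iff.1 o x hx
    have h1 : x - δ / 2 ∈ K := hb (by simp [abs_of_pos hδ]; exact hδ)
    have h2 : x + δ / 2 ∈ K := hb (by simp [abs_of_pos hδ]; exact hδ)
    have := csInf_le hbb h1
    have := le_csSup hba h2
    constructor <;> linarith
  obtain ⟨x, hx⟩ := ne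
  exact ⟨_, _, (hsup hx).1.trans (hsup hx).2, hsup.antisymm hsub⟩

lemma bm_Ioo {F : Set ℝ} (bF : IsBounded F) (ne : F.Nonempty) {p q : ℝ}
    (h : p < q) : volume.real F + (q - p) ≤ volume.real (F + Ioo p q) := by
  have hba : BddAbove F := (isBounded_iff_bddBelow_bddAbove.1 bF).2
  have bs : IsBounded (F + Ioo p q) := bF.add (isBounded_Ioo _ _)
  have key : ∀ η ∈ Ioo p q, volume.real F + (q - η) ≤ volume.real (F + Ioo p q) := by
    intro η hη
    have h1 : (η +ᵥ F) ∪ Ioo (sSup F + η) (sSup F + q) ⊆ F + Ioo p q := by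
      apply union_subset
      · rintro _ ⟨x, hx, rfl⟩
        exact ⟨x, hx, η, hη, by simp [add_comm]⟩
      · intro y hy
        obtain ⟨f, hf, hfy⟩ := exists_lt_of_lt_csSup ne (show y - q < sSup F by linarith [hy.2])
        have : f ≤ sSup F := le_csSup hba hf
        exact ⟨f, hf, y - f, ⟨by linarith [hy.1, hη.1], by linarith⟩, by simp⟩
    have hd : Disjoint (η +ᵥ F) (Ioo (sSup F + η) (sSup F + q)) := by
      rw [Set.disjoint_left]
      rintro _ ⟨x, hx, rfl⟩ h2
      have : x ≤ sSup F := le_csSup hba hx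
      simp at h2; linarith [h2.1]
    have := mono h1 bs
    rw [measureReal_union hd measurableSet_Ioo (fin (bdd_vadd bF)) (fin (isBounded_Ioo _ _)), vol_vadd,
      Real.volume_real_Ioo_of_le (by linarith [hη.2])] at this
    linarith
  by_contra hc
  push Not at hc
  set D := volume.real F + (q - p) - volume.real (F + Ioo p q)
  have hD : 0 < D := by simp only [D]; linarith
  have := key (p + min (D / 2) ((q - p) / 2)) ⟨by
    have : 0 < min (D / 2) ((q - p) / 2) := lt_min (by linarith) (by linarith)
    linarith, by
    have := min_le_right (D / 2) ((q - p) / 2)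
    linarith⟩
  have := min_le_left (D / 2) ((q - p) / 2)
  simp only [D] at *
  linarith

lemma BMp_real : BMp ℝ 1 := by
  intro F K P t ht
  obtain ⟨p, q, hpq, rfl⟩ := real_Ioo P.oK P.cK P.bK P.ne
  rw [LinearOrderedField.smul_Ioo ht]
  have hv := P.vol
  have ne : F.Nonempty := nonempty_of_pos (by rw [hv]; exact P.pos)
  have := bm_Ioo P.bF ne (show t * p < t * q by gcongr)
  rw [Real.volume_real_Ioo_of_le hpq.le] at *

  nlinarith

lemma Stp_real : Stp ℝ 1 := by
  refine ⟨2, by norm_num, ?_⟩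
  intro F K P t ε ht hε hv
  obtain ⟨p, q, hpq, rfl⟩ := real_Ioo P.oK P.cK P.bK P.ne
  have hvol := P.vol
  have bS := P.bS t
  have ne : F.Nonempty := nonempty_of_pos (by rw [hvol]; exact P.pos)
  rw [LinearOrderedField.smul_Ioo ht] at hv bS

  obtain ⟨hbb, hba⟩ := isBounded_iff_bddBelow_bddAbove.1 P.bF
  rw [Real.volume_real_Ioo_of_le hpq.le] at *
  have htpq : t * p < t * q := by gcongr
  have hV : 0 < q - p := by linarith
  set A := sInf F
  set B := sSup F
  have hm1 : min t 1 * ε ^ 2 ≤ t * ε ^ 2 := by gcongr; exact min_le_left _ _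
  have hm2 : min t 1 * ε ^ 2 ≤ 1 * ε ^ 2 := by gcongr; exact min_le_right _ _
  have hFAB : F ⊆ Icc A B := fun x hx => ⟨csInf_le hbb hx, le_csSup hba hx⟩
  have triv : 1 ≤ ε → ∃ x : ℝ, volume.real (symmDiff F (x +ᵥ Ioo p q)) ≤ 2 * (q - p) * ε := by
    intro h1
    refine ⟨0, ?_⟩
    have h2 : symmDiff F ((0:ℝ) +ᵥ Ioo p q) ⊆ F ∪ ((0:ℝ) +ᵥ Ioo p q) := by
      rw [Set.symmDiff_def]; exact union_subset_union sdiff_subset sdiff_subset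
    calc _ ≤ _ := mono h2 (P.bF.union (bdd_vadd P.bK))
      _ ≤ volume.real F + volume.real ((0:ℝ) +ᵥ Ioo p q) := measureReal_union_le _ _
      _ = 2 * (q - p) := by rw [vol_vadd, hvol, Real.volume_real_Ioo_of_le hpq.le]; ring
      _ ≤ _ := by nlinarith
  by_cases hfull : Ioo (A + t * p) (B + t * q) ⊆ F + Ioo (t * p) (t * q)
  · have hAB : q - p ≤ B - A := by
      rw [← hvol, ← Real.volume_real_Icc_of_le ?_]
      · exact mono hFAB (isBounded_Icc _ _)
      · obtain ⟨x, hx⟩ := ne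
        exact (hFAB hx).1.trans (hFAB hx).2
    have h1 := mono hfull bS
    rw [Real.volume_real_Ioo_of_le (by linarith)] at h1
    have h2 : B - A ≤ (q - p) + (q - p) * ε ^ 2 := by
      simp only [pow_one] at hv
      nlinarith
    by_cases he : 1 ≤ ε
    · exact triv he
    · push Not at he
      refine ⟨A - p, ?_⟩
      have h3 : (A - p) +ᵥ Ioo p q = Ioo A (A + (q - p)) := by
        ext y; simp only [mem_vadd_set, vadd_eq_add, mem_Ioo]
        constructor
        · rintro ⟨z, hz, rfl⟩; constructor <;> linarith [hz.1, hz.2]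
        · intro hy; exact ⟨y - (A - p), ⟨by linarith [hy.1], by linarith [hy.2]⟩, by ring⟩
      rw [h3]
      set J := Ioo A (A + (q - p))
      have hJ : volume.real J = q - p := by
        rw [Real.volume_real_Ioo_of_le (by linarith)]; ring
      have h4 : volume.real (Icc A B \ J) ≤ (q - p) * ε ^ 2 := by
        rw [measureReal_sdiff (by
          intro x hx; exact ⟨hx.1.le, by linarith [hx.2]⟩) measurableSet_Ioo (fin (isBounded_Icc _ _)), hJ,
          Real.volume_real_Icc_of_le (by linarith)]
        linarith
      have h5 : volume.real (Icc A B \ F) ≤ (q - p) * ε ^ 2 := by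
        rw [measureReal_sdiff hFAB P.mF (fin (isBounded_Icc _ _)), hvol,
          Real.volume_real_Icc_of_le (by linarith)]
        linarith
      have h6 : symmDiff F J ⊆ (Icc A B \ J) ∪ (Icc A B \ F) := by
        rw [Set.symmDiff_def]
        apply union_subset_union
        · exact sdiff_subset_sdiff_left hFAB
        · apply sdiff_subset_sdiff_left
          intro x hx; exact ⟨hx.1.le, by linarith [hx.2]⟩
      calc _ ≤ _ := mono h6 (((isBounded_Icc _ _).subset sdiff_subset).union ((isBounded_Icc _ _).subset sdiff_subset))
        _ ≤ _ := measureReal_union_le _ _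
        _ ≤ (q - p) * ε ^ 2 + (q - p) * ε ^ 2 := by linarith
        _ ≤ _ := by nlinarith [mul_pos hV hε]
  · apply triv
    rw [Set.not_subset] at hfull
    obtain ⟨z, hz, hzn⟩ := hfull
    have hgap : ∀ x ∈ F, x ≤ z - t * q ∨ z - t * p ≤ x := by
      intro x hx
      by_contra h
      push Not at h
      exact hzn ⟨x, hx, z - x, ⟨by linarith, by linarith⟩, by simp⟩
    obtain ⟨x1, hx1, hx1'⟩ := exists_lt_of_csInf_lt ne (show A < z - t * p by linarith [hz.1])
    obtain ⟨x2, hx2, hx2'⟩ := exists_lt_of_lt_csSup ne (show z - t * q < B by linarith [hz.2])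
    have b1 := bm_Ioo (P.bF.subset (inter_subset_left (t := Iio (z - t * p)))) ⟨x1, hx1, hx1'⟩ htpq
    have b2 := bm_Ioo (P.bF.subset (sdiff_subset (t := Iio (z - t * p)))) ⟨x2, hx2, by
      have := hgap x2 hx2
      rcases this with h | h
      · linarith
      · simpa using h⟩ htpq
    have hsplit := measureReal_inter_add_sdiff (μ := volume) (s := F) (measurableSet_Iio (a := z - t * p)) (fin P.bF)
    have hd : Disjoint (F ∩ Iio (z - t * p) + Ioo (t * p) (t * q)) (F \ Iio (z - t * p) + Ioo (t * p) (t * q)) := by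
      rw [Set.disjoint_left]
      rintro _ ⟨x, hx, y, hy, rfl⟩ ⟨x', hx', y', hy', h⟩
      have e1 := (hgap x hx.1).resolve_right (not_le.2 hx.2)
      have e2 := hx'.2
      simp only [mem_Iio, not_lt, mem_Ioo] at *
      linarith [hy.2, hy'.1]
    have hsub : (F ∩ Iio (z - t * p) + Ioo (t * p) (t * q)) ∪ (F \ Iio (z - t * p) + Ioo (t * p) (t * q)) ⊆ F + Ioo (t * p) (t * q) :=
      union_subset (add_subset_add_right inter_subset_left) (add_subset_add_right sdiff_subset)
    have h1 := mono hsub bS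
    rw [measureReal_union hd (isOpen_Ioo.add_left.measurableSet) (fin (bS.subset (subset_union_left.trans hsub)))
      (fin (bS.subset (subset_union_right.trans hsub)))] at h1
    by_contra hlt
    push Not at hlt
    have : ε ^ 2 < 1 := by nlinarith
    simp only [pow_one] at hv
    have : t * (q - p) * ε ^ 2 < t * (q - p) * 1 := by gcongr
    nlinarith

/-- the equivalence `Y 1 ≃ ℝ` -/
lemma funUnique_vol (S : Set (Y 1)) :
    volume.real ((ContinuousLinearEquiv.funUnique (Fin 1) ℝ ℝ) '' S) = volume.real S :=
  mp_image _ (volume_preserving_funUnique (Fin 1) ℝ) S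

lemma BMp_one : BMp (Y 1) 1 := BMp.transfer _ funUnique_vol BMp_real
lemma Stp_one : Stp (Y 1) 1 := Stp.transfer _ funUnique_vol Stp_real

end QBM

namespace QBM
set_option linter.unusedSectionVars false
set_option linter.style.longLine false

lemma sum_choose_id (M : ℕ) (t : ℝ) :
    ∑ j ∈ Finset.range (M + 2), ((M + 1).choose j : ℝ) * t ^ j * j = (M + 1) * t * (1 + t) ^ M := by
  rw [Finset.sum_range_succ', add_comm 1 t, add_pow, Finset.mul_sum]
  simp only [Nat.cast_zero, mul_zero, add_zero, one_pow, mul_one]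
  refine Finset.sum_congr rfl fun j _ => ?_
  have := Nat.add_one_mul_choose_eq M j
  have h2 : ((M:ℝ) + 1) * (M.choose j) = ((M+1).choose (j+1)) * (j + 1) := by exact_mod_cast this
  push_cast
  rw [pow_succ]
  linear_combination (-(t ^ j * t)) * h2

lemma sum_choose (M : ℕ) (t : ℝ) :
    ∑ j ∈ Finset.range (M + 2), ((M + 1).choose j : ℝ) * t ^ j = (1 + t) ^ (M + 1) := by
  rw [add_comm 1 t, add_pow]
  refine Finset.sum_congr rfl fun j _ => by simp; ring

lemma A1 (m : ℕ) (hm : 1 ≤ m) {a ρ t : ℝ} (ha : 0 < a) (ht : 0 ≤ t) (h : a ^ m * ρ = 1) :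
    (1 + t) ^ (m + 1) + t * (m * a + ρ - (m + 1)) ≤ (1 + t * a) ^ m * (1 + t * ρ) := by
  obtain ⟨M, rfl⟩ : ∃ M, m = M + 1 := ⟨m - 1, by omega⟩
  set L := Real.log a with hL
  have hae : a = Real.exp L := (Real.exp_log ha).symm
  have hρ : ρ = Real.exp (-((M + 1 : ℕ) : ℝ) * L) := by
    have : a ^ (M + 1) = Real.exp (((M + 1 : ℕ) : ℝ) * L) := by
      rw [hae, ← Real.exp_nat_mul]
    rw [this] at h
    rw [neg_mul, Real.exp_neg]
    exact eq_inv_of_mul_eq_one_right h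
  have e1 : ∀ j : ℕ, 1 + j * L ≤ a ^ j := by
    intro j; rw [hae, ← Real.exp_nat_mul]; linarith [Real.add_one_le_exp (j * L)]
  have e2 : ∀ j : ℕ, 1 + (j - (M + 1)) * L ≤ a ^ j * ρ := by
    intro j; rw [hρ, hae, ← Real.exp_nat_mul, ← Real.exp_add]
    have := Real.add_one_le_exp (j * L + -((M + 1 : ℕ) : ℝ) * L)
    push_cast at *; linarith
  have E1 : (1 + t * a) ^ (M + 1) = ∑ j ∈ Finset.range (M + 2), ((M + 1).choose j : ℝ) * t ^ j * a ^ j := by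
    rw [← sum_choose]; simp [mul_pow, mul_assoc]
  have B1 : (1 + t) ^ (M + 1) + L * ((M + 1) * t * (1 + t) ^ M) + (M + 1) * t * (a - 1 - L)
      ≤ (1 + t * a) ^ (M + 1) := by
    have h1 : (1 + t) ^ (M + 1) + L * ((M + 1) * t * (1 + t) ^ M) 
       = ∑ j ∈ Finset.range (M + 2), ((M + 1).choose j : ℝ) * t ^ j * (1 + j * L) := by
      rw [← sum_choose_id, ← sum_choose, Finset.mul_sum, ← Finset.sum_add_distrib]
      exact Finset.sum_congr rfl fun j _ => by ring
    rw [E1, h1]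
    have h2 : ∑ j ∈ Finset.range (M + 2), (if j = 1 then (M + 1) * t * (a - 1 - L) else 0) = (M + 1) * t * (a - 1 - L) := by
      rw [Finset.sum_ite_eq']; simp
    rw [← h2, ← Finset.sum_add_distrib]
    refine Finset.sum_le_sum fun j _ => ?_
    split_ifs with hj
    · subst hj; simp; apply le_of_eq; ring
    · rw [add_zero]; gcongr; exact e1 j
  have B2 : (1 + t) ^ (M + 1) + L * ((M + 1) * t * (1 + t) ^ M) - (M + 1) * L * (1 + t) ^ (M + 1) +
      (ρ - 1 + (M + 1) * L) ≤ (1 + t * a) ^ (M + 1) * ρ := by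
    have h1 : (1 + t) ^ (M + 1) + L * ((M + 1) * t * (1 + t) ^ M) - (M + 1) * L * (1 + t) ^ (M + 1) 
       = ∑ j ∈ Finset.range (M + 2), ((M + 1).choose j : ℝ) * t ^ j * (1 + (j - (M + 1)) * L) := by
      rw [← sum_choose_id, ← sum_choose, Finset.mul_sum, Finset.mul_sum, ← Finset.sum_add_distrib, ← Finset.sum_sub_distrib]
      exact Finset.sum_congr rfl fun j _ => by ring
    rw [E1, h1]
    have h2 : ∑ j ∈ Finset.range (M + 2), (if j = 0 then (ρ - 1 + (M + 1) * L) else 0) = (ρ - 1 + (M + 1) * L) := by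
      rw [Finset.sum_ite_eq']; simp
    rw [← h2, ← Finset.sum_add_distrib, Finset.sum_mul]
    refine Finset.sum_le_sum fun j _ => ?_
    split_ifs with hj
    · subst hj; simp; apply le_of_eq; ring
    · rw [add_zero, mul_assoc _ (a ^ j)]; gcongr; exact e2 j
  have B3 := mul_le_mul_of_nonneg_left B2 ht
  push_cast
  have : (1 + t * a) ^ (M + 1) * (1 + t * ρ) = (1 + t * a) ^ (M + 1) + t * ((1 + t * a) ^ (M + 1) * ρ) := by ring
  rw [this]
  refine le_trans (le_of_eq ?_) (add_le_add B1 B3)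
  rw [pow_succ (1 + t) (M + 1), pow_succ (1 + t) M]
  ring

lemma A2 (m : ℕ) (hm : 1 ≤ m) {a ρ : ℝ} (ha : 0 < a) (h : a ^ m * ρ = 1) :
    (ρ - 1) ^ 2 ≤ m ^ 2 * (1 + ρ) * (m * a + ρ - (m + 1)) := by
  have hρ : 0 < ρ := by
    by_contra hc; push Not at hc
    nlinarith [pow_pos ha m]
  have hm' : (1:ℝ) ≤ m := by exact_mod_cast hm
  have h' : a⁻¹ ^ m = ρ := by
    rw [inv_pow]; exact inv_eq_of_mul_eq_one_right h
  obtain ⟨M, rfl⟩ : ∃ M, m = M + 1 := ⟨m - 1, by omega⟩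
  have h'' : a⁻¹ ^ M = a * ρ := by
    rw [← h', pow_succ]; field_simp
  push_cast at *
  set E := ((M:ℝ) + 1) * a + ρ - (M + 1 + 1)
  have hM0 : (0:ℝ) ≤ M := by positivity
  have hai : 0 < a⁻¹ := inv_pos.2 ha
  rcases le_total 1 a with h1 | h1
  · have b1 : 1 - (M + 1) * (1 - a⁻¹) ≤ ρ := by
      rw [← h']
      have := one_add_mul_le_pow (show (-2:ℝ) ≤ a⁻¹ - 1 by linarith) (M + 1)
      push_cast at this
      have e : 1 + (a⁻¹ - 1) = a⁻¹ := by ring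
      rw [e] at this; linarith
    have b2 : 1 - M * (a - 1) ≤ a * ρ := by
      rw [← h'']
      have := one_add_mul_le_pow (show (-2:ℝ) ≤ a⁻¹ - 1 by linarith) M
      have e : 1 + (a⁻¹ - 1) = a⁻¹ := by ring
      rw [e] at this
      have : a⁻¹ - 1 ≥ 1 - a := by
        have := mul_inv_cancel₀ ha.ne'
        nlinarith [sq_nonneg (a - 1)]
      nlinarith
    have hρ1 : ρ ≤ 1 := by
      rw [← h']; exact pow_le_one₀ hai.le (inv_le_one_of_one_le₀ h1)
    have b3 : (M + 1) * (a - 1) ^ 2 ≤ a * E := by simp only [E]; nlinarith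
    have hE : 0 ≤ E := by
      have : 0 ≤ a * E := le_trans (by positivity) b3
      exact nonneg_of_mul_nonneg_right this ha
    have b4 : (a * (1 - ρ)) ^ 2 ≤ ((M + 1) * (a - 1)) ^ 2 := by
      have h0 : 0 ≤ a * (1 - ρ) := mul_nonneg ha.le (by linarith)
      have : a * (1 - ρ) ≤ (M + 1) * (a - 1) := by
        have := mul_inv_cancel₀ ha.ne'
        have := mul_le_mul_of_nonneg_left b1 ha.le
        nlinarith
      gcongr
    have b5 : a ^ 2 * (ρ - 1) ^ 2 ≤ a ^ 2 * ((M + 1) ^ 2 * (1 + ρ) * E) := by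
      calc a ^ 2 * (ρ - 1) ^ 2 = (a * (1 - ρ)) ^ 2 := by ring
        _ ≤ ((M + 1) * (a - 1)) ^ 2 := b4
        _ = (M + 1) * ((M + 1) * (a - 1) ^ 2) := by ring
        _ ≤ (M + 1) * (a * E) := by gcongr
        _ ≤ (M+1)^2 * (a ^ 2 * E) := by
          have : a * E ≤ a ^ 2 * E := by gcongr; nlinarith
          have h3 : ((M:ℝ)+1) ≤ (M+1)^2 := by nlinarith
          have h4 : 0 ≤ a * E := by positivity
          exact mul_le_mul h3 this h4 (by positivity)
        _ ≤ (M+1)^2 * (a ^ 2 * E) * (1 + ρ) := by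
          have : 0 ≤ ((M:ℝ)+1)^2 * (a ^ 2 * E) := by positivity
          nlinarith
        _ = _ := by ring
    exact le_of_mul_le_mul_left b5 (by positivity)
  · have b0 : 1 ≤ a⁻¹ := (one_le_inv₀ ha).2 h1
    have hρ1 : 1 ≤ ρ := by rw [← h']; exact one_le_pow₀ b0
    have b1 : ρ - 1 ≤ (M + 1) * ρ * (1 - a) := by
      have := one_add_mul_le_pow (show (-2:ℝ) ≤ a - 1 by linarith) (M + 1)
      push_cast at this
      have e : 1 + (a - 1) = a := by ring
      rw [e] at this
      nlinarith
    have b2 : 1 + M * (a⁻¹ - 1) ≤ a * ρ := by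
      rw [← h'']
      have := one_add_mul_le_pow (show (-2:ℝ) ≤ a⁻¹ - 1 by linarith) M
      have e : 1 + (a⁻¹ - 1) = a⁻¹ := by ring
      rwa [e] at this
    have b2' : 1 + M * (1 - a) ≤ a * ρ := by
      have : a⁻¹ - 1 ≥ 1 - a := by
        have := mul_inv_cancel₀ ha.ne'
        nlinarith [sq_nonneg (a - 1)]
      nlinarith
    have b3 : ρ * (1 - a) ^ 2 ≤ E := by
      have : 1 + (M + 1) * (1 - a) ≤ a * ρ * (2 - a) := by
        have h5 : (1 + M * (1 - a)) * (2 - a) ≤ a * ρ * (2 - a) := by gcongr; linarith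
        have h6 : 0 ≤ M * (1 - a) * (1 - a) := by
          have : 0 ≤ 1 - a := by linarith
          positivity
        nlinarith
      simp only [E]; nlinarith
    have hE : 0 ≤ E := le_trans (by positivity) b3
    calc (ρ - 1) ^ 2 ≤ ((M + 1) * ρ * (1 - a)) ^ 2 := by
          have : 0 ≤ ρ - 1 := by linarith
          gcongr
      _ = (M + 1) ^ 2 * ρ * (ρ * (1 - a) ^ 2) := by ring
      _ ≤ (M + 1) ^ 2 * (1 + ρ) * E := by gcongr; linarith

lemma E_nonneg (m : ℕ) (hm : 1 ≤ m) {a ρ : ℝ} (ha : 0 < a) (h : a ^ m * ρ = 1) :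
    0 ≤ m * a + ρ - (m + 1) := by
  have hρ : 0 < ρ := by
    by_contra hc; push Not at hc
    nlinarith [pow_pos ha m]
  have := (sq_nonneg _).trans (A2 m hm ha h)
  have hm' : (1:ℝ) ≤ m := by exact_mod_cast hm
  exact nonneg_of_mul_nonneg_right this (by positivity)

end QBM

namespace QBM
set_option linter.unusedSectionVars false
set_option linter.style.longLine false
set_option linter.unusedVariables false
set_option linter.unusedSimpArgs false

variable {m : ℕ}

def slice (S : Set (X m)) (s : ℝ) : Set (Y m) := Prod.mk s ⁻¹' S
def sl (S : Set (X m)) (s : ℝ) : ℝ := volume.real (slice S s)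
def cum (S : Set (X m)) (z : ℝ) : ℝ := volume.real (S ∩ {p | p.1 < z})

lemma mem_slice {S : Set (X m)} {s : ℝ} {y : Y m} : y ∈ slice S s ↔ (s, y) ∈ S := Iff.rfl

lemma slice_meas {S : Set (X m)} (h : MeasurableSet S) (s : ℝ) : MeasurableSet (slice S s) :=
  measurable_prodMk_left h

lemma slice_open {S : Set (X m)} (h : IsOpen S) (s : ℝ) : IsOpen (slice S s) :=
  h.preimage (by fun_prop)

lemma slice_bdd {S : Set (X m)} (h : IsBounded S) (s : ℝ) : IsBounded (slice S s) :=
  (h.image_snd).subset (fun y hy => ⟨(s, y), hy, rfl⟩)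

lemma slice_convex {S : Set (X m)} (h : Convex ℝ S) (s : ℝ) : Convex ℝ (slice S s) := by
  intro x hx y hy a b ha hb hab
  have := h hx hy ha hb hab
  simp only [mem_slice]
  convert this using 1
  ext <;> simp
  rw [← add_mul, hab, one_mul]

lemma sl_nonneg (S : Set (X m)) (s : ℝ) : 0 ≤ sl S s := measureReal_nonneg

lemma sl_meas {S : Set (X m)} (h : MeasurableSet S) : Measurable (sl S) :=
  (measurable_measure_prodMk_left h).ennreal_toReal

lemma lint_slice {S : Set (X m)} (h : MeasurableSet S) : ∫⁻ s, volume (slice S s) = volume S := by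
  rw [show (volume : Measure (X m)) = (volume : Measure ℝ).prod (volume : Measure (Y m)) from rfl,
    Measure.prod_apply h]; rfl

lemma ofReal_sl {S : Set (X m)} (b : IsBounded S) (s : ℝ) : ENNReal.ofReal (sl S s) = volume (slice S s) :=
  ENNReal.ofReal_toReal (fin (slice_bdd b s))

lemma sl_integrable {S : Set (X m)} (h : MeasurableSet S) (b : IsBounded S) : Integrable (sl S) := by
  refine ⟨(sl_meas h).aestronglyMeasurable, ?_⟩
  rw [hasFiniteIntegral_iff_ofReal (Eventually.of_forall (sl_nonneg S))]
  simp_rw [ofReal_sl b]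
  rw [lint_slice h]
  exact (fin b).lt_top

lemma integral_sl {S : Set (X m)} (h : MeasurableSet S) (b : IsBounded S) : ∫ s, sl S s = volume.real S := by
  rw [integral_eq_lintegral_of_nonneg_ae (Eventually.of_forall (sl_nonneg S)) (sl_meas h).aestronglyMeasurable]
  simp_rw [ofReal_sl b]
  rw [lint_slice h]; rfl

lemma setIntegral_sl {S : Set (X m)} (h : MeasurableSet S) (b : IsBounded S) {A : Set ℝ} (hA : MeasurableSet A) :
    ∫ s in A, sl S s = volume.real (S ∩ Prod.fst ⁻¹' A) := by
  rw [← integral_sl (h.inter (measurable_fst hA)) (b.subset inter_subset_left), ← integral_indicator hA]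
  congr 1; ext s
  by_cases hs : s ∈ A
  · rw [indicator_of_mem hs]; unfold sl; congr 1; ext y; simp [mem_slice, hs]
  · rw [indicator_of_notMem hs]; unfold sl
    have : slice (S ∩ Prod.fst ⁻¹' A) s = ∅ := by ext y; simp [mem_slice, hs]
    simp [this]

lemma cum_eq {S : Set (X m)} (h : MeasurableSet S) (b : IsBounded S) (z : ℝ) :
    cum S z = ∫ s in Iio z, sl S s := (setIntegral_sl h b measurableSet_Iio).symm

lemma cum_sub {S : Set (X m)} (h : MeasurableSet S) (b : IsBounded S) (a c : ℝ) :
    cum S c - cum S a = ∫ s in a..c, sl S s := by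
  have hi := sl_integrable h b
  rw [cum_eq h b, cum_eq h b, setIntegral_congr_set Iio_ae_eq_Iic, setIntegral_congr_set (Iio_ae_eq_Iic (a := a))]
  exact intervalIntegral.integral_Iic_sub_Iic hi.integrableOn hi.integrableOn

lemma cum_mono {S : Set (X m)} (b : IsBounded S) : Monotone (cum S) := fun x y hxy =>
  mono (inter_subset_inter_right _ (fun p hp => lt_of_lt_of_le hp hxy)) (b.subset inter_subset_left)

lemma cum_cont {S : Set (X m)} (h : MeasurableSet S) (b : IsBounded S) : Continuous (cum S) := by
  have : cum S = fun z => cum S 0 + ∫ s in (0:ℝ)..z, sl S s := by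
    ext z; rw [← cum_sub h b]; ring
  rw [this]
  exact continuous_const.add (intervalIntegral.continuous_primitive (fun _ _ => (sl_integrable h b).intervalIntegrable) 0)

lemma cum_ae_deriv {S : Set (X m)} (h : MeasurableSet S) (b : IsBounded S) :
    ∀ᵐ s, HasDerivAt (cum S) (sl S s) s := by
  have := LocallyIntegrable.ae_hasDerivAt_integral (sl_integrable h b).locallyIntegrable
  filter_upwards [this] with s hs
  have e : cum S = fun z => cum S 0 + ∫ s in (0:ℝ)..z, sl S s := by
    ext z; rw [← cum_sub h b]; ring
  rw [e]
  exact (hs 0).const_add _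

lemma cum_deriv {S : Set (X m)} (h : MeasurableSet S) (b : IsBounded S) {s : ℝ} (hc : ContinuousAt (sl S) s) :
    HasDerivAt (cum S) (sl S s) s := by
  have e : cum S = fun z => cum S 0 + ∫ s in (0:ℝ)..z, sl S s := by
    ext z; rw [← cum_sub h b]; ring
  rw [e]
  exact (intervalIntegral.integral_hasDerivAt_right (sl_integrable h b).intervalIntegrable
    ((sl_meas h).stronglyMeasurable.stronglyMeasurableAtFilter) hc).const_add _

/-- a common bound in the first coordinate -/
lemma fst_bound {S : Set (X m)} (b : IsBounded S) : ∃ R : ℝ, 0 < R ∧ ∀ p ∈ S, ‖p‖ < R := by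
  obtain ⟨R, hR, h⟩ := b.exists_pos_norm_lt
  exact ⟨R, hR, h⟩

lemma cum_zero {S : Set (X m)} {R : ℝ} (h : ∀ p ∈ S, ‖p‖ < R) {z : ℝ} (hz : z ≤ -R) : cum S z = 0 := by
  have : S ∩ {p | p.1 < z} = ∅ := by
    ext p; simp only [mem_inter_iff, mem_ofPred_eq, mem_empty_iff_false, iff_false, not_and, not_lt]
    intro hp
    have := (norm_fst_le p).trans_lt (h p hp)
    rw [Real.norm_eq_abs, abs_lt] at this
    linarith
  simp [cum, this]

lemma cum_top {S : Set (X m)} {R : ℝ} (h : ∀ p ∈ S, ‖p‖ < R) {z : ℝ} (hz : R ≤ z) : cum S z = volume.real S := by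
  have : S ∩ {p | p.1 < z} = S := by
    ext p; simp only [mem_inter_iff, mem_ofPred_eq, and_iff_left_iff_imp]
    intro hp
    have := (norm_fst_le p).trans_lt (h p hp)
    rw [Real.norm_eq_abs, abs_lt] at this
    linarith
  simp [cum, this]

lemma finrankY : Module.finrank ℝ (Y m) = m := by simp
lemma finrankX : Module.finrank ℝ (X m) = m + 1 := by simp [Module.finrank_prod, add_comm]

lemma vol_ballY (x : Y m) {r : ℝ} (hr : 0 < r) : volume.real (ball x r) = (2 * r) ^ m := by
  rw [Measure.real, Real.volume_pi_ball _ hr, ENNReal.toReal_ofReal (by positivity)]; simp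

lemma sl_le {S : Set (X m)} {R : ℝ} (hR : 0 < R) (h : ∀ p ∈ S, ‖p‖ < R) (s : ℝ) : sl S s ≤ (2 * R) ^ m := by
  rw [← vol_ballY 0 hR]
  apply mono _ isBounded_ball
  intro y hy
  rw [mem_ball_zero_iff]
  exact (norm_snd_le (s, y)).trans_lt (h _ hy)

lemma one_sub_pow_le (m : ℕ) {l : ℝ} (h1 : l ≤ 1) : 1 - m * l ≤ (1 - l) ^ m := by
  have := one_add_mul_le_pow (show (-2:ℝ) ≤ -l by linarith) m
  rw [← sub_eq_add_neg] at this
  linarith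

/-- shrinking a set towards a point -/
lemma vol_shrink {E : Type*} [NormedAddCommGroup E] [NormedSpace ℝ E] [MeasureSpace E] [BorelSpace E]
    [FiniteDimensional ℝ E] [(volume : Measure E).IsAddHaarMeasure] {n : ℕ} (hn : Module.finrank ℝ E = n)
    {A B : Set E} (bA : IsBounded A) (mB : MeasurableSet B) {l : ℝ} {y : E} (h0 : 0 ≤ l) (h1 : l ≤ 1)
    (hA : ∀ x ∈ A, (1 - l) • x + l • y ∈ A ∩ B) :
    volume.real (A \ B) ≤ n * l * volume.real A := by
  have hs : (l • y) +ᵥ ((1 - l) • A) ⊆ A ∩ B := by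
    rintro _ ⟨_, ⟨x, hx, rfl⟩, rfl⟩
    have := hA x hx
    simpa [add_comm] using this
  have h2 := mono hs (bA.subset inter_subset_left)
  rw [vol_vadd, vol_smul hn (by linarith)] at h2
  have h3 := measureReal_inter_add_sdiff (μ := volume) (s := A) mB (fin bA)
  have h4 := one_sub_pow_le n h1
  have h5 : (1 - n * l) * volume.real A ≤ (1 - l) ^ n * volume.real A := by
    gcongr
  linarith

lemma slice_diff {K : Set (X m)} (oK : IsOpen K) (cK : Convex ℝ K) (bK : IsBounded K) {q q' δ : ℝ} {y0 : Y m}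
    (hδ : 0 < δ) (hy : ∀ x, |x - q| ≤ δ → (x, y0) ∈ K) (hq : |q - q'| ≤ δ) :
    volume.real (slice K q \ slice K q') ≤ m * (|q - q'| / δ) * sl K q := by
  apply vol_shrink finrankY (slice_bdd bK q) (slice_open oK q').measurableSet (y := y0) (by positivity)
    ((div_le_one hδ).2 hq)
  intro x hx
  set l := |q - q'| / δ
  have hl0 : 0 ≤ l := by positivity
  have hl1 : l ≤ 1 := (div_le_one hδ).2 hq
  constructor
  · exact slice_convex cK q hx (hy q (by simp [hδ.le])) (by linarith) hl0 (by ring)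
  · have key : ∀ q2, |q2 - q| ≤ δ → (1 - l) * q + l * q2 = q' → (1 - l) • x + l • y0 ∈ slice K q' := by
      intro q2 h2 he
      have := cK hx (hy q2 h2) (show 0 ≤ 1 - l by linarith) hl0 (by ring)
      simp only [mem_slice]
      convert this using 1
      ext <;> simp [he]
    rcases le_total q q' with h | h
    · apply key (q + δ) (by simp [abs_of_pos hδ])
      have : l * δ = q' - q := by simp only [l]; rw [abs_of_nonpos (by linarith)]; field_simp; ring
      linarith
    · apply key (q - δ) (by simp [abs_of_pos hδ])
      have : l * δ = q - q' := by simp only [l]; rw [abs_of_nonneg (by linarith)]; field_simp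
      linarith

lemma sl_sub_le {K : Set (X m)} (oK : IsOpen K) (bK : IsBounded K) (q q' : ℝ) :
    sl K q - sl K q' ≤ volume.real (slice K q \ slice K q') := by
  have h3 := measureReal_inter_add_sdiff (μ := volume) (s := slice K q) (slice_open oK q').measurableSet (fin (slice_bdd bK q))
  have := mono (inter_subset_right (s := slice K q) (t := slice K q')) (slice_bdd bK q')
  unfold sl; linarith

/-- projection of K -/
def prj (K : Set (X m)) : Set ℝ := Prod.fst '' K

lemma mem_prj {K : Set (X m)} {q : ℝ} : q ∈ prj K ↔ (slice K q).Nonempty := by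
  constructor
  · rintro ⟨⟨a, y⟩, h, rfl⟩; exact ⟨y, h⟩
  · rintro ⟨y, h⟩; exact ⟨(q, y), h, rfl⟩

lemma prj_open {K : Set (X m)} (o : IsOpen K) : IsOpen (prj K) := isOpenMap_fst _ o
lemma prj_convex {K : Set (X m)} (c : Convex ℝ K) : Convex ℝ (prj K) := c.linear_image (LinearMap.fst ℝ ℝ (Y m))

lemma sl_pos {K : Set (X m)} (o : IsOpen K) (b : IsBounded K) {q : ℝ} (hq : q ∈ prj K) : 0 < sl K q :=
  vol_pos (slice_open o q) (mem_prj.1 hq) (slice_bdd b q)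

lemma sl_cont {K : Set (X m)} (oK : IsOpen K) (cK : Convex ℝ K) (bK : IsBounded K) {q0 : ℝ} (hq : q0 ∈ prj K) :
    ContinuousAt (sl K) q0 := by
  obtain ⟨⟨q1, y0⟩, hp, h⟩ := hq
  simp only at h; subst h
  obtain ⟨R, hR, hK⟩ := fst_bound bK
  obtain ⟨δ, hδ, hb⟩ := Metric.isOpen_iff.1 oK _ hp
  have hin : ∀ x, |x - q1| ≤ 2 * (δ / 4) → (x, y0) ∈ K := by
    intro x hx; apply hb; rw [mem_ball, Prod.dist_eq]; simp [Real.dist_eq, hδ]; linarith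
  set δ' := δ / 4
  have hδ' : 0 < δ' := by positivity
  have key : ∀ q q', |q - q1| ≤ δ' → |q - q'| ≤ δ' → sl K q - sl K q' ≤ m * (|q - q'| / δ') * (2 * R) ^ m := by
    intro q q' h1 h2
    refine (sl_sub_le oK bK q q').trans ((slice_diff (y0 := y0) oK cK bK hδ' ?_ h2).trans ?_)
    · intro x hx; apply hin
      calc |x - q1| = |(x - q) + (q - q1)| := by ring_nf
        _ ≤ _ := abs_add_le _ _
        _ ≤ _ := by linarith
    · gcongr; exact sl_le hR hK q
  have h2 : ∀ᶠ q in nhds q1, |sl K q - sl K q1| ≤ m * (|q - q1| / δ') * (2 * R) ^ m := by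
    filter_upwards [Metric.closedBall_mem_nhds q1 hδ'] with q hq
    rw [mem_closedBall, Real.dist_eq] at hq
    rw [abs_le]
    have a1 := key q q1 hq hq
    have a2 := key q1 q (by simp [hδ'.le]) (by rwa [abs_sub_comm])
    rw [abs_sub_comm q1 q] at a2
    constructor <;> linarith
  rw [ContinuousAt, tendsto_iff_dist_tendsto_zero]
  refine squeeze_zero' (Eventually.of_forall fun _ => dist_nonneg) h2 ?_
  have : Tendsto (fun q => m * (|q - q1| / δ') * (2 * R) ^ m) (nhds q1) (nhds (m * (|q1 - q1| / δ') * (2 * R) ^ m)) := by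
    apply Continuous.tendsto; fun_prop
  simpa using this

end QBM

namespace QBM
set_option linter.unusedSectionVars false
set_option linter.style.longLine false
set_option linter.unusedVariables false
set_option linter.unusedSimpArgs false

variable {m : ℕ}

lemma cum_nonneg (S : Set (X m)) (z : ℝ) : 0 ≤ cum S z := measureReal_nonneg
lemma cum_le {S : Set (X m)} (b : IsBounded S) (z : ℝ) : cum S z ≤ volume.real S := mono inter_subset_left b

lemma cum_strict {K : Set (X m)} (oK : IsOpen K) (cK : Convex ℝ K) (bK : IsBounded K) : StrictMonoOn (cum K) (prj K) := by
  intro q hq q' hq' h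
  have := cum_sub oK.measurableSet bK q q'
  have h2 : 0 < ∫ s in q..q', sl K s := by
    apply intervalIntegral.intervalIntegral_pos_of_pos_on (sl_integrable oK.measurableSet bK).intervalIntegrable _ h
    intro x hx
    apply sl_pos oK bK
    exact (prj_convex cK).ordConnected.out hq hq' ⟨hx.1.le, hx.2.le⟩
  linarith

lemma cum_mem {K : Set (X m)} (oK : IsOpen K) (cK : Convex ℝ K) (bK : IsBounded K) {q : ℝ} (hq : q ∈ prj K) :
    0 < cum K q ∧ cum K q < volume.real K := by
  obtain ⟨δ, hδ, hb⟩ := Metric.isOpen_iff.1 (prj_open oK) q hq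
  have h1 : q - δ / 2 ∈ prj K := hb (by simp [abs_of_pos hδ]; exact hδ)
  have h2 : q + δ / 2 ∈ prj K := hb (by simp [abs_of_pos hδ]; exact hδ)
  have := cum_strict oK cK bK h1 hq (by linarith)
  have := cum_strict oK cK bK hq h2 (by linarith)
  have := cum_nonneg K (q - δ / 2)
  have := cum_le bK (q + δ / 2)
  constructor <;> linarith

lemma cum_ivt {S : Set (X m)} (h : MeasurableSet S) (b : IsBounded S) {v : ℝ} (h0 : 0 ≤ v) (h1 : v ≤ volume.real S) :
    ∃ z, cum S z = v := by
  obtain ⟨R, hR, hS⟩ := fst_bound b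
  have := intermediate_value_Icc (show -R ≤ R by linarith) (cum_cont h b).continuousOn
  rw [cum_zero hS le_rfl, cum_top hS le_rfl] at this
  obtain ⟨z, _, hz⟩ := this ⟨h0, h1⟩
  exact ⟨z, hz⟩

lemma exists_Q {K : Set (X m)} (oK : IsOpen K) (cK : Convex ℝ K) (bK : IsBounded K) {v : ℝ} (h0 : 0 < v) (h1 : v < volume.real K) :
    ∃ q ∈ prj K, cum K q = v := by
  obtain ⟨q, hq⟩ := cum_ivt oK.measurableSet bK h0.le h1.le
  refine ⟨q, ?_, hq⟩
  by_contra hc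
  have hoc := (prj_convex cK).ordConnected
  have : (∀ p ∈ K, p.1 < q) ∨ (∀ p ∈ K, q < p.1) := by
    by_contra hcon
    push Not at hcon
    obtain ⟨⟨p, hp, hpq⟩, p', hp', hpq'⟩ := hcon
    exact hc (hoc.out ⟨p', hp', rfl⟩ ⟨p, hp, rfl⟩ ⟨hpq', hpq⟩)
  rcases this with h | h
  · have : K ∩ {p | p.1 < q} = K := inter_eq_left.2 h
    rw [cum, this] at hq; linarith
  · have : K ∩ {p | p.1 < q} = ∅ := by
      ext p; simp only [mem_inter_iff, mem_ofPred_eq, mem_empty_iff_false, iff_false, not_and, not_lt]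
      exact fun hp => (h p hp).le
    rw [cum, this] at hq; simp at hq; linarith

/-- the quantile function and its derivative -/
lemma exists_quantile {K : Set (X m)} (oK : IsOpen K) (cK : Convex ℝ K) (bK : IsBounded K) :
    ∃ Q : ℝ → ℝ, ∀ v, 0 < v → v < volume.real K → Q v ∈ prj K ∧ cum K (Q v) = v ∧
      HasDerivAt Q (sl K (Q v))⁻¹ v := by
  have : ∀ v, ∃ q, 0 < v → v < volume.real K → q ∈ prj K ∧ cum K q = v := by
    intro v
    by_cases h : 0 < v ∧ v < volume.real K
    · obtain ⟨q, h1, h2⟩ := exists_Q oK cK bK h.1 h.2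
      exact ⟨q, fun _ _ => ⟨h1, h2⟩⟩
    · exact ⟨0, fun h1 h2 => absurd ⟨h1, h2⟩ h⟩
  choose Q hQ using this
  refine ⟨Q, fun v h0 h1 => ⟨(hQ v h0 h1).1, (hQ v h0 h1).2, ?_⟩⟩
  obtain ⟨hq, hc⟩ := hQ v h0 h1
  have hev : ∀ᶠ v' in nhds v, 0 < v' ∧ v' < volume.real K := Ioo_mem_nhds h0 h1
  apply HasDerivAt.of_local_left_inverse (f := cum K)
  · rw [Metric.continuousAt_iff']
    intro ε hε
    obtain ⟨δ, hδ, hb⟩ := Metric.isOpen_iff.1 (prj_open oK) _ hq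
    set δ' := min (δ / 2) (ε / 2)
    have hδ' : 0 < δ' := by positivity
    have hl : δ' ≤ δ / 2 := min_le_left _ _
    have hr : δ' ≤ ε / 2 := min_le_right _ _
    have g1 : Q v - δ' ∈ prj K := hb (by simp [abs_of_pos hδ']; linarith)
    have g2 : Q v + δ' ∈ prj K := hb (by simp [abs_of_pos hδ']; linarith)
    have s1 := cum_strict oK cK bK g1 hq (by linarith)
    have s2 := cum_strict oK cK bK hq g2 (by linarith)
    rw [hc] at s1 s2
    filter_upwards [hev, Ioo_mem_nhds s1 s2] with v' hv' hv''
    obtain ⟨hq', hc'⟩ := hQ v' hv'.1 hv'.2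
    have i1 : Q v - δ' < Q v' := by
      rw [← (cum_strict oK cK bK).lt_iff_lt g1 hq', hc']; exact hv''.1
    have i2 : Q v' < Q v + δ' := by
      rw [← (cum_strict oK cK bK).lt_iff_lt hq' g2, hc']; exact hv''.2
    rw [Real.dist_eq, abs_lt]; constructor <;> linarith
  · exact cum_deriv oK.measurableSet bK (sl_cont oK cK bK hq)
  · exact (sl_pos oK bK hq).ne'
  · filter_upwards [hev] with v' hv' using (hQ v' hv'.1 hv'.2).2

/-- window -/
def JJ (F : Set (X m)) : Set ℝ := {s | 0 < cum F s ∧ cum F s < volume.real F}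

lemma JJ_open {F : Set (X m)} (h : MeasurableSet F) (b : IsBounded F) : IsOpen (JJ F) :=
  (isOpen_lt continuous_const (cum_cont h b)).inter (isOpen_lt (cum_cont h b) continuous_const)

/-- outside of JJ the slices are null a.e. -/
lemma JJ_integral {F : Set (X m)} (h : MeasurableSet F) (b : IsBounded F) :
    ∫ s in JJ F, sl F s = volume.real F := by
  rw [setIntegral_sl h b (JJ_open h b).measurableSet]
  obtain ⟨R, hR, hF⟩ := fst_bound b
  rcases (measureReal_nonneg (μ := volume) (s := F)).eq_or_lt with hV | hV
  · rw [← hV]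
    exact le_antisymm ((mono inter_subset_left b).trans hV.symm.le) measureReal_nonneg
  -- compare with interval
  apply le_antisymm (mono inter_subset_left b)
  apply le_of_forall_pos_le_add
  intro ε hε
  set e := min (ε / 2) (volume.real F / 3)
  have he : 0 < e := by positivity
  have he1 : e ≤ ε / 2 := min_le_left _ _
  have he2 : e ≤ volume.real F / 3 := min_le_right _ _
  obtain ⟨a, ha⟩ := cum_ivt h b he.le (by linarith)
  obtain ⟨c, hc⟩ := cum_ivt h b (v := volume.real F - e) (by linarith) (by linarith)
  have hsub : F ∩ Prod.fst ⁻¹' (Ico a c) ⊆ F ∩ Prod.fst ⁻¹' (JJ F) := by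
    apply inter_subset_inter_right
    intro p hp
    have h1 := cum_mono b hp.1
    have h2 := cum_mono b hp.2.le
    constructor <;> linarith
  have h3 := mono hsub (b.subset inter_subset_left)
  have hac : a ≤ c := by
    by_contra hlt; push Not at hlt
    have := cum_mono b hlt.le
    linarith
  have h4 : volume.real (F ∩ Prod.fst ⁻¹' (Ico a c)) = cum F c - cum F a := by
    rw [cum_sub h b, intervalIntegral.integral_of_le hac, ← setIntegral_congr_set Ico_ae_eq_Ioc, setIntegral_sl h b measurableSet_Ico]
  rw [ha, hc] at h4
  linarith

structure Core (F K : Set (X m)) (t : ℝ) (τ : ℝ → ℝ) (S : Set ℝ) : Prop where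
  mS : MeasurableSet S
  sub : S ⊆ JJ F
  full : volume (JJ F \ S) = 0
  mτ : Measurable τ
  cτ : ContinuousOn τ (JJ F)
  prop : ∀ s ∈ JJ F, τ s ∈ prj K ∧ cum K (τ s) = cum F s
  der : ∀ s ∈ S, HasDerivAt τ (sl F s / sl K (τ s)) s
  int : IntegrableOn (fun s => sl (F + t • K) (s + t * τ s) * (1 + t * (sl F s / sl K (τ s)))) S
  le : ∫ s in S, sl (F + t • K) (s + t * τ s) * (1 + t * (sl F s / sl K (τ s))) ≤ volume.real (F + t • K)

lemma exists_core {F K : Set (X m)} (P : Pair F K) {t : ℝ} (ht : 0 < t) : ∃ τ S, Core F K t τ S := by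
  obtain ⟨Q, hQ⟩ := exists_quantile P.oK P.cK P.bK
  have mK := P.oK.measurableSet
  classical
  have hJo := JJ_open P.mF P.bF
  set τ : ℝ → ℝ := (JJ F).piecewise (Q ∘ cum F) (fun _ => 0) with hτ
  have hτJ : ∀ s ∈ JJ F, τ s = Q (cum F s) := fun s hs => piecewise_eq_of_mem _ _ _ hs
  have hQc : ∀ s ∈ JJ F, ContinuousAt (Q ∘ cum F) s := fun s hs =>
    ContinuousAt.comp (hQ _ hs.1 (by rw [← P.vol]; exact hs.2)).2.2.continuousAt (cum_cont P.mF P.bF).continuousAt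
  have cQ : ContinuousOn (Q ∘ cum F) (JJ F) := fun s hs => (hQc s hs).continuousWithinAt
  have mτ : Measurable τ := cQ.measurable_piecewise continuousOn_const hJo.measurableSet
  have hprop : ∀ s ∈ JJ F, τ s ∈ prj K ∧ cum K (τ s) = cum F s := by
    intro s hs
    rw [hτJ s hs]
    have := hQ _ hs.1 (by rw [← P.vol]; exact hs.2)
    exact ⟨this.1, this.2.1⟩
  obtain ⟨N, hN, mN, N0⟩ := exists_measurable_superset_of_null (ae_iff.1 (cum_ae_deriv P.mF P.bF))
  have hder : ∀ s ∈ JJ F \ N, HasDerivAt τ (sl F s / sl K (τ s)) s := by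
    intro s hs
    have hd : HasDerivAt (cum F) (sl F s) s := by
      by_contra hc; exact hs.2 (hN hc)
    have := (hQ _ hs.1.1 (by rw [← P.vol]; exact hs.1.2)).2.2.comp s hd
    rw [← hτJ s hs.1, mul_comm, ← div_eq_mul_inv] at this
    apply this.congr_of_eventuallyEq
    filter_upwards [hJo.mem_nhds hs.1] with x hx using hτJ x hx
  have hmono : MonotoneOn τ (JJ F) := by
    intro x hx y hy hxy
    rw [← (cum_strict P.oK P.cK P.bK).le_iff_le (hprop x hx).1 (hprop y hy).1, (hprop x hx).2, (hprop y hy).2]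
    exact cum_mono P.bF hxy
  have mS : MeasurableSet (JJ F \ N) := hJo.measurableSet.diff mN
  have mU : MeasurableSet (F + t • K) := (P.oS ht).measurableSet
  have hlint : ∫⁻ s in JJ F \ N, ENNReal.ofReal (sl (F + t • K) (s + t * τ s) * (1 + t * (sl F s / sl K (τ s))))
      ≤ volume (F + t • K) := by
    have cov := lintegral_image_eq_lintegral_abs_deriv_mul mS (f := fun s => s + t * τ s)
      (f' := fun s => 1 + t * (sl F s / sl K (τ s)))
      (fun s hs => ((hasDerivAt_id s).add ((hder s hs).const_mul t)).hasDerivWithinAt) (by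
        intro x hx y hy hxy
        simp only at hxy
        rcases lt_trichotomy x y with h | h | h
        · have := hmono hx.1 hy.1 h.le
          nlinarith
        · exact h
        · have := hmono hy.1 hx.1 h.le
          nlinarith) (fun z => volume (slice (F + t • K) z))
    rw [← lint_slice mU]
    refine le_trans (le_of_eq ?_) (setLIntegral_le_lintegral ((fun s => s + t * τ s) '' (JJ F \ N)) _)
    rw [cov]
    refine lintegral_congr fun s => ?_
    have h0 : 0 ≤ sl F s / sl K (τ s) := div_nonneg (sl_nonneg _ _) (sl_nonneg _ _)
    rw [mul_comm, ENNReal.ofReal_mul (by positivity), ofReal_sl (P.bS t), abs_of_nonneg (by positivity)]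
  have mk : Measurable (sl K) := sl_meas mK
  have mf : Measurable (sl F) := sl_meas P.mF
  have mu : Measurable (sl (F + t • K)) := sl_meas mU
  have mint : Measurable (fun s => sl (F + t • K) (s + t * τ s) * (1 + t * (sl F s / sl K (τ s)))) := by
    have h1 := mk.comp mτ
    have h2 := mu.comp (measurable_id.add (mτ.const_mul t))
    exact h2.mul (measurable_const.add ((mf.div h1).const_mul t))
  have hnn : ∀ s, 0 ≤ sl (F + t • K) (s + t * τ s) * (1 + t * (sl F s / sl K (τ s))) := by
    intro s
    have h0 : 0 ≤ sl F s / sl K (τ s) := div_nonneg (sl_nonneg _ _) (sl_nonneg _ _)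
    exact mul_nonneg (sl_nonneg _ _) (by positivity)
  refine ⟨τ, JJ F \ N, mS, diff_subset, ?_, mτ, ?_, hprop, hder, ?_, ?_⟩
  · exact measure_mono_null (by intro x hx; by_contra h; exact hx.2 ⟨hx.1, h⟩) N0
  · exact cQ.congr hτJ
  · refine ⟨mint.aestronglyMeasurable, ?_⟩
    rw [hasFiniteIntegral_iff_ofReal (Eventually.of_forall hnn)]
    exact hlint.trans_lt (fin (P.bS t)).lt_top
  · rw [integral_eq_lintegral_of_nonneg_ae (Eventually.of_forall hnn) mint.aestronglyMeasurable]
    exact ENNReal.toReal_mono (fin (P.bS t)) hlint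

end QBM

namespace QBM
set_option linter.unusedSectionVars false
set_option linter.style.longLine false
set_option linter.unusedVariables false
set_option linter.unusedSimpArgs false
variable {m : ℕ}

lemma slice_sum (F K : Set (X m)) (t s q : ℝ) :
    slice F s + t • slice K q ⊆ slice (F + t • K) (s + t * q) := by
  rintro _ ⟨x, hx, _, ⟨y, hy, rfl⟩, rfl⟩
  exact ⟨(s, x), hx, (t * q, t • y), ⟨(q, y), hy, by simp⟩, by simp⟩

lemma exists_a (hm : 1 ≤ m) {f k : ℝ} (hf : 0 < f) (hk : 0 < k) : ∃ a, 0 < a ∧ a ^ m * (f / k) = 1 := by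
  refine ⟨(k / f) ^ ((m:ℝ)⁻¹), by positivity, ?_⟩
  rw [Real.rpow_inv_natCast_pow (by positivity) (by omega)]; field_simp

lemma pt_u (hm : 1 ≤ m) (hB : BMp (Y m) m) {F K : Set (X m)} (P : Pair F K) {t : ℝ} (ht : 0 < t) {s q a : ℝ}
    (hf : 0 < sl F s) (hq : q ∈ prj K) (ha : 0 < a) (h : a ^ m * (sl F s / sl K q) = 1) :
    (1 + t * a) ^ m * sl F s ≤ sl (F + t • K) (s + t * q) := by
  have hk : 0 < sl K q := sl_pos P.oK P.bK hq
  set f := sl F s with hfd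
  set k := sl K q with hkd
  have hm0 : m ≠ 0 := by omega
  set A := f ^ ((m:ℝ)⁻¹)
  have hA : A ^ m = f := Real.rpow_inv_natCast_pow hf.le hm0
  have hA0 : 0 < A := by positivity
  have hk2 : k = (a * A) ^ m := by rw [mul_pow, hA]; field_simp at h; linarith
  have hbk : IsBounded (slice K q) := slice_bdd P.bK q
  have := BM_gen (E := Y m) hm0 finrankY hB (F := slice F s) (K := t • slice K q) (slice_bdd P.bF s) (slice_meas P.mF s)
    ((slice_open P.oK q).smul₀ ht.ne') ((slice_convex P.cK q).smul t) (hbk.smul₀ t) (A := A) (B := t * (a * A)) hA0 (by positivity)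
    hA.le (by rw [vol_smul finrankY ht.le, mul_pow t, ← hk2]; rfl)
  calc (1 + t * a) ^ m * f = (A + t * (a * A)) ^ m := by rw [← hA, ← mul_pow]; congr 1; ring
    _ ≤ _ := this
    _ ≤ _ := mono (slice_sum F K t s q) (slice_bdd (P.bS t) _)

/-- excess -/
def exc (F K : Set (X m)) (t : ℝ) (τ : ℝ → ℝ) (s : ℝ) : ℝ :=
  sl (F + t • K) (s + t * τ s) * (1 + t * (sl F s / sl K (τ s))) - (1 + t) ^ (m + 1) * sl F s

lemma exc_ge (hm : 1 ≤ m) (hB : BMp (Y m) m) {F K : Set (X m)} (P : Pair F K) {t : ℝ} (ht : 0 < t) {τ : ℝ → ℝ} {s a : ℝ}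
    (hf : 0 < sl F s) (hq : τ s ∈ prj K) (ha : 0 < a) (h : a ^ m * (sl F s / sl K (τ s)) = 1) :
    t * sl F s * (m * a + sl F s / sl K (τ s) - (m + 1)) ≤ exc F K t τ s := by
  have hk : 0 < sl K (τ s) := sl_pos P.oK P.bK hq
  have h1 := pt_u hm hB P ht hf hq ha h
  have h2 := A1 m hm ha ht.le h
  have h3 : (1 + t * a) ^ m * sl F s * (1 + t * (sl F s / sl K (τ s))) ≤ sl (F + t • K) (s + t * τ s) * (1 + t * (sl F s / sl K (τ s))) := by
    gcongr
  have h4 := mul_le_mul_of_nonneg_left h2 hf.le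
  unfold exc
  linarith

lemma exc_nonneg (hm : 1 ≤ m) (hB : BMp (Y m) m) {F K : Set (X m)} (P : Pair F K) {t : ℝ} (ht : 0 < t) {τ : ℝ → ℝ} {s : ℝ}
    (hq : τ s ∈ prj K) : 0 ≤ exc F K t τ s := by
  have hk : 0 < sl K (τ s) := sl_pos P.oK P.bK hq
  rcases (sl_nonneg F s).eq_or_lt with hf | hf
  · unfold exc; rw [← hf]; simp; exact sl_nonneg _ _
  · obtain ⟨a, ha, h⟩ := exists_a hm hf hk
    refine le_trans ?_ (exc_ge hm hB P ht hf hq ha h)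
    have := E_nonneg m hm ha h
    positivity

lemma Core.int_f {F K : Set (X m)} (P : Pair F K) {t : ℝ} {τ S} (c : Core F K t τ S) :
    ∫ s in S, sl F s = volume.real K := by
  rw [← P.vol, ← JJ_integral P.mF P.bF]
  refine (setIntegral_congr_set ?_)
  refine Filter.EventuallyEq.symm ?_ 
  rw [ae_eq_set]
  exact ⟨c.full, by rw [sdiff_eq_empty.2 c.sub]; simp⟩

lemma Core.exc_int {F K : Set (X m)} (P : Pair F K) {t : ℝ} {τ S} (c : Core F K t τ S) :
    IntegrableOn (exc F K t τ) S :=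
  c.int.sub ((sl_integrable P.mF P.bF).integrableOn.const_mul _)

lemma Core.exc_le {F K : Set (X m)} (P : Pair F K) {t : ℝ} {τ S} (c : Core F K t τ S) :
    ∫ s in S, exc F K t τ s ≤ volume.real (F + t • K) - (1 + t) ^ (m + 1) * volume.real K := by
  unfold exc
  rw [integral_sub c.int ((sl_integrable P.mF P.bF).integrableOn.const_mul _), integral_const_mul, c.int_f P]
  linarith [c.le]

lemma BMp_succ (hm : 1 ≤ m) (hB : BMp (Y m) m) : BMp (X m) (m + 1) := by
  intro F K P t ht
  obtain ⟨τ, S, c⟩ := exists_core P ht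
  have := c.exc_le P
  have h2 : 0 ≤ ∫ s in S, exc F K t τ s := 
    setIntegral_nonneg c.mS fun s hs => exc_nonneg hm hB P ht (c.prop s (c.sub hs)).1
  linarith

end QBM

namespace QBM
set_option linter.unusedSectionVars false
set_option linter.style.longLine false
set_option linter.unusedVariables false
set_option linter.unusedSimpArgs false
variable {m : ℕ}

structure Geo (K : Set (X m)) (y0 : Y m) (r R : ℝ) : Prop where
  hr : 0 < r
  hR : 0 < R
  ball : ball ((0 : ℝ), y0) r ⊆ K
  bd : ∀ p ∈ K, ‖p‖ < R

lemma cum_inc_le {S : Set (X m)} (h : MeasurableSet S) (b : IsBounded S) {a c M : ℝ} (hac : a ≤ c)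
    (hM : ∀ s ∈ Ioo a c, sl S s ≤ M) : cum S c - cum S a ≤ M * (c - a) := by
  rw [cum_sub h b]
  have : ∫ s in a..c, sl S s ≤ ∫ s in a..c, M := 
    intervalIntegral.integral_mono_on_of_le_Ioo hac (sl_integrable h b).intervalIntegrable (by simp) hM
  simpa [mul_comm] using this

lemma cum_inc_ge {S : Set (X m)} (h : MeasurableSet S) (b : IsBounded S) {a c M : ℝ} (hac : a ≤ c)
    (hM : ∀ s ∈ Ioo a c, M ≤ sl S s) : M * (c - a) ≤ cum S c - cum S a := by
  rw [cum_sub h b]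
  have : ∫ s in a..c, M ≤ ∫ s in a..c, sl S s := 
    intervalIntegral.integral_mono_on_of_le_Ioo hac (by simp) (sl_integrable h b).intervalIntegrable hM
  simpa [mul_comm] using this

lemma cum_lip {S : Set (X m)} (h : MeasurableSet S) (b : IsBounded S) {R : ℝ} (hR : 0 < R) (hb : ∀ p ∈ S, ‖p‖ < R) (a c : ℝ) :
    |cum S c - cum S a| ≤ (2 * R) ^ m * |c - a| := by
  rcases le_total a c with h' | h'
  · rw [abs_of_nonneg (sub_nonneg.2 (cum_mono b h')), abs_of_nonneg (sub_nonneg.2 h')]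
    exact cum_inc_le h b h' fun s _ => sl_le hR hb s
  · rw [abs_sub_comm, abs_sub_comm c, abs_of_nonneg (sub_nonneg.2 (cum_mono b h')), abs_of_nonneg (sub_nonneg.2 h')]
    exact cum_inc_le h b h' fun s _ => sl_le hR hb s

lemma cone_slice {K : Set (X m)} {y0 : Y m} {r R : ℝ} (G : Geo K y0 r R) (cK : Convex ℝ K) (bK : IsBounded K) {p : X m} (hp : p ∈ K) {l : ℝ}
    (h0 : 0 < l) (h1 : l ≤ 1) : (2 * (l * r)) ^ m ≤ sl K ((1 - l) * p.1) := by
  have hr := G.hr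
  rw [← vol_ballY ((1 - l) • p.2 + l • y0) (by positivity : 0 < l * r)]
  apply mono _ (slice_bdd bK _)
  intro y hy
  rw [mem_slice]
  set w : Y m := l⁻¹ • (y - (1 - l) • p.2) with hw
  have hwK : ((0:ℝ), w) ∈ K := by
    apply G.ball
    rw [mem_ball_iff_norm, Prod.mk_sub_mk, sub_self, Prod.norm_mk, norm_zero]
    rw [mem_ball_iff_norm] at hy
    have : w - y0 = l⁻¹ • (y - ((1 - l) • p.2 + l • y0)) := by
      rw [hw, ← sub_sub, smul_sub l⁻¹ _ (l • y0), smul_smul, inv_mul_cancel₀ h0.ne', one_smul]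
    rw [this, norm_smul, norm_inv, Real.norm_of_nonneg h0.le]
    apply max_lt hr
    rw [inv_mul_lt_iff₀ h0]; exact hy
  have := cK hp hwK (by linarith : 0 ≤ 1 - l) h0.le (by ring)
  convert this using 1
  ext1
  · simp
  · simp [hw, smul_smul, mul_inv_cancel₀ h0.ne']

lemma sl_lower {K : Set (X m)} {y0 : Y m} {r R : ℝ} (G : Geo K y0 r R) (oK : IsOpen K) (cK : Convex ℝ K) (bK : IsBounded K) {v q : ℝ} (hv : 0 < v)
    (h1 : v ≤ cum K q) (h2 : cum K q ≤ volume.real K - v) :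
    (2 * (min 1 (v / (2 * (2 * R) ^ m) / R) * r)) ^ m ≤ sl K q := by
  have hr := G.hr
  have hR := G.hR
  set η := v / (2 * (2 * R) ^ m) with hη
  have hη0 : 0 < η := by positivity
  have mK := oK.measurableSet
  have hsl := sl_le hR G.bd
  have hηv : (2 * R) ^ m * η = v / 2 := by rw [hη]; field_simp
  have h0 : ((0:ℝ), y0) ∈ K := G.ball (mem_ball_self hr)
  have key : ∃ p ∈ K, ∃ l, min 1 (η / R) ≤ l ∧ l ≤ 1 ∧ q = (1 - l) * p.1 := by
    rcases le_total q 0 with hq | hq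
    · have : ∃ p ∈ K, p.1 ≤ q - η := by
        by_contra hc
        push Not at hc
        have hz : cum K (q - η) = 0 := by
          have : K ∩ {p | p.1 < q - η} = ∅ := by
            ext p; simp only [mem_inter_iff, mem_ofPred_eq, mem_empty_iff_false, iff_false, not_and, not_lt]
            exact fun hp => (hc p hp).le
          rw [cum, this]; simp
        have := cum_inc_le mK bK (show q - η ≤ q by linarith) (fun s _ => hsl s)
        rw [hz] at this
        have h3 : q - (q - η) = η := by ring
        rw [h3, hηv] at this
        linarith
      obtain ⟨p, hp, hpq⟩ := this
      have hpR := G.bd p hp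
      have hp1 : |p.1| < R := lt_of_le_of_lt (norm_fst_le p) hpR
      rw [abs_lt] at hp1
      have hneg : p.1 < 0 := by linarith
      refine ⟨p, hp, (q - p.1) / (-p.1), (min_le_right _ _).trans ?_, ?_, ?_⟩
      · apply div_le_div₀ <;> linarith
      · rw [div_le_one] <;> linarith
      · have : p.1 ≠ 0 := hneg.ne
        field_simp; ring
    · have : ∃ p ∈ K, q + η ≤ p.1 := by
        by_contra hc
        push Not at hc
        have hz : cum K (q + η) = volume.real K := by
          have : K ∩ {p | p.1 < q + η} = K := inter_eq_left.2 hc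
          rw [cum, this]
        have := cum_inc_le mK bK (show q ≤ q + η by linarith) (fun s _ => hsl s)
        rw [hz] at this
        have h3 : q + η - q = η := by ring
        rw [h3, hηv] at this
        linarith
      obtain ⟨p, hp, hpq⟩ := this
      have hpR := G.bd p hp
      have hp1 : |p.1| < R := lt_of_le_of_lt (norm_fst_le p) hpR
      rw [abs_lt] at hp1
      have hpos : 0 < p.1 := by linarith
      refine ⟨p, hp, (p.1 - q) / p.1, (min_le_right _ _).trans ?_, ?_, ?_⟩
      · apply div_le_div₀ <;> linarith
      · rw [div_le_one] <;> linarith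
      · field_simp; ring
  obtain ⟨p, hp, l, hl, hl1, rfl⟩ := key
  have : 0 < min 1 (η / R) := by positivity
  refine le_trans ?_ (cone_slice G cK bK hp (lt_of_lt_of_le this hl) hl1)
  gcongr

/-- uniform bulk lower bound constant -/
lemma exists_kappa (m : ℕ) {r R v : ℝ} (hr : 0 < r) (hR : 0 < R) (hv : 0 < v) : ∃ κ : ℝ, 0 < κ ∧ 
    ∀ (K : Set (X m)) (y0 : Y m), Geo K y0 r R → IsOpen K → Convex ℝ K → IsBounded K → ∀ q, v ≤ cum K q → cum K q ≤ volume.real K - v →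
      κ ≤ sl K q ∧ q ∈ prj K := by
  refine ⟨(2 * (min 1 (v / (2 * (2 * R) ^ m) / R) * r)) ^ m, by positivity, ?_⟩
  intro K y0 G oK cK bK q h1 h2
  have := sl_lower G oK cK bK hv h1 h2
  refine ⟨this, mem_prj.2 ?_⟩
  apply nonempty_of_pos
  exact lt_of_lt_of_le (by positivity) this

/-- volume lower bounds near zero -/
lemma Geo.sl_ge {K : Set (X m)} {y0 : Y m} {r R : ℝ} (G : Geo K y0 r R) (bK : IsBounded K) {q : ℝ} (hq : |q| < r) :
    (2 * r) ^ m ≤ sl K q := by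
  rw [← vol_ballY y0 G.hr]
  apply mono _ (slice_bdd bK _)
  intro y hy
  apply G.ball
  rw [mem_ball, Prod.dist_eq]
  exact max_lt (by simpa using hq) hy

lemma Geo.cum_ge {K : Set (X m)} {y0 : Y m} {r R : ℝ} (G : Geo K y0 r R) (oK : IsOpen K) (bK : IsBounded K) {q : ℝ} (hq : |q| ≤ r) :
    (2 * r) ^ m * (r + q) ≤ cum K q ∧ (2 * r) ^ m * (r - q) ≤ volume.real K - cum K q := by
  have mK := oK.measurableSet
  rw [abs_le] at hq
  have h1 := cum_inc_ge mK bK (show -r ≤ q by linarith) (fun s hs => G.sl_ge bK (abs_lt.2 ⟨hs.1, by linarith [hs.2]⟩))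
  have h2 := cum_inc_ge mK bK (show q ≤ r by linarith) (fun s hs => G.sl_ge bK (abs_lt.2 ⟨by linarith [hs.1], hs.2⟩))
  have := cum_nonneg K (-r)
  have := cum_le bK r
  constructor
  · have : q - -r = r + q := by ring
    rw [this] at h1; linarith
  · linarith

lemma Geo.vol_le {K : Set (X m)} {y0 : Y m} {r R : ℝ} (G : Geo K y0 r R) (oK : IsOpen K) (bK : IsBounded K) :
    volume.real K ≤ (2 * R) ^ m * (2 * R) := by
  have := cum_lip oK.measurableSet bK G.hR G.bd (-R) R
  rw [cum_zero G.bd le_rfl, cum_top G.bd le_rfl, sub_zero] at this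
  refine (le_abs_self _).trans (this.trans_eq ?_)
  congr 1; rw [abs_of_nonneg] <;> linarith [G.hR]

lemma Geo.vol_ge {K : Set (X m)} {y0 : Y m} {r R : ℝ} (G : Geo K y0 r R) (oK : IsOpen K) (bK : IsBounded K) :
    (2 * r) ^ m * (2 * r) ≤ volume.real K := by
  have := G.cum_ge oK bK (q := 0) (by simpa using G.hr.le)
  simp at this
  linarith

end QBM

namespace QBM
set_option linter.unusedSectionVars false
set_option linter.style.longLine false
set_option linter.unusedVariables false
set_option linter.unusedSimpArgs false
variable {m : ℕ}

lemma tail_eq {S : Set (X m)} (h : MeasurableSet S) (b : IsBounded S) (z : ℝ) :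
    volume.real (S ∩ {p | z < p.1}) = volume.real S - cum S z := by
  have h1 := setIntegral_sl h b (measurableSet_Ioi (a := z))
  have h2 : cum S z = ∫ s in Iic z, sl S s := by rw [cum_eq h b, integral_Iic_eq_integral_Iio]
  have h3 := intervalIntegral.integral_Iic_add_Ioi (b := z) (sl_integrable h b).integrableOn (sl_integrable h b).integrableOn
  rw [integral_sl h b] at h3
  have : S ∩ Prod.fst ⁻¹' Ioi z = S ∩ {p | z < p.1} := rfl
  rw [← this, ← h1]; linarith

lemma pow_one_add_le (n : ℕ) {x : ℝ} (h0 : 0 ≤ x) (h1 : x ≤ 1) : (1 + x) ^ n ≤ 1 + (2 ^ n - 1) * x := by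
  induction n with
  | zero => simp
  | succ n ih =>
    have h2 : (1:ℝ) ≤ 2 ^ n := one_le_pow₀ (by norm_num)
    calc (1 + x) ^ (n + 1) = (1 + x) ^ n * (1 + x) := pow_succ _ _
      _ ≤ (1 + (2 ^ n - 1) * x) * (1 + x) := by gcongr
      _ = 1 + 2 ^ n * x + (2 ^ n - 1) * (x * x) := by ring
      _ ≤ 1 + 2 ^ n * x + (2 ^ n - 1) * (x * 1) := by
          have : 0 ≤ (2:ℝ) ^ n - 1 := by linarith
          gcongr
      _ = _ := by rw [pow_succ]; ring

lemma pow_add_ge (n : ℕ) (hn : n ≠ 0) {A d : ℝ} (hA : 1 ≤ A) (hd : 0 ≤ d) : A ^ n + d ≤ (A + d) ^ n := by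
  obtain ⟨k, rfl⟩ := Nat.exists_eq_succ_of_ne_zero hn
  have h1 : A ^ k ≤ (A + d) ^ k := by gcongr; linarith
  have h2 : 1 ≤ (A + d) ^ k := one_le_pow₀ (by linarith)
  rw [Nat.succ_eq_add_one, pow_succ, pow_succ]
  nlinarith

lemma half_est {n : ℕ} (hn : n ≠ 0) (hnr : Module.finrank ℝ (X m) = n) (hB : BMp (X m) n) {F K : Set (X m)} (bF : IsBounded F) (mF : MeasurableSet F) (oK : IsOpen K)
    (cK : Convex ℝ K) (bK : IsBounded K) {t v x : ℝ} (ht : 0 < t) (ht1 : t ≤ 1) (hv : 0 < v) (hx : 0 < x) (hx1 : x ≤ 1)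
    (h1 : v * (1 - t * (x / 2)) ≤ volume.real F) (h2 : v * (1 + 2 ^ n * x) ≤ volume.real K) :
    v * ((1 + t) ^ n + t * (x / 2)) ≤ volume.real (F + t • K) := by
  set a := v ^ ((n:ℝ)⁻¹)
  have ha : 0 < a := by positivity
  have hav : a ^ n = v := Real.rpow_inv_natCast_pow hv.le hn
  have hp : 0 < 1 - t * (x / 2) := by nlinarith
  have := BM_gen hn hnr hB bF mF (K := t • K) (oK.smul₀ ht.ne') (cK.smul t) (bK.smul₀ t) (A := a * (1 - t * (x / 2)))
    (B := t * (a * (1 + x))) (by positivity) (by positivity) (by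
      rw [mul_pow, hav]; refine le_trans ?_ h1
      gcongr
      exact pow_le_of_le_one hp.le (by linarith [show 0 ≤ t * (x/2) by positivity]) hn) (by
      rw [vol_smul hnr ht.le, mul_pow, mul_pow, hav]
      gcongr
      refine le_trans ?_ h2
      gcongr
      refine (pow_one_add_le n hx.le hx1).trans ?_
      gcongr; linarith)
  refine le_trans ?_ this
  have e : a * (1 - t * (x / 2)) + t * (a * (1 + x)) = a * ((1 + t) + t * (x / 2)) := by ring
  rw [e, mul_pow, hav]
  gcongr
  exact pow_add_ge n hn (by linarith) (by positivity)

lemma claimA (hB : BMp (X m) (m + 1)) {r R v1 η : ℝ} (hr : 0 < r) (hR : 0 < R) (hv1 : 0 < v1) (hη : 0 < η) (hη1 : (2 * R) ^ m * η ≤ v1 / 2) :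
    ∃ β ε0 : ℝ, 0 < β ∧ 0 < ε0 ∧ ∀ (F K : Set (X m)) (y0 : Y m), Pair F K → Geo K y0 r R → ∀ t, 0 < t → t ≤ 1 →
      volume.real (F + t • K) ≤ (1 + t) ^ (m + 1) * volume.real K + t * ε0 ^ 2 → ∀ s q, cum K q = cum F s →
        v1 ≤ cum F s → cum F s ≤ volume.real K - v1 → ∃ s', |s' - s| < t * η ∧ β ≤ sl F s' := by
  obtain ⟨κ, hκ, hκp⟩ := exists_kappa m hr hR (show 0 < v1 / 2 by positivity)
  set Vm := (2 * R) ^ m * (2 * R) with hVm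
  have hVm0 : 0 < Vm := by positivity
  set x := min 1 (κ * η / Vm / 2 ^ (m + 1)) with hx
  have hx0 : 0 < x := by positivity
  have hx1 : x ≤ 1 := min_le_left _ _
  have hx2 : Vm * (2 ^ (m + 1) * x) ≤ κ * η := by
    have : x ≤ κ * η / Vm / 2 ^ (m + 1) := min_le_right _ _
    rw [div_div, le_div_iff₀ (by positivity)] at this
    linarith
  refine ⟨x / 2 * v1 / η, Real.sqrt ((2 * r) ^ m * (2 * r) * (x / 4)), by positivity, by positivity, ?_⟩
  intro F K y0 P G t ht ht1 hdef s q hqs h1 h2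
  rw [Real.sq_sqrt (by positivity)] at hdef
  by_contra hc
  push Not at hc
  set V := volume.real K with hV
  set v := cum F s with hv
  have mK := P.oK.measurableSet
  have htη : 0 < t * η := by positivity
  have hlip := cum_lip mK P.bK G.hR G.bd
  have hk : ∀ z, |z - q| ≤ η → κ ≤ sl K z := by
    intro z hz
    have h3 := hlip q z
    have h4 : |cum K z - cum K q| ≤ v1 / 2 := h3.trans (le_trans (by gcongr) hη1)
    rw [abs_le, hqs] at h4
    exact (hκp K y0 G P.oK P.cK P.bK z (by linarith) (by linarith)).1
  have hVle : V ≤ Vm := G.vol_le P.oK P.bK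
  have hVge := G.vol_ge P.oK P.bK
  have i1 := cum_inc_ge mK P.bK (show q ≤ q + η by linarith) (M := κ) (fun z hz => hk z (by rw [abs_le]; constructor <;> linarith [hz.1, hz.2]))
  have i2 := cum_inc_ge mK P.bK (show q - η ≤ q by linarith) (M := κ) (fun z hz => hk z (by rw [abs_le]; constructor <;> linarith [hz.1, hz.2]))
  have i3 := cum_inc_le P.mF P.bF (show s ≤ s + t * η by linarith) (M := x / 2 * v1 / η) (fun z hz => (hc z (by rw [abs_lt]; constructor <;> linarith [hz.1, hz.2])).le)
  have i4 := cum_inc_le P.mF P.bF (show s - t * η ≤ s by linarith) (M := x / 2 * v1 / η) (fun z hz => (hc z (by rw [abs_lt]; constructor <;> linarith [hz.1, hz.2])).le)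
  have e3 : x / 2 * v1 / η * (s + t * η - s) = t * (x / 2) * v1 := by field_simp; ring
  have e4 : x / 2 * v1 / η * (s - (s - t * η)) = t * (x / 2) * v1 := by field_simp; ring
  rw [e3] at i3; rw [e4] at i4
  have e1 : κ * (q + η - q) = κ * η := by ring
  have e2 : κ * (q - (q - η)) = κ * η := by ring
  rw [e1] at i1; rw [e2] at i2
  have bnd : ∀ w, 0 ≤ w → w ≤ V → w * (2 ^ (m + 1) * x) ≤ κ * η := fun w hw0 hw => by
    refine le_trans ?_ hx2
    have := hw.trans hVle
    gcongr
  have htx : 0 ≤ t * (x / 2) := by positivity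
  have cc1 : Convex ℝ {p : X m | p.1 < q + η} := convex_halfSpace_lt (LinearMap.fst ℝ ℝ (Y m)).isLinear _
  have cc2 : Convex ℝ {p : X m | q - η < p.1} := convex_halfSpace_gt (LinearMap.fst ℝ ℝ (Y m)).isLinear _
  have oo1 : IsOpen {p : X m | p.1 < q + η} := isOpen_lt continuous_fst continuous_const
  have oo2 : IsOpen {p : X m | q - η < p.1} := isOpen_lt continuous_const continuous_fst
  have mm1 : MeasurableSet {p : X m | p.1 < s - t * η} := measurableSet_lt measurable_fst measurable_const
  have mm2 : MeasurableSet {p : X m | s + t * η < p.1} := measurableSet_lt measurable_const measurable_fst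
  have H1 := half_est (m := m) (n := m + 1) (by omega) finrankX hB (F := F ∩ {p | p.1 < s - t * η}) (K := K ∩ {p | p.1 < q + η})
    (P.bF.subset inter_subset_left) (P.mF.inter mm1) (P.oK.inter oo1)
    (P.cK.inter cc1) (P.bK.subset inter_subset_left) ht ht1 (v := v) (by linarith) hx0 hx1
    (by
      change _ ≤ cum F (s - t * η)
      have := mul_le_mul_of_nonneg_left h1 htx
      linarith)
    (by
      change _ ≤ cum K (q + η)
      have := bnd v (by linarith) (by linarith)
      linarith)
  have H2 := half_est (m := m) (n := m + 1) (by omega) finrankX hB (F := F ∩ {p | s + t * η < p.1}) (K := K ∩ {p | q - η < p.1})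
    (P.bF.subset inter_subset_left) (P.mF.inter mm2) (P.oK.inter oo2)
    (P.cK.inter cc2) (P.bK.subset inter_subset_left) ht ht1 (v := V - v) (by linarith) hx0 hx1
    (by
      rw [tail_eq P.mF P.bF, P.vol]
      have := mul_le_mul_of_nonneg_left (show v1 ≤ V - v by linarith) htx
      linarith)
    (by
      rw [tail_eq mK P.bK]
      have := bnd (V - v) (by linarith) (by linarith)
      linarith)
  set A1 := F ∩ {p | p.1 < s - t * η} + t • (K ∩ {p | p.1 < q + η}) with hA1
  set A2 := F ∩ {p | s + t * η < p.1} + t • (K ∩ {p | q - η < p.1}) with hA2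
  have hs1 : A1 ⊆ F + t • K := add_subset_add inter_subset_left (smul_set_mono inter_subset_left)
  have hs2 : A2 ⊆ F + t • K := add_subset_add inter_subset_left (smul_set_mono inter_subset_left)
  have hd : Disjoint A1 A2 := by
    rw [Set.disjoint_left]
    rintro _ ⟨a, ⟨_, ha⟩, _, ⟨b, ⟨_, hb⟩, rfl⟩, rfl⟩ ⟨a', ⟨_, ha'⟩, _, ⟨b', ⟨_, hb'⟩, rfl⟩, heq⟩
    simp only [mem_ofPred_eq] at ha hb ha' hb'
    have := congrArg Prod.fst heq
    simp at this
    nlinarith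
  have o2 : IsOpen A2 := IsOpen.add_left ((P.oK.inter oo2).smul₀ ht.ne')
  have hu := measureReal_union (μ := volume) hd o2.measurableSet (fin ((P.bS t).subset hs1)) (fin ((P.bS t).subset hs2))
  have hle := mono (union_subset hs1 hs2) (P.bS t)
  have : V * ((1 + t) ^ (m + 1) + t * (x / 2)) ≤ (1 + t) ^ (m + 1) * V + t * ((2 * r) ^ m * (2 * r) * (x / 4)) := by linarith
  have h5 : t * ((2 * r) ^ m * (2 * r) * (x / 4)) ≤ t * (V * (x / 4)) := by gcongr
  have h6 : 0 < t * (V * (x / 4)) := by have := P.pos; positivity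
  linarith

end QBM

namespace QBM
set_option linter.unusedSectionVars false
set_option linter.style.longLine false
set_option linter.unusedVariables false
set_option linter.unusedSimpArgs false
variable {m : ℕ}

section general
variable {E : Type*} [NormedAddCommGroup E] [NormedSpace ℝ E] [MeasureSpace E]
variable [BorelSpace E] [FiniteDimensional ℝ E] [(volume : Measure E).IsAddHaarMeasure]

lemma bdd_sd {A B : Set E} (bA : IsBounded A) (bB : IsBounded B) : IsBounded (symmDiff A B) :=
  (bA.union bB).subset symmDiff_le_sup

lemma sd_tri {A B C : Set E} (bA : IsBounded A) (bB : IsBounded B) (bC : IsBounded C) : 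
    volume.real (symmDiff A C) ≤ volume.real (symmDiff A B) + volume.real (symmDiff B C) := by
  refine (mono (symmDiff_triangle A B C) ((bdd_sd bA bB).union (bdd_sd bB bC))).trans ?_
  exact measureReal_union_le _ _

lemma sd_le_add {A B : Set E} (bA : IsBounded A) (bB : IsBounded B) :
    volume.real (symmDiff A B) ≤ volume.real A + volume.real B := by
  refine (mono symmDiff_le_sup (bA.union bB)).trans ?_
  exact measureReal_union_le _ _

lemma sd_vadd (x : E) (A B : Set E) : volume.real (symmDiff (x +ᵥ A) (x +ᵥ B)) = volume.real (symmDiff A B) := by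
  rw [← Set.vadd_set_symmDiff, vol_vadd]

lemma vol_sub_le {A B : Set E} (bA : IsBounded A) (bB : IsBounded B) :
    volume.real A - volume.real B ≤ volume.real (A \ B) := by
  have : volume.real A ≤ volume.real (B ∪ (A \ B)) := mono (by simp) (bB.union (bA.subset sdiff_subset))
  have := this.trans (measureReal_union_le _ _)
  linarith

lemma abs_vol_sub_le {A B : Set E} (bA : IsBounded A) (bB : IsBounded B) :
    |volume.real A - volume.real B| ≤ volume.real (symmDiff A B) := by
  have h1 := vol_sub_le bA bB
  have h2 := vol_sub_le bB bA
  have h3 : volume.real (A \ B) ≤ volume.real (symmDiff A B) := mono le_sup_left (bdd_sd bA bB)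
  have h4 : volume.real (B \ A) ≤ volume.real (symmDiff A B) := mono le_sup_right (bdd_sd bA bB)
  rw [abs_le]; constructor <;> linarith

lemma sd_nested {A B : Set E} (h : A ⊆ B) (mA : MeasurableSet A) (bB : IsBounded B) :
    volume.real (symmDiff A B) = volume.real B - volume.real A := by
  rw [symmDiff_of_le h]
  exact measureReal_sdiff h mA (fin (bB))
end general

lemma scale_sub {K : Set (Y m)} (cK : Convex ℝ K) {y : Y m} (hy : y ∈ K) {b : ℝ} (h0 : 0 ≤ b) (h1 : b ≤ 1) :
    ((1 - b) • y) +ᵥ (b • K) ⊆ K := by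
  rintro _ ⟨_, ⟨x, hx, rfl⟩, rfl⟩
  exact cK hy hx (by linarith) h0 (by ring)

lemma scale_sup {K : Set (Y m)} (cK : Convex ℝ K) {y : Y m} (hy : y ∈ K) {b : ℝ} (h1 : 1 ≤ b) :
    K ⊆ ((1 - b) • y) +ᵥ (b • K) := by
  intro x hx
  have hb : 0 < b := by linarith
  refine ⟨x - (1 - b) • y, ⟨b⁻¹ • (x - (1 - b) • y), ?_, ?_⟩, ?_⟩
  · have := cK hy hx (sub_nonneg.2 (inv_le_one_of_one_le₀ h1)) (inv_nonneg.2 hb.le) (by ring)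
    convert this using 1
    ext i; simp; field_simp; ring
  · simp [smul_smul, hb.ne']
  · simp

set_option maxHeartbeats 1000000 in
lemma slice_stab (hm : 1 ≤ m) (hB : BMp (Y m) m) (hS : Stp (Y m) m) {β κ0 κ1 : ℝ} (hβ : 0 < β) (hκ0 : 0 < κ0) (hκ1 : 0 < κ1) :
    ∃ C, 0 < C ∧ ∀ A K : Set (Y m), IsBounded A → MeasurableSet A → IsOpen K → Convex ℝ K → IsBounded K → K.Nonempty →
      κ0 ≤ volume.real K → volume.real K ≤ κ1 → β ≤ volume.real A → ∀ t u e : ℝ, 0 < t → t ≤ 1 → volume.real (A + t • K) ≤ u →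
      0 < e → u * (1 + t * (volume.real A / volume.real K)) - (1 + t) ^ (m + 1) * volume.real A ≤ e →
      ∃ x : Y m, volume.real (symmDiff A (x +ᵥ K)) ^ 2 ≤ C * (e / t) := by
  obtain ⟨C0, hC0, hS⟩ := hS
  set C1 : ℝ := m ^ 2 * κ1 * (κ1 / β + 1) with hC1
  have hm' : (0:ℝ) < m := by exact_mod_cast hm
  have hm0 : m ≠ 0 := by omega
  set a1 := min 1 (κ0 / (2 * κ1)) with ha1
  have ha10 : 0 < a1 := by positivity
  refine ⟨9 * C1 + 2 * (C0 ^ 2 * (2 * κ1) / a1), by positivity, ?_⟩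
  intro A K bA mA oK cK bK ne hk0 hk1 hf0 t u e ht ht1 hu he hue
  set f := volume.real A with hf
  set k := volume.real K with hk
  have hfp : 0 < f := by linarith
  have hkp : 0 < k := by linarith
  obtain ⟨a, ha, hak⟩ := exists_a hm hfp hkp
  have hak' : a ^ m = k / f := by field_simp at hak ⊢; linarith
  have hfk : f = (a⁻¹) ^ m * k := by rw [inv_pow, hak']; field_simp
  -- lower bound of u
  have hul : (1 + t * a) ^ m * f ≤ u := by
    set F0 := f ^ ((m:ℝ)⁻¹)
    have hF0 : F0 ^ m = f := Real.rpow_inv_natCast_pow hfp.le hm0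
    have hF0p : 0 < F0 := by positivity
    have := BM_gen (E := Y m) hm0 finrankY hB (F := A) (K := t • K) bA mA (oK.smul₀ ht.ne') (cK.smul t) (bK.smul₀ t)
      (A := F0) (B := t * (a * F0)) hF0p (by positivity) hF0.le (by
        rw [vol_smul finrankY ht.le, mul_pow, mul_pow, hF0, hak']; apply le_of_eq; field_simp; rfl)
    refine le_trans (le_of_eq ?_) (this.trans hu)
    rw [← hF0, ← mul_pow]; congr 1; ring
  set ρ := f / k with hρ
  have hρp : 0 < ρ := by positivity
  set E := m * a + ρ - (m + 1) with hE
  have h1 := A1 m hm ha ht.le hak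
  have h2 := A2 m hm ha hak
  have hEn := E_nonneg m hm ha hak
  rw [← hE] at h1 h2 hEn
  have hE1 : t * f * E ≤ e := by
    have h3 : (1 + t * a) ^ m * f * (1 + t * ρ) ≤ u * (1 + t * ρ) := by gcongr
    have h4 := mul_le_mul_of_nonneg_left h1 hfp.le
    linarith
  have hd : (f - k) ^ 2 ≤ C1 * (e / t) := by
    have h5 : (f - k) ^ 2 = (ρ - 1) ^ 2 * k ^ 2 := by rw [hρ]; field_simp
    have h6 : (f - k) ^ 2 ≤ m ^ 2 * (1 + ρ) * E * k ^ 2 := by rw [h5]; gcongr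
    have h7 : m ^ 2 * (1 + ρ) * E * k ^ 2 = m ^ 2 * k * (k / f + 1) * (f * E) := by rw [hρ]; field_simp
    have h8 : f * E ≤ e / t := by rw [le_div_iff₀ ht]; linarith
    rw [h7] at h6
    refine h6.trans ?_
    rw [hC1]
    gcongr
  have hC1p : 0 < C1 := by positivity
  have het : 0 < e / t := by positivity
  rcases le_or_gt (2 * κ1) f with hlarge | hsmall
  · refine ⟨0, ?_⟩
    have h9 : volume.real (symmDiff A ((0 : Y m) +ᵥ K)) ≤ 3 * (f - k) := by
      rw [zero_vadd]
      have := sd_le_add bA bK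
      linarith
    calc _ ≤ (3 * (f - k)) ^ 2 := by gcongr
      _ = 9 * (f - k) ^ 2 := by ring
      _ ≤ 9 * (C1 * (e / t)) := by gcongr
      _ ≤ _ := by
        have : 0 ≤ 2 * (C0 ^ 2 * (2 * κ1) / a1) * (e / t) := by positivity
        linarith
  · obtain ⟨y, hy⟩ := ne
    have hb : 0 < a⁻¹ := by positivity
    set K' := ((1 - a⁻¹) • y) +ᵥ (a⁻¹ • K) with hK'
    have hvK' : volume.real K' = f := by rw [hK', vol_vadd, vol_smul finrankY hb.le, hfk]
    have oK' : IsOpen K' := (oK.smul₀ hb.ne').vadd _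
    have bK' : IsBounded K' := bdd_vadd (bK.smul₀ _)
    have P : Pair A K' := ⟨bA, mA, oK', (cK.smul _).vadd _, bK', ⟨_, ⟨_, ⟨y, hy, rfl⟩, rfl⟩⟩, hvK'.symm⟩
    have hta : 0 < t * a := by positivity
    have hsum : A + (t * a) • K' = ((t * a) • ((1 - a⁻¹) • y)) +ᵥ (A + t • K) := by
      rw [hK']
      ext z
      simp only [Set.mem_add, Set.mem_vadd_set, Set.mem_smul_set]
      constructor
      · rintro ⟨p, hp, _, ⟨_, ⟨_, ⟨w, hw, rfl⟩, rfl⟩, rfl⟩, rfl⟩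
        refine ⟨_, ⟨p, hp, _, ⟨w, hw, rfl⟩, rfl⟩, ?_⟩
        ext i; simp; field_simp; ring
      · rintro ⟨_, ⟨p, hp, _, ⟨w, hw, rfl⟩, rfl⟩, rfl⟩
        refine ⟨p, hp, _, ⟨_, ⟨_, ⟨w, hw, rfl⟩, rfl⟩, rfl⟩, ?_⟩
        ext i; simp; field_simp; ring
    have hup : u ≤ (1 + t * a) ^ m * f + e := by
      have h4 := mul_le_mul_of_nonneg_left h1 hfp.le
      have h5 : 0 ≤ t * E := by positivity
      have h6 : 0 ≤ f * (t * E) := by positivity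
      have h7 : (u - (1 + t * a) ^ m * f) * (1 + t * ρ) ≤ e := by linarith
      have h8 : (u - (1 + t * a) ^ m * f) * 1 ≤ (u - (1 + t * a) ^ m * f) * (1 + t * ρ) := by
        apply mul_le_mul_of_nonneg_left _ (by linarith)
        have : 0 < t * ρ := by positivity
        linarith
      linarith
    set M := min (t * a) 1 with hM
    have hMp : 0 < M := by positivity
    set ε := Real.sqrt (e / (f * M)) with hε
    have hεp : 0 < ε := by positivity
    have hε2 : ε ^ 2 = e / (f * M) := Real.sq_sqrt (by positivity)
    obtain ⟨x, hx⟩ := hS A K' P (t * a) ε hta hεp (by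
      rw [hsum, vol_vadd, hvK']
      refine hu.trans (hup.trans ?_)
      have : M * ε ^ 2 = e / f := by rw [hε2]; field_simp
      rw [← hM, this]
      have := pow_add_ge m hm0 (A := 1 + t * a) (d := e / f) (by linarith) (by positivity)
      have := mul_le_mul_of_nonneg_right this hfp.le
      rwa [add_mul, div_mul_cancel₀ _ hfp.ne'] at this)
    refine ⟨x, ?_⟩
    rw [hvK'] at hx
    have hnest : volume.real (symmDiff K' K) ≤ |f - k| := by
      rcases le_total a⁻¹ 1 with h | h
      · rw [sd_nested (scale_sub cK hy hb.le h) oK'.measurableSet bK, hvK', abs_sub_comm]; exact le_abs_self _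
      · rw [symmDiff_comm, sd_nested (scale_sup cK hy h) oK.measurableSet bK', hvK']; exact le_abs_self _
    have htri := sd_tri bA (bdd_vadd (x := x) bK') (bdd_vadd (x := x) bK)
    rw [sd_vadd] at htri
    have haa : a1 ≤ a := by
      by_contra hlt
      push Not at hlt
      have h1' : a ≤ 1 := hlt.le.trans (min_le_left _ _)
      have h2' : a ^ m ≤ a := pow_le_of_le_one ha.le h1' hm0
      have h3' : κ0 / (2 * κ1) ≤ k / f := by gcongr
      have : a1 ≤ κ0 / (2 * κ1) := min_le_right _ _
      linarith
    have hMt : t * a1 ≤ M := by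
      apply le_min
      · gcongr
      · calc t * a1 ≤ 1 * 1 := by gcongr; exact min_le_left _ _
          _ = 1 := by ring
    have hD1 : (C0 * f * ε) ^ 2 ≤ C0 ^ 2 * (2 * κ1) / a1 * (e / t) := by
      rw [mul_pow, mul_pow, hε2]
      have : C0 ^ 2 * f ^ 2 * (e / (f * M)) = C0 ^ 2 * f * (e / M) := by field_simp
      rw [this]
      have h10 : e / M ≤ e / (t * a1) := by gcongr
      calc C0 ^ 2 * f * (e / M) ≤ C0 ^ 2 * (2 * κ1) * (e / (t * a1)) := by gcongr
        _ = _ := by field_simp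
    have hD : volume.real (symmDiff A (x +ᵥ K)) ≤ C0 * f * ε + |f - k| := by linarith
    calc _ ≤ (C0 * f * ε + |f - k|) ^ 2 := by gcongr
      _ ≤ 2 * (C0 * f * ε) ^ 2 + 2 * |f - k| ^ 2 := by nlinarith [sq_nonneg (C0 * f * ε - |f - k|)]
      _ ≤ 2 * (C0 ^ 2 * (2 * κ1) / a1 * (e / t)) + 2 * (C1 * (e / t)) := by rw [sq_abs]; gcongr
      _ ≤ _ := by
        have : 0 ≤ C1 * (e / t) := by positivity
        linarith

end QBM

namespace QBM
set_option linter.unusedSectionVars false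
set_option linter.style.longLine false
set_option linter.unusedVariables false
set_option linter.unusedSimpArgs false
variable {m : ℕ}

/-- bulk -/
def Wk (F : Set (X m)) (v1 : ℝ) : Set ℝ := cum F ⁻¹' Icc v1 (volume.real F - v1)

lemma ptw (hm : 1 ≤ m) (hB : BMp (Y m) m) (hS : Stp (Y m) m) {r R v1 : ℝ} (hr : 0 < r) (hR : 0 < R) (hv1 : 0 < v1) :
    ∃ C β ε0 κ : ℝ, 0 < C ∧ 0 < β ∧ 0 < ε0 ∧ 0 < κ ∧ ∀ (F K : Set (X m)) (y0 : Y m), Pair F K → Geo K y0 r R → ∀ t, 0 < t → t ≤ 1 →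
      volume.real (F + t • K) ≤ (1 + t) ^ (m + 1) * volume.real K + t * ε0 ^ 2 → 
      (∀ q, v1 ≤ cum K q → cum K q ≤ volume.real K - v1 → κ ≤ sl K q ∧ q ∈ prj K) ∧
      ∀ τ S, Core F K t τ S → ∀ s ∈ S, s ∈ Wk F v1 →
        (β ≤ sl F s ∨ β ≤ exc F K t τ s) ∧ ∀ e, 0 < e → exc F K t τ s ≤ e →
          ∃ x : Y m, volume.real (symmDiff (slice F s) (x +ᵥ slice K (τ s))) ^ 2 ≤ C * (e / t) := by
  have hBX := BMp_succ hm hB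
  set κ1 := (2 * R) ^ m with hκ1
  have hkapp : 0 < κ1 := by positivity
  set η := v1 / 2 / κ1 with hη
  have hηp : 0 < η := by positivity
  have hη1 : (2 * R) ^ m * η ≤ v1 / 2 := by rw [hη, ← hκ1]; apply le_of_eq; field_simp
  obtain ⟨κ, hκ, hκp⟩ := exists_kappa m hr hR (show 0 < v1 / 2 by positivity)
  obtain ⟨β2, ε0, hβ2, hε0, hA⟩ := claimA hBX hr hR hv1 hηp hη1
  set β := β2 / 2 ^ (m + 2) with hβ
  have hβp : 0 < β := by positivity
  obtain ⟨C0, hC0, hst⟩ := slice_stab hm hB hS hβp hκ hkapp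
  refine ⟨C0 + (β + κ1) ^ 2 / β, β, ε0, κ, by positivity, hβp, hε0, hκ, ?_⟩
  intro F K y0 P G t ht ht1 hdef
  refine ⟨fun q h1 h2 => hκp K y0 G P.oK P.cK P.bK q (by linarith) (by linarith), ?_⟩
  intro τ S c s hs hW
  obtain ⟨hτp, hτc⟩ := c.prop s (c.sub hs)
  have hW1 : v1 ≤ cum F s := hW.1
  have hW2 : cum F s ≤ volume.real K - v1 := by rw [← P.vol]; exact hW.2
  have hk := (hκp K y0 G P.oK P.cK P.bK (τ s) (by linarith) (by linarith)).1
  have hk1 : sl K (τ s) ≤ κ1 := sl_le hR G.bd _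
  have hkp : 0 < sl K (τ s) := by linarith
  have hfn := sl_nonneg F s
  rcases le_or_gt β (sl F s) with hf | hf
  · refine ⟨Or.inl hf, fun e he hee => ?_⟩
    obtain ⟨x, hx⟩ := hst (slice F s) (slice K (τ s)) (slice_bdd P.bF s) (slice_meas P.mF s) (slice_open P.oK _) (slice_convex P.cK _)
      (slice_bdd P.bK _) (mem_prj.1 hτp) hk hk1 hf t _ e ht ht1 (mono (slice_sum F K t s (τ s)) (slice_bdd (P.bS t) _)) he hee
    refine ⟨x, hx.trans ?_⟩
    have : 0 ≤ (β + κ1) ^ 2 / β * (e / t) := by positivity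
    linarith
  · obtain ⟨s', hs', hfs'⟩ := hA F K y0 P G t ht ht1 hdef s (τ s) hτc hW1 hW2
    have hq : (s - s') / t + τ s ∈ prj K := by
      have h3 := cum_lip P.oK.measurableSet P.bK G.hR G.bd (τ s) ((s - s') / t + τ s)
      have h4 : |(s - s') / t + τ s - τ s| ≤ η := by
        rw [add_sub_cancel_right, abs_div, abs_of_pos ht, div_le_iff₀ ht, abs_sub_comm, mul_comm]; exact hs'.le
      have h5 := h3.trans (le_trans (by gcongr) hη1)
      rw [abs_le, hτc] at h5
      exact (hκp K y0 G P.oK P.cK P.bK _ (by linarith) (by linarith)).2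
    have hu : β2 ≤ sl (F + t • K) (s + t * τ s) := by
      refine hfs'.trans ?_
      obtain ⟨w, hw⟩ := mem_prj.1 hq
      have e1 : s + t * τ s = s' + t * ((s - s') / t + τ s) := by field_simp; ring
      rw [e1]
      have hsub := slice_sum F K t s' ((s - s') / t + τ s)
      have : (t • w) +ᵥ slice F s' ⊆ slice (F + t • K) (s' + t * ((s - s') / t + τ s)) := by
        refine Subset.trans ?_ hsub
        rintro _ ⟨z, hz, rfl⟩
        exact ⟨z, hz, t • w, ⟨w, hw, rfl⟩, by simp [add_comm]⟩
      have h6 := mono this (slice_bdd (P.bS t) _)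
      rwa [vol_vadd] at h6
    have he : β ≤ exc F K t τ s := by
      unfold exc
      have h7 : β2 * 1 ≤ sl (F + t • K) (s + t * τ s) * (1 + t * (sl F s / sl K (τ s))) := by
        have : 0 ≤ t * (sl F s / sl K (τ s)) := by positivity
        exact mul_le_mul hu (by linarith) (by norm_num) (sl_nonneg _ _)
      have h8 : (1 + t) ^ (m + 1) * sl F s ≤ 2 ^ (m + 1) * β := by
        have : 1 + t ≤ 2 := by linarith
        gcongr
      have h9 : 2 ^ (m + 1) * β = β2 / 2 := by rw [hβ, pow_succ 2 (m + 1)]; field_simp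
      have h10 : β ≤ β2 / 2 := by
        rw [hβ]; gcongr
        calc (2:ℝ) = 2 ^ 1 := by ring
          _ ≤ 2 ^ (m + 2) := pow_le_pow_right₀ (by norm_num) (by omega)
      linarith
    refine ⟨Or.inr he, fun e hep hee => ⟨0, ?_⟩⟩
    have hD : volume.real (symmDiff (slice F s) ((0 : Y m) +ᵥ slice K (τ s))) ≤ β + κ1 := by
      rw [zero_vadd]
      have := sd_le_add (slice_bdd P.bF s) (slice_bdd P.bK (τ s))
      change _ ≤ sl F s + sl K (τ s) at this
      linarith
    have h11 : β ≤ e / t := by rw [le_div_iff₀ ht]; nlinarith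
    calc _ ≤ (β + κ1) ^ 2 := by gcongr
      _ = (β + κ1) ^ 2 / β * β := by field_simp
      _ ≤ (β + κ1) ^ 2 / β * (e / t) := by gcongr
      _ ≤ _ := by
        have : 0 ≤ C0 * (e / t) := by positivity
        linarith

end QBM

namespace QBM
set_option linter.unusedSectionVars false
set_option linter.style.longLine false
set_option linter.unusedVariables false
set_option linter.unusedSimpArgs false
variable {m : ℕ}

lemma Wk_sub {F : Set (X m)} {v1 : ℝ} (hv : 0 < v1) : Wk F v1 ⊆ JJ F := fun s hs =>
  ⟨lt_of_lt_of_le hv hs.1, by have := hs.2; linarith⟩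

lemma Wk_meas {F : Set (X m)} {v1 : ℝ} (mF : MeasurableSet F) (b : IsBounded F) : MeasurableSet (Wk F v1) :=
  (cum_cont mF b).measurable measurableSet_Icc

lemma Wk_ord {F : Set (X m)} {v1 : ℝ} (b : IsBounded F) {x y : ℝ} (hx : x ∈ Wk F v1) (hy : y ∈ Wk F v1) : Icc x y ⊆ Wk F v1 :=
  fun z hz => ⟨hx.1.trans (cum_mono b hz.1), (cum_mono b hz.2).trans hy.2⟩

lemma Wk_bdd {F : Set (X m)} {v1 : ℝ} (hv : 0 < v1) (b : IsBounded F) : IsBounded (Wk F v1) := by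
  obtain ⟨R, hR, h⟩ := fst_bound b
  refine (isBounded_Icc (-R) R).subset fun z hz => ?_
  constructor
  · by_contra hc
    push Not at hc
    have := hz.1
    rw [cum_zero h hc.le] at this; linarith
  · by_contra hc
    push Not at hc
    have := hz.2
    rw [cum_top h hc.le] at this; linarith

/-- displacement lemma -/
lemma displacement {F K : Set (X m)} (P : Pair F K) {t v1 κ δ : ℝ} {τ : ℝ → ℝ} {S : Set ℝ} (c : Core F K t τ S) (hκ : 0 < κ) (hv : 0 < v1)
    (hk : ∀ q, v1 ≤ cum K q → cum K q ≤ volume.real K - v1 → κ ≤ sl K q ∧ q ∈ prj K) {g : ℝ → ℝ} (gi : Integrable g)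
    (g0 : ∀ s, 0 ≤ g s) (hg : ∫ s, g s ≤ δ) (hfg : ∀ s ∈ S, s ∈ Wk F v1 → |sl F s - sl K (τ s)| ≤ g s)
    {a b : ℝ} (hab : a ≤ b) (ha : a ∈ Wk F v1) (hb : b ∈ Wk F v1) : |τ b - τ a - (b - a)| ≤ δ / κ := by
  have hW : Icc a b ⊆ Wk F v1 := Wk_ord P.bF ha hb
  obtain ⟨RF, hRF, hRb⟩ := fst_bound P.bF
  set M := (2 * RF) ^ m
  have hlip0 : ∀ x ∈ Icc a b, ∀ y ∈ Icc a b, x ≤ y → |τ y - τ x| ≤ M / κ * |y - x| := by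
    intro x hx y hy hxy
    have hx' := hW hx
    have hy' := hW hy
    obtain ⟨hxp, hxc⟩ := c.prop x (Wk_sub hv hx')
    obtain ⟨hyp, hyc⟩ := c.prop y (Wk_sub hv hy')
    have hle : τ x ≤ τ y := by
      rw [← (cum_strict P.oK P.cK P.bK).le_iff_le hxp hyp, hxc, hyc]; exact cum_mono P.bF hxy
    have h1 := cum_inc_ge P.oK.measurableSet P.bK hle (M := κ) (fun z hz => (hk z 
      (by have := hx'.1; rw [← hxc] at this; exact this.trans (cum_mono P.bK hz.1.le)) 
      (by have := hy'.2; rw [← hyc, P.vol] at this; exact (cum_mono P.bK hz.2.le).trans this)).1)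
    rw [hxc, hyc] at h1
    have h2 := cum_inc_le P.mF P.bF hxy (fun s _ => sl_le hRF hRb s)
    rw [abs_of_nonneg (by linarith), abs_of_nonneg (by linarith)]
    rw [div_mul_eq_mul_div, le_div_iff₀ hκ]
    linarith
  have hMk : 0 ≤ M / κ := by positivity
  have hlip : LipschitzOnWith (M / κ).toNNReal τ (uIcc a b) := by
    rw [uIcc_of_le hab]
    apply LipschitzOnWith.of_dist_le_mul
    intro x hx y hy
    rw [Real.coe_toNNReal _ hMk, Real.dist_eq, Real.dist_eq]
    rcases le_total x y with h | h
    · rw [abs_sub_comm, abs_sub_comm x]; exact hlip0 x hx y hy h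
    · exact hlip0 y hy x hx h
  have hac := hlip.absolutelyContinuousOnInterval
  have hvint := hac.integral_deriv_eq_sub
  have hii := hac.intervalIntegrable_deriv
  have h1 : τ b - τ a - (b - a) = ∫ s in a..b, (deriv τ s - 1) := by
    rw [intervalIntegral.integral_sub hii (by simp), hvint]; simp
  rw [h1]
  have hae : ∀ᵐ s, s ∈ Ioc a b → ‖deriv τ s - 1‖ ≤ g s / κ := by
    have : ∀ᵐ s, s ∉ JJ F \ S := measure_eq_zero_iff_ae_notMem.1 c.full
    filter_upwards [this] with s hs hsab
    have hsW := hW ⟨hsab.1.le, hsab.2⟩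
    have hsS : s ∈ S := by
      by_contra hc; exact hs ⟨Wk_sub hv hsW, hc⟩
    rw [(c.der s hsS).deriv]
    obtain ⟨hp, hc⟩ := c.prop s (Wk_sub hv hsW)
    have hks := (hk (τ s) (by rw [hc]; exact hsW.1) (by rw [hc, ← P.vol]; exact hsW.2)).1
    have hk0 : 0 < sl K (τ s) := by linarith
    have e1 : sl F s / sl K (τ s) - 1 = (sl F s - sl K (τ s)) / sl K (τ s) := by field_simp
    rw [e1, Real.norm_eq_abs, abs_div, abs_of_pos hk0]
    have := hfg s hsS hsW
    have := g0 s
    gcongr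
  rw [← Real.norm_eq_abs]
  refine (intervalIntegral.norm_integral_le_of_norm_le hab hae (gi.div_const κ).intervalIntegrable).trans ?_
  rw [intervalIntegral.integral_div, intervalIntegral.integral_of_le hab]
  gcongr
  exact (setIntegral_le_integral gi (Eventually.of_forall g0)).trans hg


/-- symmetric difference of nearby slices -/
lemma slice_sd {K : Set (X m)} {y0 : Y m} {r R : ℝ} (G : Geo K y0 r R) (oK : IsOpen K) (cK : Convex ℝ K) (bK : IsBounded K) {q q' : ℝ}
    (hq : |q| < r / 2) (hq' : |q'| < r / 2) (hqq : |q - q'| ≤ r / 2) :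
    volume.real (symmDiff (slice K q) (slice K q')) ≤ 4 * m * (2 * R) ^ m / r * |q - q'| := by
  have hr := G.hr
  have hR := G.hR
  have mem : ∀ x, |x| < r → (x, y0) ∈ K := fun x hx => G.ball (by
    rw [mem_ball, Prod.dist_eq]; exact max_lt (by simpa using hx) (by simpa using hr))
  have h1 := slice_diff oK cK bK (q := q) (q' := q') (δ := r / 2) (y0 := y0) (by positivity) (fun x hx => mem x (by
    have := abs_sub_abs_le_abs_sub x q; linarith)) hqq
  have h2 := slice_diff oK cK bK (q := q') (q' := q) (δ := r / 2) (y0 := y0) (by positivity) (fun x hx => mem x (by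
    have := abs_sub_abs_le_abs_sub x q'; linarith)) (by rw [abs_sub_comm]; exact hqq)
  rw [abs_sub_comm q' q] at h2
  rw [measureReal_symmDiff_eq (slice_open oK _).measurableSet (slice_open oK _).measurableSet (fin (slice_bdd bK _)) (fin (slice_bdd bK _))]
  have h3 : m * (|q - q'| / (r / 2)) * sl K q ≤ m * (|q - q'| / (r / 2)) * (2 * R) ^ m := by
    gcongr; exact sl_le hR G.bd q
  have h4 : m * (|q - q'| / (r / 2)) * sl K q' ≤ m * (|q - q'| / (r / 2)) * (2 * R) ^ m := by
    gcongr; exact sl_le hR G.bd q'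
  have e : 4 * m * (2 * R) ^ m / r * |q - q'| = 2 * (m * (|q - q'| / (r / 2)) * (2 * R) ^ m) := by field_simp; ring
  rw [e]; linarith

lemma ssd_abs {F K : Set (X m)} (bF : IsBounded F) (bK : IsBounded K) {s q : ℝ} {x : Y m} :
    |sl F s - sl K q| ≤ volume.real (symmDiff (slice F s) (x +ᵥ slice K q)) := by
  have := abs_vol_sub_le (slice_bdd bF s) (bdd_vadd (x := x) (slice_bdd bK q))
  rwa [vol_vadd] at this

/-- conclusion of the one-directional lemma -/
structure LDUc (F K : Set (X m)) (r v1 D c : ℝ) : Prop where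
  coarse : ∀ z, |cum F z - cum K (z - c)| ≤ 2 * v1
  fine : ∃ g : ℝ → ℝ, Integrable g ∧ (∀ s, 0 ≤ g s) ∧ ∫ s, g s ≤ D ∧ ∀ᵐ s, |s - c| ≤ r / 4 → 
    ∃ x : Y m, volume.real (symmDiff (slice F s) (x +ᵥ slice K (s - c))) ≤ g s

set_option maxHeartbeats 1000000 in
theorem LDU (hm : 1 ≤ m) (hB : BMp (Y m) m) (hS : Stp (Y m) m) {r R v1 : ℝ} (hr : 0 < r) (hR : 0 < R) (hv1 : 0 < v1)
    (hv1r : v1 ≤ (2 * r) ^ m * (r / 4)) :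
    ∃ C ε0 : ℝ, 0 < C ∧ 0 < ε0 ∧ ∀ (F K : Set (X m)) (y0 : Y m), Pair F K → Geo K y0 r R → ∀ t ε, 0 < t → t ≤ 1 → 0 < ε → ε ≤ ε0 →
      volume.real (F + t • K) ≤ (1 + t) ^ (m + 1) * volume.real K + t * ε ^ 2 → 
      ∀ c, cum F c = cum K 0 → LDUc F K r v1 (C * ε) c := by
  obtain ⟨C0, β, ε1, κ, hC0, hβ, hε1, hκ, H⟩ := ptw hm hB hS hr hR hv1
  set κ1 := (2 * R) ^ m with hκ1
  have hkapp : 0 < κ1 := by positivity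
  set L := (κ1 * (2 * R) + 1) / β with hL
  have hLp : 0 < L := by positivity
  set C1 := (C0 + 1) * (1 + L) with hC1
  have hC1p : 0 < C1 := by positivity
  -- displacement is at most C1/κ * ε
  set C2 := C1 / κ with hC2
  have hC2p : 0 < C2 := by positivity
  set C3 := 4 * m * (2 * R) ^ m / r * C2 with hC3
  have hC3p : 0 ≤ C3 := by positivity
  refine ⟨C1 + C3 * r + 1, min (min ε1 1) (min (v1 / (κ1 * C2)) (r / (8 * C2))), by positivity, by positivity, ?_⟩
  intro F K y0 P G t ε ht ht1 hε hε0 hdef c hc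
  have hεε1 : ε ≤ ε1 := hε0.trans ((min_le_left _ _).trans (min_le_left _ _))
  have hε1' : ε ≤ 1 := hε0.trans ((min_le_left _ _).trans (min_le_right _ _))
  have hεv : κ1 * (C2 * ε) ≤ v1 := by
    have := hε0.trans ((min_le_right _ _).trans (min_le_left _ _))
    rw [le_div_iff₀ (by positivity)] at this
    linarith
  have hεr : C2 * ε ≤ r / 8 := by
    have := hε0.trans ((min_le_right _ _).trans (min_le_right _ _))
    rw [le_div_iff₀ (by positivity)] at this
    linarith
  obtain ⟨hk, HH⟩ := H F K y0 P G t ht ht1 (hdef.trans (by gcongr))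
  obtain ⟨τ, S, cr⟩ := exists_core P ht
  have HH := HH τ S cr
  set V := volume.real K with hV
  have mK := P.oK.measurableSet
  set W := Wk F v1 with hW
  have mW : MeasurableSet W := Wk_meas P.mF P.bF
  have bW : IsBounded W := Wk_bdd hv1 P.bF
  set WS := W ∩ S with hWS
  have mWS : MeasurableSet WS := mW.inter cr.mS
  have bWS : IsBounded WS := bW.subset inter_subset_left
  have finWS : volume WS ≠ ⊤ := bWS.measure_lt_top.ne
  set ex := exc F K t τ with hex
  have exS := cr.exc_int P
  have exWS : IntegrableOn ex WS := exS.mono_set inter_subset_right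
  have ex0 : ∀ s ∈ S, 0 ≤ ex s := fun s hs => exc_nonneg hm hB P ht (cr.prop s (cr.sub hs)).1
  have exle : ∫ s in S, ex s ≤ t * ε ^ 2 := (cr.exc_le P).trans (by linarith)
  have exle' : ∫ s in WS, ex s ≤ t * ε ^ 2 := by
    refine le_trans ?_ exle
    apply setIntegral_mono_set exS _ (inter_subset_right.eventuallyLE)
    filter_upwards [ae_restrict_mem cr.mS] with s hs using ex0 s hs
  have hVm : V ≤ κ1 * (2 * R) := G.vol_le P.oK P.bK
  have fint := sl_integrable P.mF P.bF
  have volWS : volume.real WS ≤ L := by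
    have h1 : β * volume.real WS ≤ ∫ s in WS, (sl F s + ex s) := by
      have : ∫ s in WS, β = β * volume.real WS := by
        rw [setIntegral_const]; simp [mul_comm]
      rw [← this]
      refine setIntegral_mono_on (integrableOn_const finWS) (fint.integrableOn.add exWS) mWS ?_
      intro s hs
      have := ex0 s hs.2
      have := sl_nonneg F s
      rcases (HH s hs.2 hs.1).1 with h | h <;> linarith
    rw [integral_add fint.integrableOn exWS] at h1
    have h2 : ∫ s in WS, sl F s ≤ V := by
      rw [hV, ← P.vol, ← integral_sl P.mF P.bF]
      exact setIntegral_le_integral fint (Eventually.of_forall (sl_nonneg F))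
    have h3 : t * ε ^ 2 ≤ 1 := by
      have : ε ^ 2 ≤ 1 := pow_le_one₀ hε.le hε1'
      nlinarith
    rw [hL, le_div_iff₀ hβ]; linarith
  set g0 : ℝ → ℝ := WS.indicator (fun s => (C0 + 1) * (ex s / (t * ε) + ε)) with hg0
  have g0i : Integrable g0 := by
    rw [hg0, integrable_indicator_iff mWS]
    exact (((exWS.div_const _).add (integrableOn_const finWS)).const_mul _)
  have g00 : ∀ s, 0 ≤ g0 s := by
    intro s
    apply indicator_nonneg
    intro s hs
    have := ex0 s hs.2
    positivity
  have g0le : ∫ s, g0 s ≤ C1 * ε := by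
    rw [hg0, integral_indicator mWS, integral_const_mul, integral_add (exWS.div_const _) (integrableOn_const finWS), integral_div, setIntegral_const, hC1, mul_assoc]
    apply mul_le_mul_of_nonneg_left _ (by positivity)
    have h1 : (∫ s in WS, ex s) / (t * ε) ≤ ε := by
      rw [div_le_iff₀ (by positivity)]; linarith
    have h2 : volume.real WS • ε ≤ L * ε := by rw [smul_eq_mul]; gcongr
    linarith
  have HD : ∀ s ∈ S, s ∈ W → ∃ x : Y m, volume.real (symmDiff (slice F s) (x +ᵥ slice K (τ s))) ≤ g0 s := by
    intro s hs hsW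
    have h0 := ex0 s hs
    obtain ⟨x, hx⟩ := (HH s hs hsW).2 (ex s + t * ε ^ 2) (by positivity) (by 
      have : 0 < t * ε ^ 2 := by positivity
      linarith)
    refine ⟨x, ?_⟩
    set D := volume.real (symmDiff (slice F s) (x +ᵥ slice K (τ s)))
    rw [hg0, indicator_of_mem (show s ∈ WS from ⟨hsW, hs⟩)]
    have e1 : (ex s + t * ε ^ 2) / t = ε * (ex s / (t * ε) + ε) := by field_simp
    rw [e1] at hx
    set Z := ex s / (t * ε) + ε with hZ
    have hZε : ε ≤ Z := by
      have : 0 ≤ ex s / (t * ε) := by positivity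
      linarith
    have h2 : 2 * D * ε ≤ D ^ 2 + ε ^ 2 := by nlinarith [sq_nonneg (D - ε)]
    have h3 : 2 * D * ε ≤ (C0 * Z + ε) * ε := by nlinarith
    have h4 : 2 * D ≤ C0 * Z + ε := le_of_mul_le_mul_right h3 hε
    have h5 : 0 ≤ C0 * Z := by have : 0 < Z := by linarith
                               positivity
    linarith
  have hfg : ∀ s ∈ S, s ∈ W → |sl F s - sl K (τ s)| ≤ g0 s := by
    intro s hs hsW
    obtain ⟨x, hx⟩ := HD s hs hsW
    exact (ssd_abs P.bF P.bK).trans hx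
  -- c is in the bulk, and τ c = 0
  have hc0 := G.cum_ge P.oK P.bK (q := 0) (by simpa using hr.le)
  have hκr : 0 < (2 * r) ^ m := by positivity
  have cW : c ∈ W := by
    constructor
    · rw [hc]; nlinarith [hc0.1]
    · rw [hc, P.vol]; nlinarith [hc0.2]
  have hc1 := cr.prop c (Wk_sub hv1 cW)
  have h0prj : (0:ℝ) ∈ prj K := ⟨_, G.ball (mem_ball_self hr), rfl⟩
  have τc : τ c = 0 := (cum_strict P.oK P.cK P.bK).injOn hc1.1 h0prj (by rw [hc1.2, hc])
  have disp : ∀ s ∈ W, |τ s - (s - c)| ≤ C2 * ε := by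
    intro s hs
    have e : C2 * ε = C1 * ε / κ := by rw [hC2]; ring
    rw [e]
    rcases le_total c s with h | h
    · have := displacement P cr hκ hv1 hk g0i g00 g0le hfg h cW hs
      rwa [τc, sub_zero] at this
    · have := displacement P cr hκ hv1 hk g0i g00 g0le hfg h hs cW
      rw [τc] at this
      rw [← abs_neg]; convert this using 2; ring
  have lipK := cum_lip mK P.bK G.hR G.bd
  have bulk : ∀ z ∈ W, |cum F z - cum K (z - c)| ≤ v1 := by
    intro z hz
    rw [← (cr.prop z (Wk_sub hv1 hz)).2]
    refine (lipK _ _).trans (le_trans ?_ hεv)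
    have := disp z hz
    gcongr
  have V4 : 4 * v1 ≤ V := by
    have := G.vol_ge P.oK P.bK
    nlinarith
  have coarse : ∀ z, |cum F z - cum K (z - c)| ≤ 2 * v1 := by
    intro z
    by_cases hz : z ∈ W
    · linarith [bulk z hz]
    · have : cum F z < v1 ∨ V - v1 < cum F z := by
        by_contra hcon
        push Not at hcon
        exact hz ⟨hcon.1, by rw [P.vol]; exact hcon.2⟩
      rcases this with h | h
      · obtain ⟨z1, hz1⟩ := cum_ivt P.mF P.bF (v := v1) hv1.le (by rw [P.vol]; linarith)
        have hzz : z ≤ z1 := by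
          by_contra hcon; push Not at hcon
          have := cum_mono P.bF hcon.le
          linarith
        have hz1W : z1 ∈ W := ⟨hz1.ge, by rw [hz1, P.vol]; linarith⟩
        have h1 := bulk z1 hz1W
        rw [abs_le] at h1 ⊢
        have h2 := cum_mono P.bK (sub_le_sub_right hzz c)
        have h3 := cum_nonneg K (z - c)
        have h4 := cum_nonneg F z
        constructor <;> linarith
      · obtain ⟨z1, hz1⟩ := cum_ivt P.mF P.bF (v := V - v1) (by linarith) (by rw [P.vol]; linarith)
        have hzz : z1 ≤ z := by
          by_contra hcon; push Not at hcon
          have := cum_mono P.bF hcon.le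
          linarith
        have hz1W : z1 ∈ W := ⟨by rw [hz1]; linarith, by rw [hz1, P.vol]⟩
        have h1 := bulk z1 hz1W
        rw [abs_le] at h1 ⊢
        have h2 := cum_mono P.bK (sub_le_sub_right hzz c)
        have h3 := cum_le P.bK (z - c)
        have h4 := cum_le P.bF z
        rw [P.vol] at h4
        constructor <;> linarith
  refine ⟨coarse, ?_⟩
  set Ic := Icc (c - r / 4) (c + r / 4) with hIc
  refine ⟨fun s => g0 s + Ic.indicator (fun _ => C3 * ε) s, g0i.add ?_, ?_, ?_, ?_⟩
  · rw [integrable_indicator_iff measurableSet_Icc]; exact integrableOn_const (by simp [hIc])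
  · intro s
    have := g00 s
    have : 0 ≤ Ic.indicator (fun _ => C3 * ε) s := indicator_nonneg (fun _ _ => by positivity) s
    positivity
  · rw [integral_add g0i, integral_indicator measurableSet_Icc, setIntegral_const]
    · have : volume.real Ic = r / 2 := by
        rw [hIc, Measure.real, Real.volume_Icc, ENNReal.toReal_ofReal] <;> linarith
      rw [this, smul_eq_mul]
      have : 0 ≤ r / 2 * (C3 * ε) := by positivity
      nlinarith
    · rw [integrable_indicator_iff measurableSet_Icc]; exact integrableOn_const (by simp [hIc])
  · have : ∀ᵐ s, s ∉ JJ F \ S := measure_eq_zero_iff_ae_notMem.1 cr.full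
    filter_upwards [this] with s hs hsc
    have hsc' := abs_le.1 hsc
    have hcq := G.cum_ge P.oK P.bK (q := s - c) (by linarith)
    have hco := abs_le.1 (coarse s)
    have sW : s ∈ W := by
      constructor
      · nlinarith [hcq.1]
      · rw [P.vol]; nlinarith [hcq.2]
    have sS : s ∈ S := by
      by_contra hcon; exact hs ⟨Wk_sub hv1 sW, hcon⟩
    obtain ⟨x, hx⟩ := HD s sS sW
    refine ⟨x, ?_⟩
    have hd := disp s sW
    have hτ : |τ s| < r / 2 := by
      have := abs_sub_abs_le_abs_sub (τ s) (s - c)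
      linarith
    have h1 := slice_sd G P.oK P.cK P.bK (q := τ s) (q' := s - c) hτ (by linarith) (by linarith)
    have h2 := sd_tri (slice_bdd P.bF s) (bdd_vadd (x := x) (slice_bdd P.bK (τ s))) (bdd_vadd (x := x) (slice_bdd P.bK (s - c)))
    rw [sd_vadd] at h2
    have hsI : s ∈ Ic := ⟨by linarith, by linarith⟩
    rw [indicator_of_mem hsI]
    have h3 : 4 * m * (2 * R) ^ m / r * |τ s - (s - c)| ≤ C3 * ε := by
      rw [hC3, mul_assoc _ C2]; gcongr
    linarith

end QBM

namespace QBM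
set_option linter.unusedSectionVars false
set_option linter.style.longLine false
set_option linter.unusedVariables false
set_option linter.unusedSimpArgs false
variable {m : ℕ}

def L (u : Y m) : Y m →ₗ[ℝ] ℝ := ∑ i, u i • LinearMap.proj i

lemma L_apply (u y : Y m) : L u y = ∑ i, u i * y i := by simp [L]

lemma L_abs (u y : Y m) : |L u y| ≤ m * ‖u‖ * ‖y‖ := by
  rw [L_apply]
  refine (Finset.abs_sum_le_sum_abs _ _).trans ?_
  refine (Finset.sum_le_card_nsmul _ _ (‖u‖ * ‖y‖) fun i _ => ?_).trans (by simp; linarith)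
  rw [abs_mul]
  exact mul_le_mul (norm_le_pi_norm u i) (norm_le_pi_norm y i) (abs_nonneg _) (norm_nonneg _)

lemma L_single (u : Y m) (j : Fin m) (a : ℝ) : L u (Pi.single j a) = u j * a := by
  rw [L_apply, Finset.sum_eq_single j]
  · simp
  · intro b _ hb; simp [hb]
  · simp

lemma L_single' (y : Y m) (j : Fin m) (a : ℝ) : L (Pi.single j a) y = a * y j := by
  rw [L_apply, Finset.sum_eq_single j]
  · simp
  · intro b _ hb; simp [hb]
  · simp

lemma L_add (u v y : Y m) : L (u + v) y = L u y + L v y := by simp [L_apply, add_mul, Finset.sum_add_distrib]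
lemma L_smul (a : ℝ) (u y : Y m) : L (a • u) y = a * L u y := by simp [L_apply, Finset.mul_sum, mul_assoc]
lemma L_neg (u y : Y m) : L (-u) y = - L u y := by simp [L_apply]

lemma L_cont (u : Y m) : Continuous (L u) := LinearMap.continuous_of_finiteDimensional _

/-- the functional `s + u · y` -/
def hf (u : Y m) : X m →ₗ[ℝ] ℝ := LinearMap.fst ℝ ℝ (Y m) + (L u).comp (LinearMap.snd ℝ ℝ (Y m))

lemma hf_apply (u : Y m) (p : X m) : hf u p = p.1 + L u p.2 := rfl
lemma hf_cont (u : Y m) : Continuous (hf u) := LinearMap.continuous_of_finiteDimensional _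

def shearL (u : Y m) : X m ≃ₗ[ℝ] X m :=
  LinearEquiv.transvection (f := (L u).comp (LinearMap.snd ℝ ℝ (Y m))) (v := ((1:ℝ), (0 : Y m))) (by simp)

def shear (u : Y m) : X m ≃L[ℝ] X m := (shearL u).toContinuousLinearEquiv

lemma shear_apply (u : Y m) (p : X m) : shear u p = (hf u p, p.2) := by
  change p + ((L u) p.2) • ((1:ℝ), (0 : Y m)) = _
  ext <;> simp [hf_apply]

lemma mp_of_det {e : X m ≃L[ℝ] X m} (h : |LinearMap.det (e : X m →ₗ[ℝ] X m)| = 1) : MeasurePreserving e := by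
  refine ⟨e.continuous.measurable, ?_⟩
  have h0 : LinearMap.det (e : X m →ₗ[ℝ] X m) ≠ 0 := by intro h0; simp [h0] at h
  have := Measure.map_linearMap_addHaar_eq_smul_addHaar (μ := (volume : Measure (X m))) h0
  rw [abs_inv, h] at this
  simpa using this

lemma shear_mp (u : Y m) : MeasurePreserving (shear u) := by
  apply mp_of_det
  change |LinearMap.det (LinearMap.transvection ((L u).comp (LinearMap.snd ℝ ℝ (Y m))) ((1:ℝ), (0 : Y m)))| = 1
  rw [LinearMap.transvection.det]
  simp

lemma shear_neg (u : Y m) (p : X m) : shear (-u) (shear u p) = p := by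
  rw [shear_apply, shear_apply]; ext <;> simp [hf_apply, L_neg]

lemma vol_inter_shear (S : Set (X m)) (u : Y m) (A : Set ℝ) :
    volume.real (S ∩ {p | hf u p ∈ A}) = volume.real ((shear u '' S) ∩ {p | p.1 ∈ A}) := by
  rw [← mp_image (shear u) (shear_mp u)]
  congr 1
  ext p; constructor
  · rintro ⟨q, ⟨h1, h2⟩, rfl⟩
    exact ⟨⟨q, h1, rfl⟩, by simpa [shear_apply] using h2⟩
  · rintro ⟨⟨q, h1, rfl⟩, h2⟩
    exact ⟨q, ⟨h1, by simpa [shear_apply] using h2⟩, rfl⟩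

lemma shear_cum (S : Set (X m)) (u : Y m) (z : ℝ) : cum (shear u '' S) z = volume.real (S ∩ {p | hf u p < z}) :=
  (vol_inter_shear S u (Iio z)).symm

lemma bdd_img {E E' : Type*} [NormedAddCommGroup E] [NormedSpace ℝ E] [NormedAddCommGroup E'] [NormedSpace ℝ E'] (e : E ≃L[ℝ] E') {S : Set E} (b : IsBounded S) : IsBounded (e '' S) :=
  e.lipschitz.isBounded_image b

lemma meas_img (e : X m ≃L[ℝ] X m) {S : Set (X m)} (h : MeasurableSet S) : MeasurableSet (e '' S) :=
  e.toHomeomorph.toMeasurableEquiv.measurableSet_image.2 h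

/-- `γ` is an admissible level for the functional `hf u` -/
def Adm (F K : Set (X m)) (u : Y m) (γ : ℝ) : Prop :=
  volume.real (F ∩ {p | hf u p < γ}) = volume.real (K ∩ {p | hf u p < 0})

lemma Pair.exists_adm {F K : Set (X m)} (P : Pair F K) (u : Y m) : ∃ γ, Adm F K u γ := by
  obtain ⟨z, hz⟩ := cum_ivt (meas_img (shear u) P.mF) (bdd_img (shear u) P.bF) (v := volume.real (K ∩ {p | hf u p < 0}))
    measureReal_nonneg (by
      rw [mp_image _ (shear_mp u), P.vol]
      exact mono inter_subset_left P.bK)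
  exact ⟨z, by rw [Adm, ← hz, shear_cum]⟩

lemma upper_eq {S : Set (X m)} (h : MeasurableSet S) (b : IsBounded S) (u : Y m) (z : ℝ) :
    volume.real (S ∩ {p | z < hf u p}) = volume.real S - volume.real (S ∩ {p | hf u p < z}) := by
  have := tail_eq (meas_img (shear u) h) (bdd_img (shear u) b) z
  rw [shear_cum, mp_image _ (shear_mp u)] at this
  rw [← this]; exact vol_inter_shear S u (Ioi z)

lemma strip (hm : 1 ≤ m) {r : ℝ} (hr : 0 < r) {u : Y m} (hu : u ≠ 0) {a b : ℝ} (hab : a ≤ b)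
    (ha : |a| ≤ ‖u‖ * r / 4) (hb : |b| ≤ ‖u‖ * r / 4) :
    (r / (4 * m)) ^ (m - 1) / ‖u‖ * (b - a) ≤ volume.real (ball (0 : Y m) r ∩ {y | a < L u y ∧ L u y < b}) := by
  have hN : 0 < ‖u‖ := norm_pos_iff.2 hu
  have hmpos : (0:ℝ) < m := by exact_mod_cast hm
  obtain ⟨j, hj⟩ : ∃ j, ‖u j‖ = ‖u‖ := by
    haveI : Nonempty (Fin m) := ⟨⟨0, hm⟩⟩
    obtain ⟨j, hj⟩ := Finite.exists_max (fun i => ‖u i‖)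
    exact ⟨j, le_antisymm (norm_le_pi_norm u j) ((pi_norm_le_iff_of_nonneg (norm_nonneg _)).2 hj)⟩
  set ρ := r / (8 * m) with hρ
  have hρ0 : 0 < ρ := by positivity
  set f := LinearMap.transvection (L u - LinearMap.proj j) (Pi.single j (1:ℝ)) with hf
  have hfi : ∀ y i, i ≠ j → f y i = y i := by
    intro y i hi; simp [hf, LinearMap.transvection.apply, hi]
  have hfj : ∀ y, f y j = L u y := by
    intro y; simp [hf, LinearMap.transvection.apply]
  have hdet : LinearMap.det f = u j := by
    rw [hf, LinearMap.transvection.det]; simp [L_single]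
  have huj : u j ≠ 0 := by intro h; rw [h] at hj; simp at hj; exact hu (by simpa using hj.symm)
  set B : Set (Y m) := Set.pi univ (fun i => Ioo (if i = j then a else -ρ) (if i = j then b else ρ)) with hB
  have hvB : volume.real B = (r / (4 * m)) ^ (m - 1) * (b - a) := by
    rw [hB, measureReal_def, Real.volume_pi_Ioo, ← ENNReal.ofReal_prod_of_nonneg]
    · rw [ENNReal.toReal_ofReal]
      · rw [Fintype.prod_eq_mul_prod_compl j]
        rw [Finset.prod_congr rfl (g := fun _ => r / (4 * m))]
        · rw [Finset.prod_const, Finset.card_compl, Finset.card_singleton, Fintype.card_fin, if_pos rfl, if_pos rfl]; ring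
        · intro i hi
          have : i ≠ j := by simpa using hi
          simp [this, hρ]; field_simp; ring
      · apply Finset.prod_nonneg; intro i _; split_ifs <;> linarith
    · intro i _; split_ifs <;> linarith
  have hsub : f ⁻¹' B ⊆ ball (0 : Y m) r ∩ {y | a < L u y ∧ L u y < b} := by
    intro y hy
    simp only [hB, mem_preimage, mem_univ_pi] at hy
    have hyj := hy j
    simp only [if_true, mem_Ioo, hfj] at hyj
    have hyi : ∀ i, i ≠ j → |y i| < ρ := by
      intro i hi; have := hy i; simp only [hi, if_false, mem_Ioo, hfi y i hi] at this
      exact abs_lt.2 this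
    refine ⟨?_, hyj⟩
    rw [mem_ball_zero_iff, pi_norm_lt_iff hr]
    have hρr : ρ ≤ r / 8 := by rw [hρ]; gcongr; have : (1:ℝ) ≤ m := by exact_mod_cast hm
                               linarith
    intro i
    by_cases hi : i = j
    · subst hi
      have e : u i * y i = L u y - L u (Function.update y i 0) := by
        have : y = Function.update y i 0 + Pi.single i (y i) := by
          ext k; by_cases hk : k = i
          · subst hk; simp
          · simp [hk]
        conv_rhs => rw [show L u y = L u (Function.update y i 0 + Pi.single i (y i)) by rw [← this]]
        rw [map_add, L_single]; ring
      have h1 : ‖Function.update y i 0‖ ≤ ρ := by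
        rw [pi_norm_le_iff_of_nonneg hρ0.le]; intro k
        by_cases hk : k = i
        · subst hk; simp [hρ0.le]
        · simp [hk]; exact (hyi k hk).le
      have h2 := L_abs u (Function.update y i 0)
      have h3 : |L u (Function.update y i 0)| ≤ ‖u‖ * r / 8 := by
        refine h2.trans ((mul_le_mul_of_nonneg_left h1 (by positivity)).trans (le_of_eq ?_))
        rw [hρ]; field_simp
      have h4 : |L u y| ≤ ‖u‖ * r / 4 := by
        rw [abs_le] at ha hb ⊢; constructor <;> linarith
      have h5 : ‖u‖ * |y i| ≤ ‖u‖ * (r * (3 / 8)) := by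
        rw [← hj, Real.norm_eq_abs, ← abs_mul, e, ← Real.norm_eq_abs, ← Real.norm_eq_abs, hj]
        refine (norm_sub_le _ _).trans ?_
        rw [Real.norm_eq_abs, Real.norm_eq_abs]; linarith
      have := le_of_mul_le_mul_left h5 hN
      rw [Real.norm_eq_abs]; linarith
    · rw [Real.norm_eq_abs]; linarith [hyi i hi]
  refine le_trans (le_of_eq ?_) (mono hsub (isBounded_ball.subset inter_subset_left))
  rw [measureReal_def, Measure.addHaar_preimage_linearMap _ (by rw [hdet]; exact huj), ENNReal.toReal_mul,
    ENNReal.toReal_ofReal (abs_nonneg _), ← measureReal_def, hvB, hdet, abs_inv, ← Real.norm_eq_abs, hj]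
  ring

end QBM

namespace QBM
set_option linter.unusedSectionVars false
set_option linter.style.longLine false
set_option linter.unusedVariables false
set_option linter.unusedSimpArgs false
variable {m : ℕ}

lemma half_pt (hm : 1 ≤ m) {r : ℝ} (hr : 0 < r) {u : Y m} (hu : u ≠ 0) {f k k' : Set (Y m)} (bf : IsBounded f) (bk : IsBounded k) (bk' : IsBounded k')
    (hk : ball (0 : Y m) r ⊆ k) {b a0 g e : ℝ} {x x' : Y m} (ha0 : |a0| ≤ ‖u‖ * r / 8)
    (h1 : volume.real (symmDiff (f ∩ {y | b < L u y}) (x' +ᵥ (k' ∩ {y | a0 < L u y}))) ≤ g)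
    (h2 : volume.real (symmDiff k' k) ≤ e) :
    min |b - L u x - a0| (‖u‖ * r / 8) ≤ ‖u‖ / (r / (4 * m)) ^ (m - 1) * (volume.real (symmDiff f (x +ᵥ k)) + g + e) := by
  have hN : 0 < ‖u‖ := norm_pos_iff.2 hu
  have hmpos : (0:ℝ) < m := by exact_mod_cast hm
  set c0 := (r / (4 * m)) ^ (m - 1) with hc0
  have hc0p : 0 < c0 := by positivity
  have key : ∀ (A B S : Set (Y m)), symmDiff (A ∩ S) (B ∩ S) ⊆ symmDiff A B := by
    intro A B S y hy; simp only [mem_symmDiff, mem_inter_iff] at hy ⊢; tauto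
  have bfi : ∀ S, IsBounded (f ∩ S) := fun S => bf.subset inter_subset_left
  have bki : ∀ S, IsBounded (k ∩ S) := fun S => bk.subset inter_subset_left
  have bki' : ∀ S, IsBounded (k' ∩ S) := fun S => bk'.subset inter_subset_left
  have e1 := (abs_vol_sub_le (bfi _) (bdd_vadd (x := x') (bki' {y | a0 < L u y}))).trans h1
  rw [vol_vadd] at e1
  have e2 := (abs_vol_sub_le (bki' {y | a0 < L u y}) (bki {y | a0 < L u y})).trans ((mono (key _ _ _) (bdd_sd bk' bk)).trans h2)
  have e3 := (abs_vol_sub_le (bfi {y | b < L u y}) ((bdd_vadd (x := x) bk).subset (inter_subset_left (t := {y | b < L u y})))).trans (mono (key _ _ _) (bdd_sd bf (bdd_vadd bk)))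
  have e4 : (x +ᵥ k) ∩ {y | b < L u y} = x +ᵥ (k ∩ {y | b - L u x < L u y}) := by
    ext y; simp only [mem_inter_iff, mem_vadd_set_iff_neg_vadd_mem, vadd_eq_add, mem_ofPred_eq, map_add, map_neg]
    constructor
    · rintro ⟨h, h'⟩; exact ⟨h, by linarith⟩
    · rintro ⟨h, h'⟩; exact ⟨h, by linarith⟩
  rw [e4, vol_vadd] at e3
  set a := b - L u x with ha
  set τ := ‖u‖ * r / 8 with hτ
  have hτ0 : 0 < τ := by positivity
  have mS : ∀ c : ℝ, MeasurableSet {y : Y m | c < L u y} := fun c => (isOpen_lt continuous_const (L_cont u)).measurableSet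
  have e5 : ∀ c d, c ≤ d → volume.real (k ∩ {y | c < L u y ∧ L u y < d}) + volume.real (k ∩ {y | d < L u y}) ≤ volume.real (k ∩ {y | c < L u y}) := by
    intro c d hcd
    have hh := measureReal_inter_add_sdiff (μ := volume) (s := k ∩ {y | c < L u y}) (mS d) (fin (bki _))
    rw [← hh, add_comm]
    apply add_le_add
    · apply mono _ ((bki _).subset inter_subset_left)
      rintro y ⟨hy, hy2⟩; exact ⟨⟨hy, lt_of_le_of_lt hcd hy2⟩, hy2⟩
    · apply mono _ ((bki _).subset sdiff_subset)
      rintro y ⟨hy, hy2, hy3⟩; exact ⟨⟨hy, hy2⟩, fun h => lt_asymm h hy3⟩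
  have e6 : c0 / ‖u‖ * min |a - a0| τ ≤ |volume.real (k ∩ {y | a < L u y}) - volume.real (k ∩ {y | a0 < L u y})| := by
    have hst : ∀ c d, c ≤ d → |c| ≤ ‖u‖ * r / 4 → |d| ≤ ‖u‖ * r / 4 → c0 / ‖u‖ * (d - c) ≤ volume.real (k ∩ {y | c < L u y ∧ L u y < d}) := by
      intro c d h hc hd
      refine (strip hm hr hu h hc hd).trans (mono (inter_subset_inter_left _ hk) (bki _))
    have h44 : ‖u‖ * r / 4 = 2 * τ := by rw [hτ]; ring
    rw [h44] at hst
    rw [abs_le] at ha0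
    rcases le_total a0 a with h | h
    · have h3 := e5 a0 a h
      rw [abs_of_nonneg (sub_nonneg.2 h)]
      have h4 := hst a0 (a0 + min (a - a0) τ) (by linarith [le_min (sub_nonneg.2 h) hτ0.le]) (by rw [abs_le]; constructor <;> linarith)
        (by rw [abs_le]; constructor <;> linarith [le_min (sub_nonneg.2 h) hτ0.le, min_le_right (a - a0) τ])
      have h5 := mono (s := k ∩ {y | a0 < L u y ∧ L u y < a0 + min (a - a0) τ}) (t := k ∩ {y | a0 < L u y ∧ L u y < a})
        (by rintro y ⟨h1, h2, h3⟩; exact ⟨h1, h2, by linarith [h3, min_le_left (a - a0) τ]⟩) (bki _)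
      rw [add_sub_cancel_left] at h4
      refine le_trans ?_ (neg_le_abs _)
      linarith
    · have h3 := e5 a a0 h
      rw [abs_of_nonpos (sub_nonpos.2 h), neg_sub]
      have hmn := le_min (sub_nonneg.2 h) hτ0.le
      have h4 := hst (a0 - min (a0 - a) τ) a0 (by linarith) 
        (by rw [abs_le]; constructor <;> linarith [min_le_right (a0 - a) τ]) (by rw [abs_le]; constructor <;> linarith)
      have h5 := mono (s := k ∩ {y | a0 - min (a0 - a) τ < L u y ∧ L u y < a0}) (t := k ∩ {y | a < L u y ∧ L u y < a0})
        (by rintro y ⟨h1, h2, h3⟩; exact ⟨h1, by linarith [h2, min_le_left (a0 - a) τ], h3⟩) (bki _)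
      rw [sub_sub_cancel] at h4
      refine le_trans ?_ (le_abs_self _)
      linarith
  have e7 : |volume.real (k ∩ {y | a < L u y}) - volume.real (k ∩ {y | a0 < L u y})| ≤ volume.real (symmDiff f (x +ᵥ k)) + g + e := by
    rw [abs_le] at e1 e2 e3 ⊢; constructor <;> linarith
  have e8 := e6.trans e7
  have : ‖u‖ / c0 * (c0 / ‖u‖ * min |a - a0| τ) = min |a - a0| τ := by field_simp
  rw [← this]
  gcongr

lemma combine {a b u τ B D gp gm q : ℝ} (hab : a * b ≤ 0) (hs : |a| + |b| ≤ τ) (hq : 0 ≤ q) (hA : q * B ≤ 1 / 2)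
    (h1 : min |u - a| τ ≤ q * (D + gp + B * |a|)) (h2 : min |u - b| τ ≤ q * (D + gm + B * |b|)) :
    min |u| τ ≤ 4 * (q * (2 * D + gp + gm)) := by
  have hE : |a| + |b| = |a - b| := by
    rcases le_total a 0 with h | h <;> rcases le_total b 0 with h' | h'
    · rcases eq_or_lt_of_le h with rfl | h
      · simp
      · have : b = 0 := by nlinarith
        subst this; simp
    · rw [abs_of_nonpos h, abs_of_nonneg h', abs_of_nonpos (by linarith)]; ring
    · rw [abs_of_nonneg h, abs_of_nonpos h', abs_of_nonneg (by linarith)]; ring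
    · rcases eq_or_lt_of_le h with rfl | h
      · simp
      · have : b = 0 := by nlinarith
        subst this; simp
  set e1 := q * (D + gp + B * |a|)
  set e2 := q * (D + gm + B * |b|)
  have m1 : min |u - a| τ ≥ 0 := le_min (abs_nonneg _) (by linarith [abs_nonneg a, abs_nonneg b])
  have m2 : min |u - b| τ ≥ 0 := le_min (abs_nonneg _) (by linarith [abs_nonneg a, abs_nonneg b])
  have h3 : |a| + |b| ≤ e1 + e2 := by
    rcases le_total τ |u - a| with h | h
    · rw [min_eq_right h] at h1; linarith
    · rcases le_total τ |u - b| with h' | h'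
      · rw [min_eq_right h'] at h2; linarith
      · rw [min_eq_left h] at h1; rw [min_eq_left h'] at h2
        rw [hE]
        calc |a - b| = |(u - b) - (u - a)| := by ring_nf
          _ ≤ |u - b| + |u - a| := abs_sub _ _
          _ ≤ _ := by linarith
  have h4 : e1 + e2 = q * (2 * D + gp + gm) + q * B * (|a| + |b|) := by ring
  have h5 : q * B * (|a| + |b|) ≤ 1 / 2 * (|a| + |b|) := by gcongr
  have h6 : min |u| τ ≤ min |u - a| τ + |a| := by
    have := abs_add_le (u - a) a
    rw [sub_add_cancel] at this
    rcases le_total τ |u - a| with h | h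
    · rw [min_eq_right h]; linarith [min_le_right |u| τ, abs_nonneg a]
    · rw [min_eq_left h]; linarith [min_le_left |u| τ]
  linarith [abs_nonneg a, abs_nonneg b]

lemma hf_sub {u : Y m} {θ ρ : ℝ} (hu : ‖u‖ ≤ 2 * θ) {p : X m} (hp : ‖p‖ ≤ ρ) : |hf u p - p.1| ≤ 2 * m * θ * ρ := by
  rw [hf_apply, add_sub_cancel_left]
  refine (L_abs u p.2).trans ?_
  have := (norm_snd_le p).trans hp
  calc m * ‖u‖ * ‖p.2‖ ≤ m * (2 * θ) * ρ := by
          have := (norm_nonneg u).trans hu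
          gcongr
    _ = _ := by ring

lemma Geo.inc {K : Set (X m)} {y0 : Y m} {r R : ℝ} (G : Geo K y0 r R) (oK : IsOpen K) (bK : IsBounded K) {a c : ℝ} (ha : -r ≤ a) (hac : a ≤ c) (hc : c ≤ r) :
    (2 * r) ^ m * (c - a) ≤ cum K c - cum K a :=
  cum_inc_ge oK.measurableSet bK hac fun s hs => G.sl_ge bK (abs_lt.2 ⟨by linarith [hs.1], by linarith [hs.2]⟩)

lemma Geo.inc' {K : Set (X m)} {y0 : Y m} {r R : ℝ} (G : Geo K y0 r R) (oK : IsOpen K) (bK : IsBounded K) {a d : ℝ} (ha : |a| ≤ r) (hd : 0 ≤ d) :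
    (2 * r) ^ m * min d (r - a) ≤ cum K (a + d) - cum K a ∧ (2 * r) ^ m * min d (r - a) ≤ cum K (-a) - cum K (-a - d) := by
  rw [abs_le] at ha
  have hmn : 0 ≤ min d (r - a) := le_min hd (by linarith)
  have h1 := min_le_left d (r - a)
  have h2 := min_le_right d (r - a)
  constructor
  · have := G.inc oK bK (a := a) (c := a + min d (r - a)) (by linarith) (by linarith) (by linarith)
    have h3 := cum_mono bK (show a + min d (r - a) ≤ a + d by linarith)
    rw [add_sub_cancel_left] at this
    linarith
  · have := G.inc oK bK (a := -a - min d (r - a)) (c := -a) (by linarith) (by linarith) (by linarith)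
    have h3 := cum_mono bK (show -a - d ≤ -a - min d (r - a) by linarith)
    rw [sub_sub_cancel] at this
    linarith

lemma union_bd {F A B : Set (X m)} {v : ℝ} (bF : IsBounded F) (h : A ⊆ B ∪ F \ closedBall 0 R1) (bB : IsBounded B) (hv : volume.real (F \ closedBall 0 R1) ≤ v) :
    volume.real A ≤ volume.real B + v :=
  (mono h (bB.union (bF.subset sdiff_subset))).trans ((measureReal_union_le _ _).trans (by linarith))

lemma gam_bound {F K : Set (X m)} (P : Pair F K) {r R R1 v1 θ γ : ℝ} (G : Geo K 0 r R) (hR1 : 0 < R1) (hθ : 0 < θ)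
    (hloc : volume.real (F \ closedBall 0 R1) ≤ v1) (hco : ∀ z, |cum F z - cum K z| ≤ 2 * v1) {u : Y m} (hu : ‖u‖ ≤ 2 * θ)
    (hA : Adm F K u γ) (hv : 3 * v1 < (2 * r) ^ m * θ) (hθr : 2 * m * θ * R + θ ≤ r) :
    |γ| ≤ θ * (2 * m * (R1 + R) + 1) := by
  have hr := G.hr
  have hR := G.hR
  set D := 2 * m * θ * R with hD
  set D1 := 2 * m * θ * R1 with hD1
  have hD0 : 0 ≤ D := by positivity
  have hK : ∀ p ∈ K, |hf u p - p.1| ≤ D := fun p hp => hf_sub hu (G.bd p hp).le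
  have hF : ∀ p ∈ F, p ∈ closedBall (0 : X m) R1 → |hf u p - p.1| ≤ D1 := fun p _ hp => hf_sub hu (mem_closedBall_zero_iff.1 hp)
  have i1 : cum F (γ - D1) ≤ volume.real (F ∩ {p | hf u p < γ}) + v1 := by
    refine union_bd P.bF ?_ (P.bF.subset inter_subset_left) hloc
    rintro p ⟨hp, hp2⟩
    by_cases hb : p ∈ closedBall (0 : X m) R1
    · left; refine ⟨hp, ?_⟩
      have := hF p hp hb; rw [abs_le] at this
      simp only [mem_ofPred_eq] at hp2 ⊢; linarith
    · right; exact ⟨hp, hb⟩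
  have i2 : volume.real (F ∩ {p | hf u p < γ}) ≤ cum F (γ + D1) + v1 := by
    refine union_bd P.bF ?_ (P.bF.subset inter_subset_left) hloc
    rintro p ⟨hp, hp2⟩
    by_cases hb : p ∈ closedBall (0 : X m) R1
    · left; refine ⟨hp, ?_⟩
      have := hF p hp hb; rw [abs_le] at this
      simp only [mem_ofPred_eq] at hp2 ⊢; linarith
    · right; exact ⟨hp, hb⟩
  have i3 : volume.real (K ∩ {p | hf u p < 0}) ≤ cum K D := by
    refine mono ?_ (P.bK.subset inter_subset_left)
    rintro p ⟨hp, hp2⟩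
    refine ⟨hp, ?_⟩
    have := hK p hp; rw [abs_le] at this
    simp only [mem_ofPred_eq] at hp2 ⊢; linarith
  have i4 : cum K (-D) ≤ volume.real (K ∩ {p | hf u p < 0}) := by
    refine mono ?_ (P.bK.subset inter_subset_left)
    rintro p ⟨hp, hp2⟩
    refine ⟨hp, ?_⟩
    have := hK p hp; rw [abs_le] at this
    simp only [mem_ofPred_eq] at hp2 ⊢; linarith
  rw [Adm] at hA
  have eM : θ * (2 * m * (R1 + R) + 1) = D1 + D + θ := by rw [hD, hD1]; ring
  rw [eM]
  have c1 := abs_le.1 (hco (γ - D1))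
  have c2 := abs_le.1 (hco (γ + D1))
  rw [abs_le]; constructor
  · by_contra hc
    push Not at hc
    have := G.inc P.oK P.bK (a := -D - θ) (c := -D) (by linarith) (by linarith) (by linarith)
    have h2 := cum_mono P.bK (show γ + D1 ≤ -D - θ by linarith)
    rw [sub_sub_cancel] at this
    linarith
  · by_contra hc
    push Not at hc
    have := G.inc P.oK P.bK (a := D) (c := D + θ) (by linarith) (by linarith) (by linarith)
    have h2 := cum_mono P.bK (show D + θ ≤ γ - D1 by linarith)
    rw [add_sub_cancel_left] at this
    linarith

end QBM

namespace QBM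
set_option linter.unusedSectionVars false
set_option linter.style.longLine false
set_option linter.unusedVariables false
set_option linter.unusedSimpArgs false
variable {m : ℕ}

def up (S : Set (X m)) (u : Y m) (γ : ℝ) : Set (X m) := S ∩ {p | γ < hf u p}
def lo (S : Set (X m)) (u : Y m) (γ : ℝ) : Set (X m) := S ∩ {p | hf u p < γ}

lemma up_open (u : Y m) (γ : ℝ) : IsOpen {p : X m | γ < hf u p} := isOpen_lt continuous_const (hf_cont u)
lemma lo_open (u : Y m) (γ : ℝ) : IsOpen {p : X m | hf u p < γ} := isOpen_lt (hf_cont u) continuous_const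

lemma Pair.up {F K : Set (X m)} (P : Pair F K) {u : Y m} {γ : ℝ} (hA : Adm F K u γ) (ne : (up K u 0).Nonempty) : Pair (up F u γ) (up K u 0) where
  bF := P.bF.subset inter_subset_left
  mF := P.mF.inter (up_open u γ).measurableSet
  oK := P.oK.inter (up_open u 0)
  cK := P.cK.inter (convex_halfSpace_gt (hf u).isLinear _)
  bK := P.bK.subset inter_subset_left
  ne := ne
  vol := by
    unfold QBM.up
    rw [upper_eq P.mF P.bF, upper_eq P.oK.measurableSet P.bK, P.vol, hA]

lemma Pair.lo {F K : Set (X m)} (P : Pair F K) {u : Y m} {γ : ℝ} (hA : Adm F K u γ) (ne : (lo K u 0).Nonempty) : Pair (lo F u γ) (lo K u 0) where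
  bF := P.bF.subset inter_subset_left
  mF := P.mF.inter (lo_open u γ).measurableSet
  oK := P.oK.inter (lo_open u 0)
  cK := P.cK.inter (convex_halfSpace_lt (hf u).isLinear _)
  bK := P.bK.subset inter_subset_left
  ne := ne
  vol := hA

lemma up_add_lo {S : Set (X m)} (h : MeasurableSet S) (b : IsBounded S) (u : Y m) (γ : ℝ) :
    volume.real (up S u γ) + volume.real (lo S u γ) = volume.real S := by
  have := upper_eq h b u γ
  unfold up lo; linarith

lemma cut_def (hB : BMp (X m) (m + 1)) {F K : Set (X m)} (P : Pair F K) {u : Y m} {γ t e : ℝ} (ht : 0 < t) 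
    (Pu : Pair (up F u γ) (up K u 0)) (Pl : Pair (lo F u γ) (lo K u 0))
    (hd : volume.real (F + t • K) ≤ (1 + t) ^ (m + 1) * volume.real K + e) :
    volume.real (up F u γ + t • up K u 0) ≤ (1 + t) ^ (m + 1) * volume.real (up K u 0) + e ∧
    volume.real (lo F u γ + t • lo K u 0) ≤ (1 + t) ^ (m + 1) * volume.real (lo K u 0) + e := by
  have h1 := hB _ _ Pu t ht
  have h2 := hB _ _ Pl t ht
  have h3 := up_add_lo P.oK.measurableSet P.bK u 0
  have hs1 : up F u γ + t • up K u 0 ⊆ F + t • K := add_subset_add inter_subset_left (smul_set_mono inter_subset_left)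
  have hs2 : lo F u γ + t • lo K u 0 ⊆ F + t • K := add_subset_add inter_subset_left (smul_set_mono inter_subset_left)
  have hdis : Disjoint (up F u γ + t • up K u 0) (lo F u γ + t • lo K u 0) := by
    rw [Set.disjoint_left]
    rintro _ ⟨a, ⟨_, ha⟩, _, ⟨b, ⟨_, hb⟩, rfl⟩, rfl⟩ ⟨a', ⟨_, ha'⟩, _, ⟨b', ⟨_, hb'⟩, rfl⟩, heq⟩
    simp only [mem_ofPred_eq] at ha hb ha' hb'
    have := congrArg (hf u) heq
    simp only [map_add, map_smul, smul_eq_mul] at this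
    nlinarith
  have h4 := measureReal_union (μ := volume) hdis (Pl.oS ht).measurableSet (fin (Pu.bS t)) (fin (Pl.bS t))
  have h5 := mono (union_subset hs1 hs2) (P.bS t)
  rw [← h3] at hd
  constructor <;> linarith

lemma geo_cut (hm : 1 ≤ m) {K : Set (X m)} {r R θ : ℝ} (G : Geo K 0 r R) {u : Y m} (hθ : 0 < θ) (hu1 : θ ≤ ‖u‖) (hu2 : ‖u‖ ≤ 2 * θ) (hθ1 : 2 * θ ≤ 1) :
    ∃ y1 y2 : Y m, Geo (up K u 0) y1 (θ * r / (4 * (m + 1))) R ∧ Geo (lo K u 0) y2 (θ * r / (4 * (m + 1))) R := by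
  have hr := G.hr
  have hmpos : (1:ℝ) ≤ m := by exact_mod_cast hm
  have hu : u ≠ 0 := by rintro rfl; simp at hu1; linarith
  have hN : 0 < ‖u‖ := norm_pos_iff.2 hu
  obtain ⟨j, hj⟩ : ∃ j, ‖u j‖ = ‖u‖ := by
    haveI : Nonempty (Fin m) := ⟨⟨0, hm⟩⟩
    obtain ⟨j, hj⟩ := Finite.exists_max (fun i => ‖u i‖)
    exact ⟨j, le_antisymm (norm_le_pi_norm u j) ((pi_norm_le_iff_of_nonneg (norm_nonneg _)).2 hj)⟩
  set r' := θ * r / (4 * (m + 1)) with hr'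
  have hr'0 : 0 < r' := by positivity
  have e1 : (m + 1) * r' = θ * r / 4 := by rw [hr']; field_simp
  have hr'2 : r' ≤ r / 8 := by nlinarith
  have huj : |u j| = ‖u‖ := hj
  have key : ∀ y1 : Y m, ‖y1‖ ≤ r / 2 → ∀ p ∈ ball ((0:ℝ), y1) r', p ∈ K ∧ |hf u p - L u y1| ≤ θ * r / 4 := by
    intro y1 hy1 p hp
    rw [mem_ball, Prod.dist_eq, max_lt_iff] at hp
    obtain ⟨h1, h2⟩ := hp
    simp only [Real.dist_eq, sub_zero] at h1
    rw [dist_eq_norm] at h2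
    constructor
    · apply G.ball
      rw [mem_ball, Prod.dist_eq, max_lt_iff]
      simp only [Real.dist_eq, sub_zero, dist_zero_right]
      refine ⟨by rw [Real.norm_eq_abs]; linarith, ?_⟩
      have := norm_le_norm_add_norm_sub' p.2 y1
      linarith
    · have h3 : hf u p - L u y1 = p.1 + L u (p.2 - y1) := by rw [hf_apply, map_sub]; ring
      rw [h3]
      refine (abs_add_le _ _).trans ?_
      have h4 := L_abs u (p.2 - y1)
      have h5 : m * ‖u‖ * ‖p.2 - y1‖ ≤ m * 1 * r' := by gcongr; linarith
      linarith
  have hy : ∀ a : ℝ, |a| = r / 2 → ‖(Pi.single j a : Y m)‖ ≤ r / 2 := by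
    intro a ha; rw [Pi.norm_single, Real.norm_eq_abs, ha]
  have hsg : u j * (if 0 ≤ u j then r / 2 else - (r / 2)) = ‖u‖ * (r / 2) := by
    rw [← huj]; split_ifs with h
    · rw [abs_of_nonneg h]
    · rw [abs_of_neg (not_le.1 h)]; ring
  have habs : |if 0 ≤ u j then r / 2 else - (r / 2)| = r / 2 := by
    split_ifs <;> simp <;> positivity
  set a := if 0 ≤ u j then r / 2 else - (r / 2)
  have hpos : θ * r / 4 < ‖u‖ * (r / 2) := by nlinarith [mul_pos hθ hr]
  refine ⟨Pi.single j a, Pi.single j (-a), ⟨hr'0, G.hR, ?_, fun p hp => G.bd p hp.1⟩, ⟨hr'0, G.hR, ?_, fun p hp => G.bd p hp.1⟩⟩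
  · intro p hp
    obtain ⟨h1, h2⟩ := key _ (hy a habs) p hp
    refine ⟨h1, ?_⟩
    rw [L_single, hsg, abs_le] at h2
    simp only [mem_ofPred_eq]; linarith
  · intro p hp
    obtain ⟨h1, h2⟩ := key _ (hy (-a) (by rw [abs_neg, habs])) p hp
    refine ⟨h1, ?_⟩
    rw [L_single, mul_neg, hsg, abs_le] at h2
    simp only [mem_ofPred_eq]; linarith

lemma c_small {K : Set (X m)} {r R v1 z0 c : ℝ} (G : Geo K 0 r R) (oK : IsOpen K) (bK : IsBounded K) (hz : 0 ≤ z0) (hzr : z0 ≤ r)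
    (hv : 5 * v1 < (2 * r) ^ m * (r - z0))
    (h : (∀ z, z0 ≤ z → z0 ≤ z - c → |cum K z - cum K (z - c)| ≤ 5 * v1) ∨ (∀ z, z ≤ -z0 → z - c ≤ -z0 → |cum K z - cum K (z - c)| ≤ 5 * v1)) :
    (2 * r) ^ m * |c| ≤ 5 * v1 := by
  have hr := G.hr
  have i := G.inc' oK bK (a := z0) (d := |c|) (by rw [abs_of_nonneg hz]; exact hzr) (abs_nonneg _)
  suffices hs : (2 * r) ^ m * min |c| (r - z0) ≤ 5 * v1 by
    rcases le_total |c| (r - z0) with h1 | h1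
    · rwa [min_eq_left h1] at hs
    · rw [min_eq_right h1] at hs; linarith
  rcases h with h | h
  · rcases le_total 0 c with hc | hc
    · rw [abs_of_nonneg hc] at i ⊢
      have := abs_le.1 (h (z0 + c) (by linarith) (by linarith))
      rw [add_sub_cancel_right] at this
      linarith [i.1]
    · rw [abs_of_nonpos hc] at i ⊢
      have := abs_le.1 (h z0 (by linarith) (by linarith))
      rw [show z0 - c = z0 + -c by ring] at this
      linarith [i.1]
  · rcases le_total 0 c with hc | hc
    · rw [abs_of_nonneg hc] at i ⊢
      have := abs_le.1 (h (-z0) (by linarith) (by linarith))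
      linarith [i.2]
    · rw [abs_of_nonpos hc] at i ⊢
      have := abs_le.1 (h (-z0 + c) (by linarith) (by linarith))
      rw [add_sub_cancel_right] at this
      have e : -z0 - -c = -z0 + c := by ring
      rw [e] at i
      linarith [i.2]

lemma cpm_small {F K : Set (X m)} (P : Pair F K) {r R R1 v1 θ γ z0 cp cm : ℝ} (G : Geo K 0 r R) 
    (hloc : volume.real (F \ closedBall 0 R1) ≤ v1) (hco : ∀ z, |cum F z - cum K z| ≤ 2 * v1) {u : Y m} (hu : ‖u‖ ≤ 2 * θ)
    (Pu : Pair (up F u γ) (up K u 0)) (Pl : Pair (lo F u γ) (lo K u 0))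
    (hcp : ∀ z, |cum (up F u γ) z - cum (up K u 0) (z - cp)| ≤ 2 * v1) (hcm : ∀ z, |cum (lo F u γ) z - cum (lo K u 0) (z - cm)| ≤ 2 * v1)
    (hz : 0 ≤ z0) (hzr : z0 ≤ r) (hz1 : 2 * m * θ * R ≤ z0) (hz2 : |γ| + 2 * m * θ * R1 ≤ z0)
    (hv : 5 * v1 < (2 * r) ^ m * (r - z0)) : (2 * r) ^ m * |cp| ≤ 5 * v1 ∧ (2 * r) ^ m * |cm| ≤ 5 * v1 := by
  have hK : ∀ p ∈ K, |hf u p - p.1| ≤ 2 * m * θ * R := fun p hp => hf_sub hu (G.bd p hp).le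
  have hF : ∀ p ∈ F, p ∈ closedBall (0 : X m) R1 → |hf u p - p.1| ≤ 2 * m * θ * R1 := fun p _ hp => hf_sub hu (mem_closedBall_zero_iff.1 hp)
  have hγ := abs_le.1 (le_refl |γ|)
  constructor
  · refine c_small G P.oK P.bK hz hzr hv (Or.inl fun z h1 h2 => ?_)
    have a1 : ∀ z, z0 ≤ z → volume.real (up K u 0) - cum (up K u 0) z = volume.real K - cum K z := by
      intro z hz'
      rw [← tail_eq Pu.oK.measurableSet Pu.bK, ← tail_eq P.oK.measurableSet P.bK]
      congr 1; ext p; simp only [up, mem_inter_iff, mem_ofPred_eq]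
      constructor
      · tauto
      · rintro ⟨hp, hp2⟩
        have := abs_le.1 (hK p hp)
        exact ⟨⟨hp, by linarith⟩, hp2⟩
    have a2 : volume.real F - cum F z ≤ volume.real (up F u γ) - cum (up F u γ) z + v1 := by
      rw [← tail_eq Pu.mF Pu.bF, ← tail_eq P.mF P.bF]
      refine union_bd P.bF ?_ (Pu.bF.subset inter_subset_left) hloc
      rintro p ⟨hp, hp2⟩
      by_cases hb : p ∈ closedBall (0 : X m) R1
      · left
        have := abs_le.1 (hF p hp hb)
        simp only [up, mem_inter_iff, mem_ofPred_eq] at hp2 ⊢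
        exact ⟨⟨hp, by linarith⟩, hp2⟩
      · right; exact ⟨hp, hb⟩
    have a3 : volume.real (up F u γ) - cum (up F u γ) z ≤ volume.real F - cum F z := by
      rw [← tail_eq Pu.mF Pu.bF, ← tail_eq P.mF P.bF]
      exact mono (inter_subset_inter_left _ inter_subset_left) (P.bF.subset inter_subset_left)
    have a4 := a1 (z - cp) h2
    have b1 := abs_le.1 (hco z)
    have b2 := abs_le.1 (hcp z)
    have v1 := Pu.vol
    have v2 := P.vol
    rw [abs_le]; constructor <;> linarith
  · refine c_small G P.oK P.bK hz hzr hv (Or.inr fun z h1 h2 => ?_)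
    have a1 : ∀ z, z ≤ -z0 → cum (lo K u 0) z = cum K z := by
      intro z hz'
      unfold cum
      congr 1; ext p; simp only [lo, mem_inter_iff, mem_ofPred_eq]
      constructor
      · tauto
      · rintro ⟨hp, hp2⟩
        have := abs_le.1 (hK p hp)
        exact ⟨⟨hp, by linarith⟩, hp2⟩
    have a2 : cum F z ≤ cum (lo F u γ) z + v1 := by
      refine union_bd P.bF ?_ (Pl.bF.subset inter_subset_left) hloc
      rintro p ⟨hp, hp2⟩
      by_cases hb : p ∈ closedBall (0 : X m) R1
      · left
        have := abs_le.1 (hF p hp hb)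
        simp only [lo, mem_inter_iff, mem_ofPred_eq] at hp2 ⊢
        exact ⟨⟨hp, by linarith⟩, hp2⟩
      · right; exact ⟨hp, hb⟩
    have a3 : cum (lo F u γ) z ≤ cum F z := 
      mono (inter_subset_inter_left _ inter_subset_left) (P.bF.subset inter_subset_left)
    have a4 := a1 (z - cm) h2
    have b1 := abs_le.1 (hco z)
    have b2 := abs_le.1 (hcm z)
    rw [abs_le]; constructor <;> linarith

lemma exists_cpm {F K : Set (X m)} (P : Pair F K) {u : Y m} {γ : ℝ}
    (Pu : Pair (up F u γ) (up K u 0)) (Pl : Pair (lo F u γ) (lo K u 0)) (h0 : cum F 0 = cum K 0) :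
    ∃ cp cm, cum (up F u γ) cp = cum (up K u 0) 0 ∧ cum (lo F u γ) cm = cum (lo K u 0) 0 ∧ cp * cm ≤ 0 := by
  obtain ⟨cp, hp⟩ := cum_ivt Pu.mF Pu.bF (v := cum (up K u 0) 0) (cum_nonneg _ _) (by rw [Pu.vol]; exact cum_le Pu.bK 0)
  obtain ⟨cm, hm⟩ := cum_ivt Pl.mF Pl.bF (v := cum (lo K u 0) 0) (cum_nonneg _ _) (by rw [Pl.vol]; exact cum_le Pl.bK 0)
  have hsum : ∀ {S : Set (X m)} (z γ : ℝ), MeasurableSet S → IsBounded S → cum (up S u γ) z + cum (lo S u γ) z = cum S z := by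
    intro S z γ h b
    have := up_add_lo (h.inter (measurableSet_lt measurable_fst measurable_const : MeasurableSet {p : X m | p.1 < z})) (b.subset inter_subset_left) u γ
    unfold cum
    rw [← this]; unfold up lo
    rw [inter_right_comm S {p | γ < hf u p}, inter_right_comm S {p | hf u p < γ}]
  have s1 := hsum 0 γ P.mF P.bF
  have s2 := hsum 0 0 P.oK.measurableSet P.bK
  by_cases hc : cp * cm ≤ 0
  · exact ⟨cp, cm, hp, hm, hc⟩
  · push Not at hc
    refine ⟨0, 0, ?_, ?_, by simp⟩ <;>
    · rcases pos_and_pos_or_neg_and_neg_of_mul_pos hc with ⟨h1, h2⟩ | ⟨h1, h2⟩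
      · have := cum_mono Pu.bF h1.le
        have := cum_mono Pl.bF h2.le
        linarith
      · have := cum_mono Pu.bF h1.le
        have := cum_mono Pl.bF h2.le
        linarith

end QBM

namespace QBM
set_option linter.unusedSectionVars false
set_option linter.style.longLine false
set_option linter.unusedVariables false
set_option linter.unusedSimpArgs false
variable {m : ℕ}

lemma slice_up (S : Set (X m)) (u : Y m) (γ s : ℝ) : slice (up S u γ) s = slice S s ∩ {y | γ - s < L u y} := by
  ext y; simp only [mem_slice, up, mem_inter_iff, mem_ofPred_eq, hf_apply]
  refine and_congr_right fun _ => ?_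
  constructor <;> intro h <;> linarith

lemma slice_lo (S : Set (X m)) (u : Y m) (γ s : ℝ) : slice (lo S u γ) s = slice S s ∩ {y | -(γ - s) < L (-u) y} := by
  ext y; simp only [mem_slice, lo, mem_inter_iff, mem_ofPred_eq, hf_apply, L_neg]
  refine and_congr_right fun _ => ?_
  constructor <;> intro h <;> linarith

lemma Geo.slice_ball {K : Set (X m)} {r R : ℝ} (G : Geo K 0 r R) {s : ℝ} (hs : |s| < r) : Metric.ball (0 : Y m) r ⊆ slice K s := by
  intro y hy
  apply G.ball
  rw [mem_ball, Prod.dist_eq, max_lt_iff]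
  rw [mem_ball] at hy
  exact ⟨by simpa [Real.dist_eq] using hs, hy⟩

structure TiltC (F K : Set (X m)) (θ ω r C D : ℝ) : Prop where
  base : ∃ g : ℝ → ℝ, Integrable g ∧ (∀ s, 0 ≤ g s) ∧ ∫ s, g s ≤ D ∧
    ∀ᵐ s, |s| ≤ ω → ∃ x : Y m, volume.real (symmDiff (slice F s) (x +ᵥ slice K s)) ≤ g s
  tilt : ∀ u : Y m, θ ≤ ‖u‖ → ‖u‖ ≤ 2 * θ → ∀ γ, Adm F K u γ → ∃ g : ℝ → ℝ, Integrable g ∧ (∀ s, 0 ≤ g s) ∧ ∫ s, g s ≤ D ∧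
    ∀ᵐ s, |s| ≤ ω → ∀ x : Y m, min |γ - L u x| (θ * r / 8) ≤ g s + C * volume.real (symmDiff (slice F s) (x +ᵥ slice K s))

set_option maxHeartbeats 2000000 in
theorem tilt (hm : 1 ≤ m) (hB : BMp (Y m) m) (hS : Stp (Y m) m) {r R R1 : ℝ} (hr : 0 < r) (hR : 0 < R) (hR1 : 0 < R1) :
    ∃ θ0 : ℝ, 0 < θ0 ∧ ∀ θ, 0 < θ → θ ≤ θ0 → ∃ ω v1 C B ε0 : ℝ, 0 < ω ∧ ω < r ∧ 0 < v1 ∧ 0 < C ∧ 0 < B ∧ 0 < ε0 ∧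
      ∀ (F K : Set (X m)), Pair F K → Geo K 0 r R → volume.real (F \ closedBall 0 R1) ≤ v1 → ∀ t ε, 0 < t → t ≤ 1 → 0 < ε → ε ≤ ε0 →
        volume.real (F + t • K) ≤ (1 + t) ^ (m + 1) * volume.real K + t * ε ^ 2 → cum F 0 = cum K 0 → TiltC F K θ ω r B (C * ε) := by
  have hBX := BMp_succ hm hB
  have hmpos : (1:ℝ) ≤ m := by exact_mod_cast hm
  set M := 2 * m * (R1 + R) + 1 with hM
  set c0 := (r / (4 * m)) ^ (m - 1) with hc0
  have hc0p : 0 < c0 := by positivity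
  set C3 := 4 * m * (2 * R) ^ m / r with hC3
  have hC3p : 0 < C3 := by positivity
  set Z := M + 2 * m * R1 + 2 * m * R with hZ
  have hM1 : 1 ≤ M := by rw [hM]; have : 0 ≤ 2 * m * (R1 + R) := by positivity
                         linarith
  have hZp : 0 < Z := by positivity
  refine ⟨min (1 / 2) (min (r / (2 * Z)) (c0 / (4 * C3))), by positivity, fun θ hθ hθ0 => ?_⟩
  rw [le_min_iff, le_min_iff, le_div_iff₀ (by positivity), le_div_iff₀ (by positivity), le_div_iff₀ (by positivity)] at hθ0
  obtain ⟨hθ1, hθ2, hθ3⟩ := hθ0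
  set r' := θ * r / (4 * (m + 1)) with hr'
  have hr'0 : 0 < r' := by positivity
  have er' : (m + 1) * r' = θ * r / 4 := by rw [hr']; field_simp
  have hr'1 : r' ≤ θ * r / 8 := by nlinarith
  have hθr : θ * r ≤ r := by nlinarith
  set v1 := min ((2 * r') ^ m * (r' / 4)) (min ((2 * r) ^ m * (r' / 40)) ((2 * r) ^ m * (θ / 4))) with hv1
  have hv10 : 0 < v1 := by positivity
  have hP : 0 < (2 * r) ^ m := by positivity
  have hva : v1 ≤ (2 * r') ^ m * (r' / 4) := min_le_left _ _
  have hvb : v1 ≤ (2 * r) ^ m * (r' / 40) := (min_le_right _ _).trans (min_le_left _ _)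
  have hvc : v1 ≤ (2 * r) ^ m * (θ / 4) := (min_le_right _ _).trans (min_le_right _ _)
  have hvd : v1 ≤ (2 * r) ^ m * (r / 4) := hvb.trans (mul_le_mul_of_nonneg_left (by linarith) hP.le)
  obtain ⟨C1, ε1, hC1, hε1, H1⟩ := LDU hm hB hS hr hR hv10 hvd
  obtain ⟨C2, ε2, hC2, hε2, H2⟩ := LDU hm hB hS hr'0 hR hv10 hva
  set q0 := 2 * θ / c0 with hq0
  have hq0p : 0 < q0 := by positivity
  refine ⟨r' / 8, v1, C1 + 4 * q0 * (2 * C2), 8 * q0, min ε1 ε2, by positivity, by linarith, hv10, by positivity, by positivity, by positivity, ?_⟩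
  intro F K P G hloc t ε ht ht1 hε hε0 hdef h0
  have hL := H1 F K 0 P G t ε ht ht1 hε (hε0.trans (min_le_left _ _)) hdef 0 h0
  have hco : ∀ z, |cum F z - cum K z| ≤ 2 * v1 := fun z => by simpa using hL.coarse z
  refine ⟨?_, ?_⟩
  · obtain ⟨g, g1, g2, g3, g4⟩ := hL.fine
    refine ⟨g, g1, g2, g3.trans ?_, ?_⟩
    · gcongr
      have : 0 < 4 * q0 * (2 * C2) := by positivity
      linarith
    · filter_upwards [g4] with s hs hss
      have := hs (by rw [sub_zero]; linarith)
      simpa using this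
  · intro u hu1 hu2 γ hA
    obtain ⟨y1, y2, G1, G2⟩ := geo_cut hm G hθ hu1 hu2 (by linarith)
    have hu : u ≠ 0 := by rintro rfl; simp at hu1; linarith
    have Pu := P.up hA ⟨_, G1.ball (mem_ball_self G1.hr)⟩
    have Pl := P.lo hA ⟨_, G2.ball (mem_ball_self G2.hr)⟩
    obtain ⟨hd1, hd2⟩ := cut_def hBX P ht Pu Pl hdef
    obtain ⟨cp, cm, hcp, hcm, hcc⟩ := exists_cpm P Pu Pl h0
    have Lp := H2 _ _ y1 Pu G1 t ε ht ht1 hε (hε0.trans (min_le_right _ _)) hd1 cp hcp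
    have Lm := H2 _ _ y2 Pl G2 t ε ht ht1 hε (hε0.trans (min_le_right _ _)) hd2 cm hcm
    have hZ2 : θ * Z ≤ r / 2 := by linarith
    have hZe : θ * Z = θ * M + 2 * m * θ * R1 + 2 * m * θ * R := by rw [hZ]; ring
    have n1 : 0 ≤ 2 * m * θ * R1 := by positivity
    have n2 : 0 ≤ 2 * m * θ * R := by positivity
    have n3 : θ ≤ θ * M := by nlinarith
    have hγ := gam_bound P G hR1 hθ hloc hco hu2 hA (by linarith [mul_pos hP hθ]) (by linarith)
    obtain ⟨k1, k2⟩ := cpm_small P G hloc hco hu2 Pu Pl Lp.coarse Lm.coarse (z0 := θ * Z) (by positivity) (by linarith) (by linarith) 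
      (by linarith) (by
        have : (2 * r) ^ m * (r / 2) ≤ (2 * r) ^ m * (r - θ * Z) := by gcongr; linarith
        have : (2 * r) ^ m * (5 * (r' / 40)) < (2 * r) ^ m * (r / 2) := by gcongr; linarith
        linarith)
    have k1' : |cp| ≤ r' / 8 := le_of_mul_le_mul_left (k1.trans (by linarith)) hP
    have k2' : |cm| ≤ r' / 8 := le_of_mul_le_mul_left (k2.trans (by linarith)) hP
    obtain ⟨gp, p1, p2, p3, p4⟩ := Lp.fine
    obtain ⟨gm, m1, m2, m3, m4⟩ := Lm.fine
    have hq : ‖u‖ / c0 ≤ q0 := by rw [hq0]; gcongr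
    have hτ : θ * r / 8 ≤ ‖u‖ * r / 8 := by gcongr
    refine ⟨fun s => 4 * q0 * (gp s + gm s), (p1.add m1).const_mul _, fun s => mul_nonneg (by positivity) (add_nonneg (p2 s) (m2 s)), ?_, ?_⟩
    · rw [integral_const_mul, integral_add p1 m1]
      have : 4 * q0 * ((∫ s, gp s) + ∫ s, gm s) ≤ 4 * q0 * (C2 * ε + C2 * ε) := by gcongr
      refine this.trans ?_
      have : 0 < C1 * ε := by positivity
      linarith
    · filter_upwards [p4, m4] with s hs1 hs2 hs x
      obtain ⟨xp, hxp⟩ := hs1 (by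
        have := abs_sub s cp
        linarith)
      obtain ⟨xm, hxm⟩ := hs2 (by
        have := abs_sub s cm
        linarith)
      have bnd : ∀ c, |c| ≤ r' / 8 → |c - s| ≤ ‖u‖ * r / 8 ∧ volume.real (symmDiff (slice K (s - c)) (slice K s)) ≤ C3 * |c| := by
        intro c hc
        have i1 := abs_sub c s
        have i2 := abs_sub s c
        refine ⟨by linarith, ?_⟩
        have := slice_sd G P.oK P.cK P.bK (q := s - c) (q' := s) (by linarith) (by linarith) (by
          rw [sub_sub_cancel_left, abs_neg]; linarith)
        rw [sub_sub_cancel_left, abs_neg] at this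
        exact this
      obtain ⟨bp1, bp2⟩ := bnd cp k1'
      obtain ⟨bm1, bm2⟩ := bnd cm k2'
      have hball := G.slice_ball (s := s) (by linarith)
      rw [slice_up, slice_up] at hxp
      rw [slice_lo, slice_lo] at hxm
      have ep : 0 - (s - cp) = cp - s := by ring
      have em : 0 - (s - cm) = cm - s := by ring
      rw [ep] at hxp
      rw [em] at hxm
      have r1 := half_pt hm hr hu (slice_bdd P.bF s) (slice_bdd P.bK s) (slice_bdd P.bK (s - cp)) hball (x := x) (b := γ - s) (a0 := cp - s) (x' := xp)
        bp1 hxp bp2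
      have r2 := half_pt hm hr (neg_ne_zero.2 hu) (slice_bdd P.bF s) (slice_bdd P.bK s) (slice_bdd P.bK (s - cm)) hball (x := x) (b := -(γ - s)) (a0 := -(cm - s)) (x' := xm)
        (by rw [abs_neg, norm_neg]; exact bm1) hxm bm2
      rw [norm_neg] at r2
      rw [show γ - s - L u x - (cp - s) = (γ - L u x) - cp by ring] at r1
      rw [L_neg, show -(γ - s) - -L u x - -(cm - s) = -((γ - L u x) - cm) by ring, abs_neg] at r2
      have := combine hcc (τ := ‖u‖ * r / 8) (by linarith) (by positivity : 0 ≤ ‖u‖ / c0) (B := C3) (by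
        calc ‖u‖ / c0 * C3 ≤ q0 * C3 := by gcongr
          _ ≤ 1 / 2 := by rw [hq0, div_mul_eq_mul_div, div_le_iff₀ hc0p]; linarith) r1 r2
      set D := volume.real (symmDiff (slice F s) (x +ᵥ slice K s))
      have hD : 0 ≤ D := measureReal_nonneg
      calc min |γ - L u x| (θ * r / 8) ≤ min |γ - L u x| (‖u‖ * r / 8) := min_le_min_left _ hτ
        _ ≤ _ := this
        _ ≤ 4 * (q0 * (2 * D + gp s + gm s)) := by
            have : 0 ≤ 2 * D + gp s + gm s := by linarith [p2 s, m2 s]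
            gcongr
        _ = _ := by ring

end QBM

namespace QBM
set_option linter.unusedSectionVars false
set_option linter.style.longLine false
set_option linter.unusedVariables false
set_option linter.unusedSimpArgs false
variable {m : ℕ}

lemma Geo.transl {K : Set (X m)} {r R : ℝ} (hm : 1 ≤ m) (G : Geo K 0 r R) (oK : IsOpen K) (cK : Convex ℝ K) (bK : IsBounded K) {s : ℝ} (hs : |s| < r) (x x' : Y m) :
    volume.real (symmDiff (x +ᵥ slice K s) (x' +ᵥ slice K s)) ≤ 16 * m * (2 * R) ^ m / r * min ‖x - x'‖ (r / 8) := by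
  have hr := G.hr
  have hR := G.hR
  have hmpos : (1:ℝ) ≤ m := by exact_mod_cast hm
  set k := slice K s
  have bk : IsBounded k := slice_bdd bK s
  have ok : IsOpen k := slice_open oK s
  have ck : Convex ℝ k := slice_convex cK s
  have hk : volume.real k ≤ (2 * R) ^ m := sl_le hR G.bd s
  have hball := G.slice_ball hs
  rcases le_total (r / 8) ‖x - x'‖ with h | h
  · rw [min_eq_right h]
    refine (sd_le_add (bdd_vadd bk) (bdd_vadd bk)).trans ?_
    rw [vol_vadd, vol_vadd]
    have e : 16 * m * (2 * R) ^ m / r * (r / 8) = 2 * (m * (2 * R) ^ m) := by field_simp; ring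
    have : (2 * R) ^ m ≤ m * (2 * R) ^ m := le_mul_of_one_le_left (by positivity) hmpos
    linarith
  · rw [min_eq_left h]
    have key : ∀ v : Y m, ‖v‖ ≤ r / 8 → volume.real (k \ (v +ᵥ k)) ≤ 2 * m * (2 * R) ^ m / r * ‖v‖ := by
      intro v hv
      have := vol_shrink (E := Y m) finrankY bk (ok.vadd v).measurableSet (l := 2 * ‖v‖ / r) (y := 0) (by positivity) (by
        rw [div_le_one hr]; linarith) (by
        intro z hz
        have hl0 : 0 ≤ 2 * ‖v‖ / r := by positivity
        have hl1 : 2 * ‖v‖ / r ≤ 1 := by rw [div_le_one hr]; linarith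
        refine ⟨ck hz (hball (mem_ball_self hr)) (by linarith) hl0 (by ring), ?_⟩
        rw [mem_vadd_set_iff_neg_vadd_mem, vadd_eq_add, smul_zero, add_zero]
        rcases eq_or_ne v 0 with rfl | hv0
        · simpa using hz
        · have hn : 0 < ‖v‖ := norm_pos_iff.2 hv0
          have : -v + (1 - 2 * ‖v‖ / r) • z = (1 - 2 * ‖v‖ / r) • z + (2 * ‖v‖ / r) • (-(r / (2 * ‖v‖)) • v) := by
            rw [smul_smul, show 2 * ‖v‖ / r * -(r / (2 * ‖v‖)) = -1 by field_simp, neg_one_smul, add_comm]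
          rw [this]
          refine ck hz (hball ?_) (by linarith) hl0 (by ring)
          rw [mem_ball_zero_iff, norm_smul, norm_neg, Real.norm_of_nonneg (by positivity), div_mul_eq_mul_div, div_lt_iff₀ (by positivity)]
          nlinarith)
      refine this.trans ?_
      calc m * (2 * ‖v‖ / r) * volume.real k ≤ m * (2 * ‖v‖ / r) * (2 * R) ^ m := by gcongr
        _ = _ := by ring
    have e1 : x' +ᵥ k = x +ᵥ ((x' - x) +ᵥ k) := by rw [vadd_vadd]; simp
    rw [e1, sd_vadd]
    have e2 : symmDiff k ((x' - x) +ᵥ k) = (k \ ((x' - x) +ᵥ k)) ∪ (((x' - x) +ᵥ k) \ k) := rfl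
    rw [e2]
    refine (measureReal_union_le _ _).trans ?_
    have e3 : ((x' - x) +ᵥ k) \ k = (x' - x) +ᵥ (k \ ((x - x') +ᵥ k)) := by
      rw [Set.vadd_set_sdiff, vadd_vadd]; simp
    rw [e3, vol_vadd]
    have k1 := key (x' - x) (by rw [norm_sub_rev]; exact h)
    have k2 := key (x - x') h
    rw [norm_sub_rev] at k1
    have : 16 * m * (2 * R) ^ m / r * ‖x - x'‖ = 8 * (2 * m * (2 * R) ^ m / r * ‖x - x'‖) := by ring
    have p : 0 ≤ 2 * m * (2 * R) ^ m / r * ‖x - x'‖ := by positivity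
    linarith

lemma slice_symmDiff (A B : Set (X m)) (s : ℝ) : slice (symmDiff A B) s = symmDiff (slice A s) (slice B s) := rfl

lemma slice_vadd (T : Y m) (c : ℝ) (K : Set (X m)) (s : ℝ) : slice ((c, T) +ᵥ K) s = T +ᵥ slice K (s - c) := by
  ext y
  simp only [mem_slice, mem_vadd_set_iff_neg_vadd_mem]
  rw [show -((c, T) : X m) +ᵥ (s, y) = (s - c, -T +ᵥ y) by ext <;> simp; ring]

lemma min_norm_le {v : Y m} {τ A : ℝ} (hA : 0 ≤ A) (h : ∀ j, min |v j| τ ≤ A) : min ‖v‖ τ ≤ A := by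
  rcases le_or_gt τ A with h1 | h1
  · exact (min_le_right _ _).trans h1
  · refine (min_le_left _ _).trans ((pi_norm_le_iff_of_nonneg hA).2 fun j => ?_)
    rw [Real.norm_eq_abs]
    rcases min_le_iff.1 (h j) with h2 | h2
    · exact h2
    · linarith

lemma good_pt {H : ℝ → ℝ} {p : ℝ → Prop} {ω : ℝ} (hω : 0 < ω) (hH : Integrable H) (h0 : ∀ s, 0 ≤ H s) (hp : ∀ᵐ s, |s| ≤ ω → p s) :
    ∃ s, |s| ≤ ω ∧ p s ∧ H s ≤ (∫ s, H s) / (2 * ω) := by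
  have hv : volume.real (Icc (-ω) ω) = 2 * ω := by rw [Real.volume_real_Icc_of_le (by linarith)]; ring
  have h1 : ∀ᵐ s ∂(volume.restrict (Icc (-ω) ω)), |s| ≤ ω ∧ p s := by
    filter_upwards [ae_restrict_of_ae hp, ae_restrict_mem measurableSet_Icc] with s hs hm
    have : |s| ≤ ω := abs_le.2 hm
    exact ⟨this, hs this⟩
  have hne : volume.restrict (Icc (-ω) ω) ≠ 0 := by
    intro h
    have : (volume.restrict (Icc (-ω) ω)) univ = 0 := by rw [h]; simp
    rw [Measure.restrict_apply_univ, Real.volume_Icc, ENNReal.ofReal_eq_zero] at this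
    linarith
  obtain ⟨s, hs1, hs2⟩ := exists_notMem_null_le_average hne hH.integrableOn h1
  simp only [mem_compl_iff, not_not] at hs1
  have hs1' : |s| ≤ ω ∧ p s := hs1
  refine ⟨s, hs1'.1, hs1'.2, hs2.trans ?_⟩
  rw [setAverage_eq, hv, smul_eq_mul, inv_mul_eq_div]
  exact div_le_div_of_nonneg_right (setIntegral_le_integral hH (Eventually.of_forall h0)) (by linarith)

lemma min_add_le {a b τ : ℝ} (hτ : 0 ≤ τ) (ha : 0 ≤ a) (hb : 0 ≤ b) : min (a + b) τ ≤ min a τ + min b τ := by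
  rcases le_total a τ with h1 | h1 <;> rcases le_total b τ with h2 | h2 <;>
    simp only [min_eq_left h1, min_eq_right h1, min_eq_left h2, min_eq_right h2]
  · exact min_le_left _ _
  · exact (min_le_right _ _).trans (by linarith)
  · exact (min_le_right _ _).trans (by linarith)
  · exact (min_le_right _ _).trans (by linarith)

set_option maxHeartbeats 1000000 in
lemma slab0 {F K : Set (X m)} {r R θ ω B D : ℝ} (hm : 1 ≤ m) (P : Pair F K) (G : Geo K 0 r R) (hω : 0 < ω) (hωr : ω < r) (hθ : 0 < θ) (hB : 0 < B)
    (T : TiltC F K θ ω r B D) :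
    ∃ t : Y m, volume.real (symmDiff F (((0:ℝ), t) +ᵥ K) ∩ {p | |p.1| ≤ ω}) ≤ (1 + 16 * m * (2 * R) ^ m / r * ((1 + B) / θ)) * ((m + 1) * D) ∧
      ∀ u : Y m, θ ≤ ‖u‖ → ‖u‖ ≤ 2 * θ → ∀ γ, Adm F K u γ →
        min |γ - L u t| (θ * r / 8) ≤ (1 + B) * (1 + 2 * m) * ((m + 2) * D / (2 * ω)) := by
  have hr := G.hr
  have hR := G.hR
  have hmpos : (1:ℝ) ≤ m := by exact_mod_cast hm
  obtain ⟨g, g1, g2, g3, g4⟩ := T.base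
  have hex : ∀ j : Fin m, ∃ γ, Adm F K (Pi.single j θ) γ := fun j => P.exists_adm _
  choose γ hγ using hex
  have hn : ∀ j : Fin m, ‖(Pi.single j θ : Y m)‖ = θ := fun j => by
    rw [Pi.norm_single, Real.norm_of_nonneg hθ.le]
  have hj := fun j => T.tilt (Pi.single j θ) (hn j).ge (by rw [hn j]; linarith) (γ j) (hγ j)
  choose f f1 f2 f3 f4 using hj
  set t : Y m := fun j => γ j / θ with ht
  set H : ℝ → ℝ := fun s => g s + ∑ j, f j s with hH
  have H1 : Integrable H := g1.add (integrable_finsetSum _ fun j _ => f1 j)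
  have H2 : ∀ s, 0 ≤ H s := fun s => add_nonneg (g2 s) (Finset.sum_nonneg fun j _ => f2 j s)
  have H3 : ∫ s, H s ≤ (m + 1) * D := by
    rw [hH, integral_add g1 (integrable_finsetSum _ fun j _ => f1 j), integral_finsetSum _ fun j _ => f1 j]
    have : ∑ j, ∫ s, f j s ≤ ∑ j : Fin m, D := Finset.sum_le_sum fun j _ => f3 j
    simp at this
    linarith
  have hgH : ∀ s, g s ≤ H s := fun s => le_add_of_nonneg_right (Finset.sum_nonneg fun j _ => f2 j s)
  have hfH : ∀ j s, f j s + g s ≤ H s := fun j s => by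
    have := Finset.single_le_sum (f := fun j => f j s) (fun j _ => f2 j s) (Finset.mem_univ j)
    simp only [hH]; linarith
  have base : ∀ᵐ s, |s| ≤ ω → ∃ x : Y m, volume.real (symmDiff (slice F s) (x +ᵥ slice K s)) ≤ g s ∧ min ‖t - x‖ (r / 8) ≤ (1 + B) / θ * H s := by
    have f4' : ∀ᵐ s, ∀ j, |s| ≤ ω → ∀ x : Y m, min |γ j - L (Pi.single j θ) x| (θ * r / 8) ≤ f j s + B * volume.real (symmDiff (slice F s) (x +ᵥ slice K s)) :=
      ae_all_iff.2 f4
    filter_upwards [g4, f4'] with s h1 h2 hs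
    obtain ⟨x, hx⟩ := h1 hs
    refine ⟨x, hx, min_norm_le (mul_nonneg (by positivity) (H2 s)) fun j => ?_⟩
    have h3 := h2 j hs x
    rw [L_single'] at h3
    have e : γ j - θ * x j = θ * (t - x) j := by simp only [ht, Pi.sub_apply]; field_simp
    rw [e, abs_mul, abs_of_pos hθ, mul_div_assoc, ← mul_min_of_nonneg _ _ hθ.le] at h3
    rw [div_mul_eq_mul_div, le_div_iff₀ hθ]
    have h5 := hfH j s
    have h6 := g2 s
    have h7 := f2 j s
    nlinarith [mul_le_mul_of_nonneg_left hx hB.le, mul_le_mul_of_nonneg_left h5 hB.le, mul_nonneg hB.le h7]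
  refine ⟨t, ?_, ?_⟩
  · have mT : MeasurableSet (symmDiff F (((0:ℝ), t) +ᵥ K)) := P.mF.symmDiff (P.oK.vadd _).measurableSet
    have bT : IsBounded (symmDiff F (((0:ℝ), t) +ᵥ K)) := bdd_sd P.bF (bdd_vadd P.bK)
    have mI : MeasurableSet {s : ℝ | |s| ≤ ω} := (isClosed_le continuous_abs continuous_const).measurableSet
    have e := setIntegral_sl mT bT mI
    have e2 : volume.real (symmDiff F (((0:ℝ), t) +ᵥ K) ∩ {p | |p.1| ≤ ω}) = ∫ s in {s : ℝ | |s| ≤ ω}, sl (symmDiff F (((0:ℝ), t) +ᵥ K)) s := e.symm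
    rw [e2]
    set A := 16 * m * (2 * R) ^ m / r with hA
    have hA0 : 0 ≤ A := by positivity
    have c1 : ∫ s in {s : ℝ | |s| ≤ ω}, sl (symmDiff F (((0:ℝ), t) +ᵥ K)) s ≤ ∫ s in {s : ℝ | |s| ≤ ω}, (1 + A * ((1 + B) / θ)) * H s := by
      refine setIntegral_mono_on_ae (sl_integrable mT bT).integrableOn (H1.const_mul _).integrableOn mI ?_
      filter_upwards [base] with s h1 hs
      obtain ⟨x, hx1, hx2⟩ := h1 hs
      have hs' : |s| ≤ ω := hs
      have e3 : sl (symmDiff F (((0:ℝ), t) +ᵥ K)) s = volume.real (symmDiff (slice F s) (t +ᵥ slice K s)) := by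
        rw [sl, slice_symmDiff, slice_vadd, sub_zero]
      rw [e3]
      have bk : IsBounded (slice K s) := slice_bdd P.bK s
      have h4 := sd_tri (slice_bdd P.bF s) (bdd_vadd (x := x) bk) (bdd_vadd (x := t) bk)
      have h5 := G.transl hm P.oK P.cK P.bK (hs'.trans_lt hωr) x t
      rw [norm_sub_rev] at h5
      have h6 := mul_le_mul_of_nonneg_left hx2 hA0
      have := hgH s
      have e7 : (1 + A * ((1 + B) / θ)) * H s = H s + A * ((1 + B) / θ * H s) := by ring
      rw [e7]
      linarith
    refine c1.trans ((setIntegral_le_integral (H1.const_mul _) (Eventually.of_forall fun s => mul_nonneg (by positivity) (H2 s))).trans ?_)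
    rw [integral_const_mul]
    gcongr
  · intro u hu1 hu2 γ' hγ'
    obtain ⟨g', g1', g2', g3', g4'⟩ := T.tilt u hu1 hu2 γ' hγ'
    obtain ⟨s, hs1, hs2, hs3⟩ := good_pt (H := fun s => H s + g' s) hω (H1.add g1') (fun s => add_nonneg (H2 s) (g2' s)) (base.and g4' |>.mono fun s h hs => (⟨h.1 hs, h.2 hs⟩ : _ ∧ _))
    obtain ⟨⟨x, hx1, hx2⟩, h3⟩ := hs2
    have h4 := h3 x
    rw [integral_add H1 g1'] at hs3
    have hs4 : H s + g' s ≤ (m + 2) * D / (2 * ω) := hs3.trans (by gcongr; linarith)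
    have h5 : |γ' - L u t| ≤ |γ' - L u x| + 2 * m * θ * ‖t - x‖ := by
      have e : γ' - L u t = (γ' - L u x) - L u (t - x) := by rw [map_sub]; ring
      rw [e]
      refine (abs_sub _ _).trans (add_le_add_right ((L_abs u (t - x)).trans ?_) _)
      refine mul_le_mul_of_nonneg_right ?_ (norm_nonneg _)
      nlinarith
    have h6 : min (2 * m * θ * ‖t - x‖) (θ * r / 8) ≤ 2 * m * θ * min ‖t - x‖ (r / 8) := by
      rw [mul_min_of_nonneg _ _ (by positivity : 0 ≤ 2 * m * θ)]
      refine min_le_min_left _ ?_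
      have : θ * r ≤ m * (θ * r) := le_mul_of_one_le_left (by positivity) hmpos
      nlinarith
    have h7 : 2 * m * θ * min ‖t - x‖ (r / 8) ≤ 2 * m * ((1 + B) * H s) := by
      calc _ ≤ 2 * m * θ * ((1 + B) / θ * H s) := by gcongr
        _ = _ := by field_simp
    calc min |γ' - L u t| (θ * r / 8) ≤ min (|γ' - L u x| + 2 * m * θ * ‖t - x‖) (θ * r / 8) := min_le_min_right _ h5
      _ ≤ _ := min_add_le (by positivity) (abs_nonneg _) (by positivity)
      _ ≤ (g' s + B * g s) + 2 * m * ((1 + B) * H s) := add_le_add (h4.trans (by gcongr)) (h6.trans h7)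
      _ ≤ (1 + B) * (1 + 2 * m) * (H s + g' s) := by
        have := hgH s
        have := g2' s
        have := H2 s
        have k : (1 + B) * (1 + 2 * m) * (H s + g' s) = (H s + B * H s) + 2 * m * ((1 + B) * H s) + (1 + B) * (1 + 2 * m) * g' s := by ring
        have k2 : g' s ≤ (1 + B) * (1 + 2 * m) * g' s := le_mul_of_one_le_left (g2' s) (by nlinarith)
        have k3 : B * g s ≤ B * H s := by gcongr
        linarith [H2 s]
      _ ≤ _ := by gcongr

end QBM

namespace QBM
set_option linter.unusedSectionVars false
set_option linter.style.longLine false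
set_option linter.unusedVariables false
set_option linter.unusedSimpArgs false
variable {m : ℕ}

lemma vadd_inter_lt (f : X m →ₗ[ℝ] ℝ) (x : X m) (F : Set (X m)) (z : ℝ) : volume.real ((x +ᵥ F) ∩ {p | f p < z}) = volume.real (F ∩ {p | f p < z - f x}) := by
  rw [← vol_vadd x (F ∩ _)]
  congr 1
  ext p
  simp only [mem_inter_iff, mem_vadd_set_iff_neg_vadd_mem, mem_ofPred_eq, vadd_eq_add, map_add, map_neg]
  constructor
  · rintro ⟨h1, h2⟩; exact ⟨h1, by linarith⟩
  · rintro ⟨h1, h2⟩; exact ⟨h1, by linarith⟩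

lemma Adm_vadd (F K : Set (X m)) (x : X m) (u : Y m) (γ : ℝ) : Adm (x +ᵥ F) K u γ ↔ Adm F K u (γ - hf u x) := by
  unfold Adm; rw [vadd_inter_lt]

lemma cum_vadd (F : Set (X m)) (x : X m) (z : ℝ) : cum (x +ᵥ F) z = cum F (z - x.1) :=
  vadd_inter_lt (LinearMap.fst ℝ ℝ (Y m)) x F z

lemma Pair.vadd {F K : Set (X m)} (P : Pair F K) (x : X m) : Pair (x +ᵥ F) K :=
  ⟨bdd_vadd P.bF, P.mF.const_vadd x, P.oK, P.cK, P.bK, P.ne, by rw [vol_vadd, P.vol]⟩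

lemma vol_vadd_add (x : X m) (F S : Set (X m)) : volume.real ((x +ᵥ F) + S) = volume.real (F + S) := by
  rw [vadd_add_assoc, vol_vadd]

structure SlabC (F K : Set (X m)) (θ ω D : ℝ) (T : X m) : Prop where
  near : volume.real (symmDiff F (T +ᵥ K) ∩ {p | |p.1 - T.1| ≤ ω}) ≤ D
  dir : ∀ u : Y m, θ ≤ ‖u‖ → ‖u‖ ≤ 2 * θ → ∀ γ, Adm F K u γ → |γ - hf u T| ≤ D

lemma Geo.c_bound {F K : Set (X m)} (P : Pair F K) {r R R1 v1 c : ℝ} (G : Geo K 0 r R) (hv : v1 < (2 * r) ^ m * r)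
    (hloc : volume.real (F \ closedBall 0 R1) ≤ v1) (hc : cum F c = cum K 0) : |c| ≤ R1 := by
  have hr := G.hr
  obtain ⟨a1, a2⟩ := G.cum_ge P.oK P.bK (q := 0) (by simpa using hr.le)
  simp only [add_zero, sub_zero] at a1 a2
  rw [abs_le]
  constructor
  · by_contra! h
    have : cum F c ≤ volume.real (F \ closedBall 0 R1) := by
      refine mono (fun p hp => ⟨hp.1, fun hb => ?_⟩) (P.bF.subset sdiff_subset)
      have h1 : p.1 < c := hp.2
      have h2 := (norm_fst_le p).trans (mem_closedBall_zero_iff.1 hb)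
      rw [Real.norm_eq_abs] at h2
      have := neg_le_of_abs_le h2
      linarith
    linarith
  · by_contra! h
    have : volume.real (F ∩ {p | c < p.1}) ≤ volume.real (F \ closedBall 0 R1) := by
      refine mono (fun p hp => ⟨hp.1, fun hb => ?_⟩) (P.bF.subset sdiff_subset)
      have h1 : c < p.1 := hp.2
      have h2 := (norm_fst_le p).trans (mem_closedBall_zero_iff.1 hb)
      rw [Real.norm_eq_abs] at h2
      have := le_of_abs_le h2
      linarith
    rw [tail_eq P.mF P.bF, P.vol] at this
    linarith

lemma loc_vadd {F : Set (X m)} (bF : IsBounded F) {x : X m} {R1 R2 : ℝ} (hx : ‖x‖ ≤ R2) :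
    volume.real ((x +ᵥ F) \ closedBall 0 (R1 + R2)) ≤ volume.real (F \ closedBall 0 R1) := by
  rw [← vol_vadd x (F \ _)]
  refine mono ?_ (bdd_vadd (bF.subset sdiff_subset))
  rintro p ⟨hp, hb⟩
  rw [mem_vadd_set_iff_neg_vadd_mem] at hp ⊢
  refine ⟨hp, fun h => hb ?_⟩
  rw [mem_closedBall_zero_iff] at h ⊢
  rw [vadd_eq_add] at h
  calc ‖p‖ = ‖(-x + p) + x‖ := by congr 1; abel
    _ ≤ _ := norm_add_le _ _
    _ ≤ _ := by linarith

set_option maxHeartbeats 1000000 in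
theorem slab (hm : 1 ≤ m) (hB : BMp (Y m) m) (hS : Stp (Y m) m) {r R R1 : ℝ} (hr : 0 < r) (hR : 0 < R) (hR1 : 0 < R1) :
    ∃ θ0 : ℝ, 0 < θ0 ∧ ∀ θ, 0 < θ → θ ≤ θ0 → ∃ ω v1 C ε0 : ℝ, 0 < ω ∧ 0 < v1 ∧ 0 < C ∧ 0 < ε0 ∧
      ∀ (F K : Set (X m)), Pair F K → Geo K 0 r R → volume.real (F \ closedBall 0 R1) ≤ v1 → ∀ t ε, 0 < t → t ≤ 1 → 0 < ε → ε ≤ ε0 →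
        volume.real (F + t • K) ≤ (1 + t) ^ (m + 1) * volume.real K + t * ε ^ 2 → ∃ T, SlabC F K θ ω (C * ε) T := by
  obtain ⟨θ0, hθ0, H⟩ := tilt hm hB hS hr hR (show 0 < R1 + R1 by linarith)
  refine ⟨θ0, hθ0, fun θ hθ hθ' => ?_⟩
  obtain ⟨ω, v1, C, B, ε0, hω, hωr, hv1, hC, hBp, hε0, H⟩ := H θ hθ hθ'
  have hP : 0 < (2 * r) ^ m * r := by positivity
  set Ca := (1 + 16 * m * (2 * R) ^ m / r * ((1 + B) / θ)) * ((m + 1) * C) with hCa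
  set Cb := (1 + B) * (1 + 2 * m) * ((m + 2) * C / (2 * ω)) with hCb
  have hCa0 : 0 < Ca := by positivity
  have hCb0 : 0 < Cb := by positivity
  refine ⟨ω, min v1 ((2 * r) ^ m * r / 2), Ca + Cb, min ε0 (θ * r / 16 / Cb), hω, by positivity, by positivity, by positivity, ?_⟩
  intro F K P G hloc t ε ht ht1 hε hεε hdef
  rw [le_min_iff] at hloc hεε
  obtain ⟨c, hc⟩ := cum_ivt P.mF P.bF (v := cum K 0) (cum_nonneg _ _) (by rw [P.vol]; exact cum_le P.bK _)
  have hcR := G.c_bound P (show (2 * r) ^ m * r / 2 < _ by linarith) hloc.2 hc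
  set x : X m := (-c, 0) with hx
  have hxn : ‖x‖ ≤ R1 := by
    rw [Prod.norm_def]; simp [hx, hcR, hR1.le]
  have T := H (x +ᵥ F) K (P.vadd x) G ((loc_vadd P.bF hxn).trans hloc.1) t ε ht ht1 hε hεε.1 (by rw [vol_vadd_add]; exact hdef)
    (by rw [cum_vadd]; simp [hx, hc])
  obtain ⟨y, h1, h2⟩ := slab0 hm (P.vadd x) G hω hωr hθ hBp T
  have hb : 0 < Cb * ε := by positivity
  have ha : 0 < Ca * ε := by positivity
  refine ⟨(c, y), ?_, ?_⟩
  · have e : symmDiff F ((c, y) +ᵥ K) ∩ {p | |p.1 - c| ≤ ω} = (-x) +ᵥ (symmDiff (x +ᵥ F) (((0:ℝ), y) +ᵥ K) ∩ {p | |p.1| ≤ ω}) := by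
      rw [Set.vadd_set_inter, Set.vadd_set_symmDiff, neg_vadd_vadd, vadd_vadd]
      congr 1
      · congr 2; simp [hx]
      · ext p
        rw [mem_vadd_set_iff_neg_vadd_mem]
        simp [hx, sub_eq_neg_add]
    rw [e, vol_vadd]
    refine h1.trans ?_
    have : (1 + 16 * m * (2 * R) ^ m / r * ((1 + B) / θ)) * ((m + 1) * (C * ε)) = Ca * ε := by rw [hCa]; ring
    rw [this]; nlinarith
  · intro u hu1 hu2 γ hγ
    have h3 := h2 u hu1 hu2 (γ - c) ((Adm_vadd _ _ _ _ _).2 (by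
      rw [hf_apply]; simpa [hx] using hγ))
    have e2 : (1 + B) * (1 + 2 * m) * ((m + 2) * (C * ε) / (2 * ω)) = Cb * ε := by rw [hCb]; ring
    rw [e2] at h3
    have h4 : Cb * ε ≤ θ * r / 16 := by
      have := (le_div_iff₀ hCb0).1 hεε.2
      linarith
    have hτ : 0 < θ * r := by positivity
    have e3 : γ - hf u (c, y) = γ - c - L u y := by rw [hf_apply]; ring
    rw [e3]
    rcases min_le_iff.1 h3 with h5 | h5
    · nlinarith
    · linarith

end QBM

namespace QBM
set_option linter.unusedSectionVars false
set_option linter.style.longLine false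
set_option linter.unusedVariables false
set_option linter.unusedSimpArgs false
variable {m : ℕ}

lemma Geo.image {K : Set (X m)} {r R M : ℝ} (G : Geo K 0 r R) (e : X m ≃L[ℝ] X m) (hM : 0 < M) (h1 : ∀ p, ‖e p‖ ≤ M * ‖p‖) (h2 : ∀ p, ‖e.symm p‖ ≤ M * ‖p‖) :
    Geo (e '' K) 0 (r / M) (M * R) := by
  have hr := G.hr
  have hR := G.hR
  refine ⟨by positivity, by positivity, ?_, ?_⟩
  · intro p hp
    refine ⟨e.symm p, G.ball ?_, by simp⟩
    have hp' : ‖p‖ < r / M := mem_ball_zero_iff.1 hp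
    change e.symm p ∈ Metric.ball (0 : X m) r
    rw [mem_ball_zero_iff]
    calc _ ≤ M * ‖p‖ := h2 p
      _ < M * (r / M) := by gcongr
      _ = r := by field_simp
  · rintro _ ⟨p, hp, rfl⟩
    exact (h1 p).trans_lt (mul_lt_mul_of_pos_left (G.bd p hp) hM)

lemma Pair.img {F K : Set (X m)} (P : Pair F K) {e : X m ≃L[ℝ] X m} (he : MeasurePreserving e) : Pair (e '' F) (e '' K) :=
  P.image e (d := 1) (fun S => by rw [mp_image e he, one_mul])

lemma def_img {F K : Set (X m)} {e : X m ≃L[ℝ] X m} (he : MeasurePreserving e) {t A a : ℝ} (h : volume.real (F + t • K) ≤ a * volume.real K + A) :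
    volume.real (e '' F + t • (e '' K)) ≤ a * volume.real (e '' K) + A := by
  rw [← image_sum, mp_image e he, mp_image e he]; exact h

lemma shear_symm (u : Y m) (p : X m) : (shear u).symm p = shear (-u) p := by
  rw [ContinuousLinearEquiv.symm_apply_eq]
  have := shear_neg (-u) p
  rw [neg_neg] at this
  exact this.symm

lemma shear_norm {u : Y m} (hu : ‖u‖ ≤ 1) (p : X m) : ‖shear u p‖ ≤ (m + 1) * ‖p‖ := by
  rw [shear_apply, Prod.norm_def, max_le_iff]
  constructor
  · rw [hf_apply]
    refine (norm_add_le _ _).trans ?_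
    have h1 := norm_fst_le p
    have h2 := norm_snd_le p
    have h3 := L_abs u p.2
    rw [Real.norm_eq_abs (L u p.2)]
    have : m * ‖u‖ * ‖p.2‖ ≤ m * 1 * ‖p‖ := by gcongr
    linarith
  · have h2 := norm_snd_le p
    have : 0 ≤ m * ‖p‖ := by positivity
    simp only
    linarith

lemma local1 (hm : 1 ≤ m) (hB : BMp (Y m) m) (hS : Stp (Y m) m) {r R v : ℝ} (hr : 0 < r) (hR : 0 < R) (hv : 0 < v) :
    ∃ ε0 : ℝ, 0 < ε0 ∧ ∀ (F K : Set (X m)), Pair F K → Geo K 0 r R → ∀ t ε, 0 < t → t ≤ 1 → 0 < ε → ε ≤ ε0 →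
      volume.real (F + t • K) ≤ (1 + t) ^ (m + 1) * volume.real K + t * ε ^ 2 → 
      ∀ u : Y m, ‖u‖ ≤ 1 → ∃ c, volume.real (F ∩ {p | (m + 1) * R < |hf u p - c|}) ≤ v := by
  set r' := r / (m + 1) with hr'
  set R' := (m + 1) * R with hR'
  have hr'0 : 0 < r' := by positivity
  have hR'0 : 0 < R' := by positivity
  set v1 := min (v / 4) ((2 * r') ^ m * (r' / 4)) with hv1
  obtain ⟨C, ε0, hC, hε0, H⟩ := LDU hm hB hS hr'0 hR'0 (show 0 < v1 by positivity) (min_le_right _ _)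
  refine ⟨ε0, hε0, fun F K P G t ε ht ht1 hε hεε hdef u hu => ?_⟩
  have hmp := shear_mp u
  have P' := P.img hmp
  have G' : Geo (shear u '' K) 0 r' R' := G.image _ (by positivity) (shear_norm hu) (fun p => by
    rw [shear_symm]; exact shear_norm (by rwa [norm_neg]) p)
  obtain ⟨c, hc⟩ := cum_ivt P'.mF P'.bF (v := cum (shear u '' K) 0) (cum_nonneg _ _) (by rw [P'.vol]; exact cum_le P'.bK _)
  have hL := H _ _ _ P' G' t ε ht ht1 hε hεε (def_img hmp hdef) c hc
  have h1 := hL.coarse (c + R')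
  have h2 := hL.coarse (c - R')
  rw [add_sub_cancel_left, cum_top (R := R') (G'.bd) le_rfl] at h1
  rw [show c - R' - c = -R' by ring, cum_zero (R := R') (G'.bd) le_rfl] at h2
  have h1' := abs_le.1 h1
  have h2' := abs_le.1 h2
  have h3 := tail_eq P'.mF P'.bF (c + R')
  rw [P'.vol] at h3
  refine ⟨c, ?_⟩
  have e : volume.real (F ∩ {p | R' < |hf u p - c|}) = volume.real ((shear u '' F) ∩ {p | R' < |p.1 - c|}) :=
    vol_inter_shear F u {z | R' < |z - c|}
  rw [e]
  have hsub : (shear u '' F) ∩ {p | R' < |p.1 - c|} ⊆ ((shear u '' F) ∩ {p | p.1 < c - R'}) ∪ ((shear u '' F) ∩ {p | c + R' < p.1}) := by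
    rintro p ⟨hp, h⟩
    have h' : R' < |p.1 - c| := h
    rcases lt_abs.1 h' with h | h
    · exact Or.inr ⟨hp, by simp only [mem_ofPred_eq]; linarith⟩
    · exact Or.inl ⟨hp, by simp only [mem_ofPred_eq]; linarith⟩
  refine (mono hsub ((P'.bF.subset inter_subset_left).union (P'.bF.subset inter_subset_left))).trans ((measureReal_union_le _ _).trans ?_)
  have h4 : volume.real ((shear u '' F) ∩ {p | p.1 < c - R'}) = cum (shear u '' F) (c - R') := rfl
  have : v1 ≤ v / 4 := min_le_left _ _
  rw [h4, h3]
  linarith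

lemma localize (hm : 1 ≤ m) (hB : BMp (Y m) m) (hS : Stp (Y m) m) {r R v : ℝ} (hr : 0 < r) (hR : 0 < R) (hv : 0 < v) :
    ∃ ε0 : ℝ, 0 < ε0 ∧ ∀ (F K : Set (X m)), Pair F K → Geo K 0 r R → ∀ t ε, 0 < t → t ≤ 1 → 0 < ε → ε ≤ ε0 →
      volume.real (F + t • K) ≤ (1 + t) ^ (m + 1) * volume.real K + t * ε ^ 2 → 
      ∃ x : X m, volume.real ((x +ᵥ F) \ closedBall 0 (2 * ((m + 1) * R))) ≤ v := by
  obtain ⟨ε0, hε0, H⟩ := local1 hm hB hS hr hR (show 0 < v / (m + 1) by positivity)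
  refine ⟨ε0, hε0, fun F K P G t ε ht ht1 hε hεε hdef => ?_⟩
  have H := H F K P G t ε ht ht1 hε hεε hdef
  obtain ⟨c0, hc0⟩ := H 0 (by simp)
  choose c hc using fun j : Fin m => H (Pi.single j 1) (by rw [Pi.norm_single]; simp)
  set R' := (m + 1) * R with hR'
  have hR'0 : 0 < R' := by positivity
  set x : X m := (-c0, fun j => c0 - c j) with hx
  refine ⟨x, ?_⟩
  set A0 := F ∩ {p | R' < |hf 0 p - c0|} with hA0
  set A : Fin m → Set (X m) := fun j => F ∩ {p | R' < |hf (Pi.single j 1) p - c j|} with hA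
  have hsub : (x +ᵥ F) \ closedBall 0 (2 * R') ⊆ x +ᵥ (A0 ∪ ⋃ j, A j) := by
    rintro p ⟨hp, hb⟩
    rw [mem_vadd_set_iff_neg_vadd_mem] at hp ⊢
    by_contra hn
    apply hb
    set q := -x +ᵥ p with hq
    have hpq : p = x + q := by rw [hq]; simp
    simp only [mem_union, mem_iUnion, not_or, not_exists, hA0, hA, mem_inter_iff, hp, true_and, mem_ofPred_eq, not_lt] at hn
    obtain ⟨n0, nj⟩ := hn
    rw [hf_apply] at n0
    simp only [L_apply, Pi.zero_apply, zero_mul, Finset.sum_const_zero, add_zero] at n0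
    rw [mem_closedBall_zero_iff, Prod.norm_def, max_le_iff]
    constructor
    · rw [hpq, Prod.fst_add, hx, Real.norm_eq_abs, neg_add_eq_sub]
      linarith
    · refine (pi_norm_le_iff_of_nonneg (by positivity)).2 fun j => ?_
      have nj := nj j
      rw [hf_apply, L_single', one_mul] at nj
      rw [hpq, Prod.snd_add, hx, Real.norm_eq_abs, Pi.add_apply]
      simp only
      rw [abs_le] at n0 nj ⊢
      constructor <;> linarith
  have bA : IsBounded (A0 ∪ ⋃ j, A j) := P.bF.subset (union_subset inter_subset_left (iUnion_subset fun j => inter_subset_left))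
  refine (mono hsub (bdd_vadd bA)).trans ?_
  rw [vol_vadd]
  refine (measureReal_union_le _ _).trans ?_
  have h2 : volume.real (⋃ j, A j) ≤ ∑ j, volume.real (A j) := measureReal_iUnion_fintype_le _
  have h3 : ∑ j, volume.real (A j) ≤ ∑ j : Fin m, v / (m + 1) := Finset.sum_le_sum fun j _ => hc j
  simp only [Finset.sum_const, Finset.card_univ, Fintype.card_fin, nsmul_eq_mul] at h3
  have : v / (m + 1) + m * (v / (m + 1)) = v := by field_simp; ring
  linarith

end QBM

namespace QBM
set_option linter.unusedSectionVars false
set_option linter.style.longLine false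
set_option linter.unusedVariables false
set_option linter.unusedSimpArgs false
variable {m : ℕ}

def rotL (j0 : Fin m) (φ : ℝ) : X m →ₗ[ℝ] X m where
  toFun p := (Real.cos φ * p.1 + Real.sin φ * p.2 j0, p.2 + Pi.single j0 ((Real.cos φ - 1) * p.2 j0 - Real.sin φ * p.1))
  map_add' p q := by
    refine Prod.ext ?_ (funext fun j => ?_)
    · simp; ring
    · rcases eq_or_ne j j0 with rfl | h
      · simp; ring
      · simp [h]
  map_smul' c p := by
    refine Prod.ext ?_ (funext fun j => ?_)
    · simp; ring
    · rcases eq_or_ne j j0 with rfl | h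
      · simp; ring
      · simp [h]

lemma rotL_apply (j0 : Fin m) (φ : ℝ) (p : X m) : rotL j0 φ p = (Real.cos φ * p.1 + Real.sin φ * p.2 j0, p.2 + Pi.single j0 ((Real.cos φ - 1) * p.2 j0 - Real.sin φ * p.1)) := rfl

lemma rotL_add (j0 : Fin m) (φ ψ : ℝ) (p : X m) : rotL j0 φ (rotL j0 ψ p) = rotL j0 (φ + ψ) p := by
  simp only [rotL_apply]
  refine Prod.ext ?_ (funext fun j => ?_)
  · simp [Real.cos_add, Real.sin_add]; ring
  · rcases eq_or_ne j j0 with rfl | h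
    · simp [Real.cos_add, Real.sin_add]; ring
    · simp [h]

lemma rotL_zero (j0 : Fin m) (p : X m) : rotL j0 0 p = p := by
  simp [rotL_apply]

def rot (j0 : Fin m) (φ : ℝ) : X m ≃L[ℝ] X m :=
  (LinearEquiv.ofLinearMap (rotL j0 φ) (rotL j0 (-φ)) (LinearMap.ext fun p => by simp [rotL_add, rotL_zero]) (LinearMap.ext fun p => by simp [rotL_add, rotL_zero])).toContinuousLinearEquiv

lemma rot_apply (j0 : Fin m) (φ : ℝ) (p : X m) : rot j0 φ p = (Real.cos φ * p.1 + Real.sin φ * p.2 j0, p.2 + Pi.single j0 ((Real.cos φ - 1) * p.2 j0 - Real.sin φ * p.1)) := rfl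

lemma rot_symm (j0 : Fin m) (φ : ℝ) (p : X m) : (rot j0 φ).symm p = rot j0 (-φ) p := rfl

lemma rot_add (j0 : Fin m) (φ ψ : ℝ) (p : X m) : rot j0 φ (rot j0 ψ p) = rot j0 (φ + ψ) p := rotL_add j0 φ ψ p

lemma rot_norm (j0 : Fin m) (φ : ℝ) (p : X m) : ‖rot j0 φ p‖ ≤ 2 * ‖p‖ := by
  have h1 : |p.1| ≤ ‖p‖ := norm_fst_le p
  have h2 : ∀ j, |p.2 j| ≤ ‖p‖ := fun j => (norm_le_pi_norm p.2 j).trans (norm_snd_le p)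
  have hc := Real.abs_cos_le_one φ
  have hs := Real.abs_sin_le_one φ
  have key : ∀ a b c d : ℝ, |a| ≤ 1 → |b| ≤ 1 → |c| ≤ ‖p‖ → |d| ≤ ‖p‖ → |a * c + b * d| ≤ 2 * ‖p‖ := by
    intro a b c d ha hb hc hd
    refine (abs_add_le _ _).trans ?_
    rw [abs_mul, abs_mul]
    have := mul_le_mul ha hc (abs_nonneg _) zero_le_one
    have := mul_le_mul hb hd (abs_nonneg _) zero_le_one
    linarith
  rw [rot_apply, Prod.norm_def, max_le_iff]
  constructor
  · exact key _ _ _ _ hc hs h1 (h2 j0)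
  · refine (pi_norm_le_iff_of_nonneg (by positivity)).2 fun j => ?_
    rw [Real.norm_eq_abs]
    rcases eq_or_ne j j0 with rfl | h
    · have := key (Real.cos φ) (-Real.sin φ) (p.2 j) p.1 hc (by rwa [abs_neg]) (h2 j) h1
      simp only [Pi.add_apply, Pi.single_eq_same]
      rwa [show p.2 j + ((Real.cos φ - 1) * p.2 j - Real.sin φ * p.1) = Real.cos φ * p.2 j + -Real.sin φ * p.1 by ring]
    · simp only [Pi.add_apply, Pi.single_eq_of_ne h, add_zero]
      have := h2 j
      have := norm_nonneg p
      linarith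

lemma sq_rot (j0 : Fin m) (φ : ℝ) (p : X m) : (rot j0 φ p).1 ^ 2 + ∑ j, (rot j0 φ p).2 j ^ 2 = p.1 ^ 2 + ∑ j, p.2 j ^ 2 := by
  have h : ∀ q : X m, ∑ j, q.2 j ^ 2 = q.2 j0 ^ 2 + ∑ j ∈ Finset.univ.erase j0, q.2 j ^ 2 := fun q =>
    (Finset.add_sum_erase _ _ (Finset.mem_univ j0)).symm
  rw [h, h p]
  have e : ∑ j ∈ Finset.univ.erase j0, (rot j0 φ p).2 j ^ 2 = ∑ j ∈ Finset.univ.erase j0, p.2 j ^ 2 := by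
    refine Finset.sum_congr rfl fun j hj => ?_
    rw [rot_apply]
    simp [Finset.ne_of_mem_erase hj]
  rw [e, rot_apply]
  simp only [Pi.add_apply, Pi.single_eq_same]
  have := Real.sin_sq_add_cos_sq φ
  linear_combination (p.1 ^ 2 + p.2 j0 ^ 2) * this

lemma rot_mp (j0 : Fin m) (φ : ℝ) : MeasurePreserving (rot j0 φ) := by
  apply mp_of_det
  set S : Set (X m) := {p | p.1 ^ 2 + ∑ j, p.2 j ^ 2 < 1} with hS
  have oS : IsOpen S := by
    refine isOpen_lt ?_ continuous_const
    fun_prop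
  have nS : S.Nonempty := ⟨0, by simp [hS]⟩
  have bS : IsBounded S := by
    refine (isBounded_closedBall (x := (0 : X m)) (r := 1)).subset fun p hp => ?_
    have hp' : p.1 ^ 2 + ∑ j, p.2 j ^ 2 < 1 := hp
    have h0 : 0 ≤ ∑ j, p.2 j ^ 2 := Finset.sum_nonneg fun j _ => sq_nonneg _
    rw [mem_closedBall_zero_iff, Prod.norm_def, max_le_iff]
    constructor
    · rw [Real.norm_eq_abs, ← sq_le_one_iff_abs_le_one]; linarith
    · refine (pi_norm_le_iff_of_nonneg zero_le_one).2 fun j => ?_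
      have := Finset.single_le_sum (f := fun j => p.2 j ^ 2) (fun j _ => sq_nonneg _) (Finset.mem_univ j)
      rw [Real.norm_eq_abs, ← sq_le_one_iff_abs_le_one]
      have := sq_nonneg p.1
      have h5 : p.2 j ^ 2 ≤ ∑ j, p.2 j ^ 2 := by assumption
      linarith
  have hpos : 0 < volume.real S := vol_pos oS nS bS
  have himg : (rot j0 φ : X m →ₗ[ℝ] X m) '' S = S := by
    ext p
    constructor
    · rintro ⟨q, hq, rfl⟩
      have : q.1 ^ 2 + ∑ j, q.2 j ^ 2 < 1 := hq
      rw [← sq_rot j0 φ] at this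
      exact this
    · intro hp
      refine ⟨(rot j0 φ).symm p, ?_, by simp⟩
      have : p.1 ^ 2 + ∑ j, p.2 j ^ 2 < 1 := hp
      rw [← sq_rot j0 (-φ)] at this
      exact this
  have := Measure.addHaar_image_linearMap (volume : Measure (X m)) (rot j0 φ : X m →ₗ[ℝ] X m) S
  rw [himg] at this
  have h2 := congrArg ENNReal.toReal this
  rw [ENNReal.toReal_mul, ENNReal.toReal_ofReal (abs_nonneg _)] at h2
  change volume.real S = _ * volume.real S at h2
  have h3 : |LinearMap.det (rot j0 φ : X m →ₗ[ℝ] X m)| * volume.real S = 1 * volume.real S := by linarith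
  exact mul_right_cancel₀ hpos.ne' h3

def AdmF (F K : Set (X m)) (f : X m → ℝ) (γ : ℝ) : Prop :=
  volume.real (F ∩ {p | f p < γ}) = volume.real (K ∩ {p | f p < 0})

lemma AdmF_img (F K : Set (X m)) {e : X m ≃L[ℝ] X m} (he : MeasurePreserving e) (u : Y m) (γ : ℝ) :
    Adm (e '' F) (e '' K) u γ ↔ AdmF F K (fun p => hf u (e p)) γ := by
  have h : ∀ (S : Set (X m)) z, (e '' S) ∩ {p | hf u p < z} = e '' (S ∩ {p | hf u (e p) < z}) := by
    intro S z
    ext p; constructor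
    · rintro ⟨⟨q, hq, rfl⟩, h⟩; exact ⟨q, ⟨hq, h⟩, rfl⟩
    · rintro ⟨q, ⟨hq, h⟩, rfl⟩; exact ⟨⟨q, hq, rfl⟩, h⟩
  unfold Adm AdmF
  rw [h, h, mp_image e he, mp_image e he]

lemma AdmF_scale {F K : Set (X m)} {f g : X m → ℝ} {a γ : ℝ} (ha : 0 < a) (h : ∀ p, f p = a * g p) (hA : AdmF F K f γ) : AdmF F K g (γ / a) := by
  have h1 : {p | f p < γ} = {p | g p < γ / a} := by
    ext p; simp only [mem_ofPred_eq]; rw [h, lt_div_iff₀ ha, mul_comm]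
  have h2 : {p | f p < 0} = {p | g p < 0} := by
    ext p; simp only [mem_ofPred_eq]; rw [h]
    constructor
    · intro h; nlinarith
    · intro h; nlinarith
  unfold AdmF at *
  rw [← h1, ← h2]; exact hA

structure RotC (F K : Set (X m)) (j0 : Fin m) (φ θ ω D : ℝ) (T : X m) : Prop where
  near : volume.real (symmDiff F (T +ᵥ K) ∩ {p | |(rot j0 φ (p - T)).1| ≤ ω}) ≤ D
  dir : ∀ u : Y m, θ ≤ ‖u‖ → ‖u‖ ≤ 2 * θ → ∀ γ, AdmF F K (fun p => hf u (rot j0 φ p)) γ → |γ - hf u (rot j0 φ T)| ≤ D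

theorem rotslab (hm : 1 ≤ m) (hB : BMp (Y m) m) (hS : Stp (Y m) m) (j0 : Fin m) {r R R1 : ℝ} (hr : 0 < r) (hR : 0 < R) (hR1 : 0 < R1) :
    ∃ θ0 : ℝ, 0 < θ0 ∧ ∀ θ, 0 < θ → θ ≤ θ0 → ∃ ω v1 C ε0 : ℝ, 0 < ω ∧ 0 < v1 ∧ 0 < C ∧ 0 < ε0 ∧
      ∀ (F K : Set (X m)), Pair F K → Geo K 0 r R → volume.real (F \ closedBall 0 R1) ≤ v1 → ∀ t ε, 0 < t → t ≤ 1 → 0 < ε → ε ≤ ε0 →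
        volume.real (F + t • K) ≤ (1 + t) ^ (m + 1) * volume.real K + t * ε ^ 2 → ∀ φ, ∃ T, RotC F K j0 φ θ ω (C * ε) T := by
  obtain ⟨θ0, hθ0, H⟩ := slab hm hB hS (show 0 < r / 2 by positivity) (show 0 < 2 * R by positivity) (show 0 < 2 * R1 by positivity)
  refine ⟨θ0, hθ0, fun θ hθ hθ' => ?_⟩
  obtain ⟨ω, v1, C, ε0, hω, hv1, hC, hε0, H⟩ := H θ hθ hθ'
  refine ⟨ω, v1, C, ε0, hω, hv1, hC, hε0, ?_⟩
  intro F K P G hloc t ε ht ht1 hε hεε hdef φ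
  set e := rot j0 φ with he
  have hmp : MeasurePreserving e := rot_mp j0 φ
  have G' : Geo (e '' K) 0 (r / 2) (2 * R) := G.image e two_pos (rot_norm j0 φ) (fun p => by rw [he, rot_symm]; exact rot_norm j0 _ p)
  have hl : volume.real ((e '' F) \ closedBall 0 (2 * R1)) ≤ v1 := by
    have : (e '' F) \ closedBall 0 (2 * R1) ⊆ e '' (F \ closedBall 0 R1) := by
      rintro _ ⟨⟨q, hq, rfl⟩, h⟩
      refine ⟨q, ⟨hq, fun h2 => h ?_⟩, rfl⟩
      rw [mem_closedBall_zero_iff] at h2 ⊢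
      exact (rot_norm j0 φ q).trans (by linarith)
    refine (mono this (bdd_img e (P.bF.subset sdiff_subset))).trans ?_
    rwa [mp_image e hmp]
  obtain ⟨T, hT⟩ := H _ _ (P.img hmp) G' hl t ε ht ht1 hε hεε (def_img hmp hdef)
  refine ⟨e.symm T, ?_, ?_⟩
  · refine le_trans (le_of_eq ?_) hT.near
    rw [← mp_image e hmp]
    congr 1
    rw [image_inter e.injective, Set.image_symmDiff e.injective, image_vadd, e.apply_symm_apply]
    congr 1
    ext p
    constructor
    · rintro ⟨q, hq, rfl⟩
      have hq' : |(e (q - e.symm T)).1| ≤ ω := hq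
      rw [map_sub, e.apply_symm_apply] at hq'
      exact hq'
    · intro hp
      refine ⟨e.symm p, ?_, by simp⟩
      change |(e (e.symm p - e.symm T)).1| ≤ ω
      rw [map_sub, e.apply_symm_apply, e.apply_symm_apply]
      exact hp
  · intro u hu1 hu2 γ hγ
    have := hT.dir u hu1 hu2 γ ((AdmF_img F K hmp u γ).2 hγ)
    rwa [← he, e.apply_symm_apply]

end QBM

namespace QBM
set_option linter.unusedSectionVars false
set_option linter.style.longLine false
set_option linter.unusedVariables false
set_option linter.unusedSimpArgs false
variable {m : ℕ}

lemma hf_rot (j0 : Fin m) (δ : ℝ) (u : Y m) (p : X m) :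
    hf u (rot j0 (-δ) p) = (Real.cos δ + u j0 * Real.sin δ) * p.1 + L (u + Pi.single j0 (u j0 * (Real.cos δ - 1) - Real.sin δ)) p.2 := by
  rw [rot_apply, hf_apply, L_add, L_single', map_add, L_single, Real.cos_neg, Real.sin_neg]
  ring

lemma link_test {F K : Set (X m)} (P : Pair F K) {j0 : Fin m} {φ δ θ ω D : ℝ} {T T' : X m} (hθ : 0 < θ) (hθ1 : θ ≤ 1 / 8) (hδ : 0 ≤ δ) (hδθ : δ ≤ θ / 8)
    (h : RotC F K j0 φ θ ω D T) (h' : RotC F K j0 (φ + δ) θ ω D T') {u : Y m} (hu : ‖u‖ = 3 / 2 * θ) : |hf u (rot j0 φ (T - T'))| ≤ 3 * D := by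
  have hs0 : |Real.sin δ| ≤ δ := by
    have := Real.abs_sin_le_abs (x := δ); rwa [abs_of_nonneg hδ] at this
  have hc0 : 1 - δ ^ 2 / 2 ≤ Real.cos δ := Real.one_sub_sq_div_two_le_cos
  have hc1 : Real.cos δ ≤ 1 := Real.cos_le_one δ
  have hu0 : |u j0| ≤ 3 / 2 * θ := by rw [← hu]; exact norm_le_pi_norm u j0
  set a := Real.cos δ + u j0 * Real.sin δ with ha
  set η := u j0 * (Real.cos δ - 1) - Real.sin δ with hη
  have hδ2 : δ ^ 2 / 2 ≤ θ / 64 := by nlinarith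
  have hcc : |Real.cos δ - 1| ≤ θ / 64 := by rw [abs_le]; constructor <;> linarith
  have h1 : |u j0 * Real.sin δ| ≤ 1 / 32 := by
    rw [abs_mul]
    calc _ ≤ 3 / 2 * θ * δ := by gcongr
      _ ≤ 1 / 32 := by nlinarith
  have h2 : |a - 1| ≤ 1 / 16 := by
    rw [show a - 1 = (Real.cos δ - 1) + u j0 * Real.sin δ by rw [ha]; ring]
    refine (abs_add_le _ _).trans ?_
    linarith
  have h3 : |η| ≤ θ / 4 := by
    refine (abs_sub _ _).trans ?_
    rw [abs_mul]
    have : |u j0| * |Real.cos δ - 1| ≤ 3 / 2 * θ * (θ / 64) := by gcongr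
    nlinarith
  rw [abs_le] at h2
  have ha0 : 0 < a := by linarith
  set v : Y m := u + Pi.single j0 η with hv
  have hsn : ‖(Pi.single j0 η : Y m)‖ ≤ θ / 4 := by rw [Pi.norm_single]; exact h3
  have v1 : ‖v‖ ≤ 7 / 4 * θ := (norm_add_le _ _).trans (by linarith)
  have v2 : 5 / 4 * θ ≤ ‖v‖ := by
    have : ‖u‖ ≤ ‖v‖ + ‖(Pi.single j0 η : Y m)‖ := by
      have := norm_sub_le v (Pi.single j0 η : Y m)
      rwa [hv, add_sub_cancel_right] at this
    linarith
  set w : Y m := a⁻¹ • v with hw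
  have hwn : ‖w‖ = ‖v‖ / a := by rw [hw, norm_smul, Real.norm_of_nonneg (by positivity), inv_mul_eq_div]
  have w1 : θ ≤ ‖w‖ := by rw [hwn, le_div_iff₀ ha0]; nlinarith
  have w2 : ‖w‖ ≤ 2 * θ := by rw [hwn, div_le_iff₀ ha0]; nlinarith
  have key : ∀ p, hf u (rot j0 φ p) = a * hf w (rot j0 (φ + δ) p) := by
    intro p
    have e : rot j0 φ p = rot j0 (-δ) (rot j0 (φ + δ) p) := by rw [rot_add]; congr 2; ring
    rw [e, hf_rot, hf_apply, hw, L_smul, mul_add, mul_inv_cancel_left₀ ha0.ne']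
  obtain ⟨γ, hγ⟩ := (P.img (rot_mp j0 φ)).exists_adm u
  rw [AdmF_img F K (rot_mp j0 φ)] at hγ
  have k1 := h.dir u (by linarith) (by linarith) γ hγ
  have k2 := h'.dir w w1 w2 (γ / a) (AdmF_scale ha0 key hγ)
  have k3 : |γ - hf u (rot j0 φ T')| ≤ 2 * D := by
    have : γ - hf u (rot j0 φ T') = a * (γ / a - hf w (rot j0 (φ + δ) T')) := by
      rw [key, mul_sub, mul_div_cancel₀ _ ha0.ne']
    rw [this, abs_mul, abs_of_pos ha0]
    have := (abs_nonneg _).trans k2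
    nlinarith
  rw [map_sub, map_sub, show hf u (rot j0 φ T) - hf u (rot j0 φ T') = (γ - hf u (rot j0 φ T')) - (γ - hf u (rot j0 φ T)) by ring]
  refine (abs_sub _ _).trans ?_
  linarith

lemma link {F K : Set (X m)} (P : Pair F K) {j0 : Fin m} {φ δ θ ω D : ℝ} {T T' : X m} (hθ : 0 < θ) (hθ1 : θ ≤ 1 / 8) (hδ : 0 ≤ δ) (hδθ : δ ≤ θ / 8)
    (h : RotC F K j0 φ θ ω D T) (h' : RotC F K j0 (φ + δ) θ ω D T') : ‖T' - T‖ ≤ 8 * D / θ := by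
  set w := rot j0 φ (T - T') with hw
  have hn : ∀ j : Fin m, ∀ s : ℝ, |s| = 3 / 2 * θ → |w.1 + s * w.2 j| ≤ 3 * D := by
    intro j s hs
    have := link_test P hθ hθ1 hδ hδθ h h' (u := Pi.single j s) (by rw [Pi.norm_single, Real.norm_eq_abs, hs])
    rwa [← hw, hf_apply, L_single'] at this
  have hp : |3 / 2 * θ| = 3 / 2 * θ := abs_of_pos (by positivity)
  have hp' : |-(3 / 2 * θ)| = 3 / 2 * θ := by rw [abs_neg, hp]
  have hj : ∀ j, |w.1| ≤ 3 * D ∧ |w.2 j| ≤ 2 * D / θ := by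
    intro j
    have a1 := abs_le.1 (hn j _ hp)
    have a2 := abs_le.1 (hn j _ hp')
    constructor
    · rw [abs_le]; constructor <;> linarith
    · rw [le_div_iff₀ hθ, ← abs_of_pos hθ, ← abs_mul, abs_le]; constructor <;> linarith
  have hD : 0 ≤ D := by
    have := (hj j0).1; have := abs_nonneg w.1; linarith
  have hb : 3 * D ≤ 4 * D / θ := by rw [le_div_iff₀ hθ]; nlinarith
  have hwn : ‖w‖ ≤ 4 * D / θ := by
    rw [Prod.norm_def, max_le_iff]
    refine ⟨(hj j0).1.trans hb, (pi_norm_le_iff_of_nonneg (by positivity)).2 fun j => (hj j).2.trans ?_⟩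
    gcongr; norm_num
  have : T - T' = (rot j0 φ).symm w := by simp [hw]
  rw [norm_sub_rev, this, rot_symm]
  refine (rot_norm _ _ _).trans ?_
  calc 2 * ‖w‖ ≤ 2 * (4 * D / θ) := by gcongr
    _ = _ := by ring

lemma translX {K : Set (X m)} {r R : ℝ} (G : Geo K 0 r R) (oK : IsOpen K) (cK : Convex ℝ K) (bK : IsBounded K) (T T' : X m) (hT : ‖T' - T‖ ≤ r / 2) :
    volume.real ((T +ᵥ K) \ (T' +ᵥ K)) ≤ (m + 1) * (2 * ‖T' - T‖ / r) * volume.real K := by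
  have hr := G.hr
  set v := T' - T with hv
  have e : (T +ᵥ K) \ (T' +ᵥ K) = T +ᵥ (K \ (v +ᵥ K)) := by
    rw [Set.vadd_set_sdiff, vadd_vadd, hv]; simp
  rw [e, vol_vadd]
  have hball : ∀ p : X m, ‖p‖ < r → p ∈ K := fun p hp => G.ball (mem_ball_zero_iff.2 hp)
  have hl0 : 0 ≤ 2 * ‖v‖ / r := by positivity
  have hl1 : 2 * ‖v‖ / r ≤ 1 := by rw [div_le_one hr]; linarith
  have := vol_shrink (E := X m) finrankX bK (oK.vadd v).measurableSet (l := 2 * ‖v‖ / r) (y := 0) hl0 hl1 (by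
    intro z hz
    refine ⟨cK hz (hball 0 (by simpa using hr)) (by linarith) hl0 (by ring), ?_⟩
    rw [mem_vadd_set_iff_neg_vadd_mem, vadd_eq_add, smul_zero, add_zero]
    rcases eq_or_ne v 0 with h0 | hv0
    · rw [h0]; simpa using hz
    · have hn : 0 < ‖v‖ := norm_pos_iff.2 hv0
      have : -v + (1 - 2 * ‖v‖ / r) • z = (1 - 2 * ‖v‖ / r) • z + (2 * ‖v‖ / r) • (-(r / (2 * ‖v‖)) • v) := by
        rw [smul_smul, show 2 * ‖v‖ / r * -(r / (2 * ‖v‖)) = -1 by field_simp, neg_one_smul, add_comm]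
      rw [this]
      refine cK hz (hball _ ?_) (by linarith) hl0 (by ring)
      rw [norm_smul, norm_neg, Real.norm_of_nonneg (by positivity), div_mul_eq_mul_div, div_lt_iff₀ (by positivity)]
      nlinarith)
  simpa using this

lemma exists_angle (a b : ℝ) : ∃ φ, 0 ≤ φ ∧ φ ≤ Real.pi ∧ Real.cos φ * a + Real.sin φ * b = 0 := by
  have hc : Continuous fun φ => Real.cos φ * a + Real.sin φ * b := by fun_prop
  rcases le_total 0 a with h | h
  · have := intermediate_value_Icc' Real.pi_pos.le hc.continuousOn
    obtain ⟨φ, hφ, h0⟩ := this (show (0:ℝ) ∈ _ by simp [h])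
    exact ⟨φ, hφ.1, hφ.2, h0⟩
  · have := intermediate_value_Icc Real.pi_pos.le hc.continuousOn
    obtain ⟨φ, hφ, h0⟩ := this (show (0:ℝ) ∈ _ by simp [h])
    exact ⟨φ, hφ.1, hφ.2, h0⟩

lemma exists_grid {δ : ℝ} (hδ : 0 < δ) {N : ℕ} (hN : Real.pi ≤ N * δ) {a b R : ℝ} (ha : |a| ≤ R) (hb : |b| ≤ R) :
    ∃ i ≤ N, |Real.cos (i * δ) * a + Real.sin (i * δ) * b| ≤ 2 * R * δ := by
  obtain ⟨φ, h0, h1, h2⟩ := exists_angle a b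
  have hq : 0 ≤ φ / δ := by positivity
  have f1 := Nat.floor_le hq
  have f2 := Nat.lt_floor_add_one (φ / δ)
  rw [le_div_iff₀ hδ] at f1
  rw [div_lt_iff₀ hδ] at f2
  set i := ⌊φ / δ⌋₊ with hi
  refine ⟨i, ?_, ?_⟩
  · have : (i:ℝ) * δ ≤ N * δ := by linarith
    exact_mod_cast le_of_mul_le_mul_right this hδ
  · have hd : |(i:ℝ) * δ - φ| ≤ δ := by rw [abs_le]; constructor <;> linarith
    have c1 := (Real.abs_cos_sub_cos_le (i * δ) φ).trans hd
    have c2 := (Real.abs_sin_sub_sin_le (i * δ) φ).trans hd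
    have e : Real.cos (i * δ) * a + Real.sin (i * δ) * b = (Real.cos (i * δ) - Real.cos φ) * a + (Real.sin (i * δ) - Real.sin φ) * b := by
      linear_combination h2
    rw [e]
    refine (abs_add_le _ _).trans ?_
    rw [abs_mul, abs_mul]
    have := mul_le_mul c1 ha (abs_nonneg _) hδ.le
    have := mul_le_mul c2 hb (abs_nonneg _) hδ.le
    linarith

end QBM

namespace QBM
set_option linter.unusedSectionVars false
set_option linter.style.longLine false
set_option linter.unusedVariables false
set_option linter.unusedSimpArgs false
variable {m : ℕ}

lemma sd_eq_vol {A B : Set (X m)} (mA : MeasurableSet A) (mB : MeasurableSet B) (bA : IsBounded A) (bB : IsBounded B) (h : volume.real A = volume.real B) :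
    volume.real (symmDiff A B) ≤ 2 * volume.real (B \ A) := by
  have h1 := measureReal_inter_add_sdiff (μ := volume) mB (fin bA)
  have h2 := measureReal_inter_add_sdiff (μ := volume) mA (fin bB)
  rw [inter_comm] at h2
  have : symmDiff A B = (A \ B) ∪ (B \ A) := rfl
  rw [this]
  refine (measureReal_union_le _ _).trans ?_
  linarith

set_option maxHeartbeats 1000000 in
theorem main_norm (hm : 1 ≤ m) (hB : BMp (Y m) m) (hS : Stp (Y m) m) {r R : ℝ} (hr : 0 < r) (hR : 0 < R) :
    ∃ C ε0 : ℝ, 0 < C ∧ 0 < ε0 ∧ ∀ (F K : Set (X m)), Pair F K → Geo K 0 r R → ∀ t ε, 0 < t → t ≤ 1 → 0 < ε → ε ≤ ε0 →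
        volume.real (F + t • K) ≤ (1 + t) ^ (m + 1) * volume.real K + t * ε ^ 2 → ∃ x : X m, volume.real (symmDiff F (x +ᵥ K)) ≤ C * ε := by
  set j0 : Fin m := ⟨0, hm⟩
  obtain ⟨θ0, hθ0, H⟩ := rotslab hm hB hS j0 hr hR (show 0 < 2 * ((m + 1) * R) by positivity)
  set θ := min θ0 (1 / 8) with hθ
  have hθp : 0 < θ := by positivity
  have hθ1 : θ ≤ 1 / 8 := min_le_right _ _
  obtain ⟨ω, v1, C1, ε1, hω, hv1, hC1, hε1, H⟩ := H θ hθp (min_le_left _ _)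
  obtain ⟨ε2, hε2, HL⟩ := localize hm hB hS hr hR hv1
  set δ := min (θ / 8) (ω / (4 * R)) with hδ
  have hδp : 0 < δ := by positivity
  have hδθ : δ ≤ θ / 8 := min_le_left _ _
  have hδR : 2 * R * δ ≤ ω / 2 := by
    have : δ ≤ ω / (4 * R) := min_le_right _ _
    rw [le_div_iff₀ (by positivity)] at this
    linarith
  obtain ⟨N, hN⟩ := exists_nat_ge (Real.pi / δ)
  rw [div_le_iff₀ hδp] at hN
  set Q := N * (8 * C1 / θ) + 1 with hQ
  have hQp : 0 < Q := by positivity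
  set κ := (2 * R) ^ m * (2 * R) with hκ
  have hκp : 0 < κ := by positivity
  set Cf := (m + 1) * (2 * Q / r) * κ + C1 with hCf
  have hCfp : 0 < Cf := by positivity
  refine ⟨2 * ((N + 1) * Cf), min (min ε1 ε2) (min (ω / 8 / Q) (r / 2 / Q)), by positivity, by positivity, ?_⟩
  intro F K P G t ε ht ht1 hε hεε hdef
  simp only [le_min_iff] at hεε
  obtain ⟨⟨he1, he2⟩, he3, he4⟩ := hεε
  rw [le_div_iff₀ hQp] at he3 he4
  obtain ⟨x, hx⟩ := HL F K P G t ε ht ht1 hε he2 hdef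
  have P' := P.vadd x
  have H := H (x +ᵥ F) K P' G hx t ε ht ht1 hε he1 (by rw [vol_vadd_add]; exact hdef)
  choose T hT using fun i : ℕ => H (i * δ)
  have hD : 0 < C1 * ε := by positivity
  have hTi : ∀ i : ℕ, ‖T i - T 0‖ ≤ i * (8 * (C1 * ε) / θ) := by
    intro i
    induction i with
    | zero => simp
    | succ i ih =>
      have h2 := hT (i + 1)
      rw [show ((i + 1 : ℕ) : ℝ) * δ = i * δ + δ by push_cast; ring] at h2
      have := link P' hθp hθ1 hδp.le hδθ (hT i) h2
      calc ‖T (i + 1) - T 0‖ = ‖(T (i + 1) - T i) + (T i - T 0)‖ := by congr 1; abel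
        _ ≤ _ := norm_add_le _ _
        _ ≤ 8 * (C1 * ε) / θ + i * (8 * (C1 * ε) / θ) := add_le_add this ih
        _ = _ := by push_cast; ring
  have hTN : ∀ i ≤ N, ‖T i - T 0‖ ≤ Q * ε := by
    intro i hi
    refine (hTi i).trans ?_
    have : (i:ℝ) ≤ N := by exact_mod_cast hi
    calc (i:ℝ) * (8 * (C1 * ε) / θ) ≤ N * (8 * (C1 * ε) / θ) := by gcongr
      _ = (N * (8 * C1 / θ)) * ε := by ring
      _ ≤ _ := by rw [hQ]; gcongr; linarith
  set A : ℕ → Set (X m) := fun i => ((T 0 +ᵥ K) \ (T i +ᵥ K)) ∪ (symmDiff (x +ᵥ F) (T i +ᵥ K) ∩ {p | |(rot j0 (i * δ) (p - T i)).1| ≤ ω}) with hA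
  have bA : ∀ i, IsBounded (A i) := fun i => ((bdd_vadd P.bK).subset sdiff_subset).union ((bdd_sd P'.bF (bdd_vadd P.bK)).subset inter_subset_left)
  have hAv : ∀ i ≤ N, volume.real (A i) ≤ Cf * ε := by
    intro i hi
    refine (measureReal_union_le _ _).trans ?_
    have h1 := translX G P.oK P.cK P.bK (T 0) (T i) ((hTN i hi).trans (by linarith))
    have h2 := (hT i).near
    have h3 : (m + 1) * (2 * ‖T i - T 0‖ / r) * volume.real K ≤ (m + 1) * (2 * (Q * ε) / r) * κ := by
      gcongr
      · exact hTN i hi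
      · exact G.vol_le P.oK P.bK
    calc _ ≤ (m + 1) * (2 * (Q * ε) / r) * κ + C1 * ε := add_le_add (h1.trans h3) h2
      _ = _ := by rw [hCf]; ring
  have hsub : (T 0 +ᵥ K) \ (x +ᵥ F) ⊆ ⋃ i ∈ Finset.range (N + 1), A i := by
    rintro p ⟨hp, hpF⟩
    have hpK : p - T 0 ∈ K := by
      rw [mem_vadd_set_iff_neg_vadd_mem, vadd_eq_add, neg_add_eq_sub] at hp; exact hp
    have hn := G.bd _ hpK
    obtain ⟨i, hi, hgi⟩ := exists_grid hδp hN (a := (p - T 0).1) (b := (p - T 0).2 j0) (R := R)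
      ((norm_fst_le _).trans hn.le) ((norm_le_pi_norm _ j0).trans ((norm_snd_le _).trans hn.le))
    rw [mem_iUnion₂]
    refine ⟨i, Finset.mem_range.2 (by omega), ?_⟩
    by_cases hpi : p ∈ T i +ᵥ K
    · refine Or.inr ⟨Or.inr ⟨hpi, hpF⟩, ?_⟩
      change |(rot j0 (i * δ) (p - T i)).1| ≤ ω
      have e : rot j0 (i * δ) (p - T i) = rot j0 (i * δ) (p - T 0) - rot j0 (i * δ) (T i - T 0) := by
        rw [← map_sub]; congr 1; abel
      rw [e, Prod.fst_sub]
      refine (abs_sub _ _).trans ?_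
      have h1 : |(rot j0 (i * δ) (p - T 0)).1| ≤ 2 * R * δ := hgi
      have h2 : |(rot j0 (i * δ) (T i - T 0)).1| ≤ 2 * ‖T i - T 0‖ := (norm_fst_le _).trans (rot_norm _ _ _)
      have h3 := hTN i hi
      linarith
    · exact Or.inl ⟨hp, hpi⟩
  refine ⟨-x + T 0, ?_⟩
  have e : symmDiff F ((-x + T 0) +ᵥ K) = -x +ᵥ symmDiff (x +ᵥ F) (T 0 +ᵥ K) := by
    rw [Set.vadd_set_symmDiff, neg_vadd_vadd, vadd_vadd]
  rw [e, vol_vadd]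
  refine (sd_eq_vol P'.mF (P.oK.vadd _).measurableSet P'.bF (bdd_vadd P.bK) (by rw [P'.vol, vol_vadd])).trans ?_
  rw [mul_assoc]
  refine mul_le_mul_of_nonneg_left ?_ two_pos.le
  have bU : IsBounded (⋃ i ∈ Finset.range (N + 1), A i) := by
    rw [isBounded_biUnion_finset]; exact fun i _ => bA i
  refine (mono hsub bU).trans ((measureReal_biUnion_finset_le _ _).trans ?_)
  refine (Finset.sum_le_sum (g := fun _ => Cf * ε) fun i hi => hAv i (by have := Finset.mem_range.1 hi; omega)).trans ?_
  simp
  rw [mul_assoc]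

end QBM

namespace QBM
set_option linter.unusedSectionVars false
set_option linter.style.longLine false
set_option linter.unusedVariables false
set_option linter.unusedSimpArgs false
variable {m : ℕ}

section John
variable {n : ℕ}

lemma john {K : Set (Y n)} (hn : 1 ≤ n) (oK : IsOpen K) (cK : Convex ℝ K) (bK : IsBounded K) (ne : K.Nonempty) :
    ∃ (e : Y n ≃L[ℝ] Y n) (z : Y n), Metric.ball z (1 / (2 * n)) ⊆ e '' K ∧ ∀ p ∈ K, ‖e p - z‖ < 2 := by
  have hn0 : (1:ℝ) ≤ n := by exact_mod_cast hn
  have cc : IsCompact (closure K) := bK.isCompact_closure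
  set f : (Fin n → Y n) × Y n → ℝ := fun q => |Matrix.det (Matrix.of fun i j => q.1 i j - q.2 j)| with hf
  have fc : Continuous f := by
    refine continuous_abs.comp (Continuous.matrix_det ?_)
    fun_prop
  obtain ⟨x, hx⟩ := ne
  obtain ⟨η, hη, hball⟩ := Metric.isOpen_iff.1 oK x hx
  have hcomp : IsCompact ((univ.pi fun _ : Fin n => closure K) ×ˢ closure K) := (isCompact_univ_pi fun _ => cc).prod cc
  obtain ⟨q, hq, hmax⟩ := hcomp.exists_isMaxOn ⟨(fun _ => x, x), fun _ _ => subset_closure hx, subset_closure hx⟩ fc.continuousOn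
  have hpos : 0 < f q := by
    have h1 : ((fun i : Fin n => x + Pi.single i (η / 2), x) : (Fin n → Y n) × Y n) ∈ (univ.pi fun _ : Fin n => closure K) ×ˢ closure K := by
      refine ⟨fun i _ => subset_closure (hball ?_), subset_closure hx⟩
      rw [mem_ball, dist_self_add_left, Pi.norm_single, Real.norm_of_nonneg (by positivity)]
      linarith
    refine lt_of_lt_of_le ?_ (hmax h1)
    have : (Matrix.of fun i j : Fin n => (x + (Pi.single i (η / 2) : Y n)) j - x j) = Matrix.diagonal fun _ => η / 2 := by
      ext i j
      simp [Matrix.diagonal_apply, Pi.single_apply, eq_comm]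
    simp only [hf]
    rw [this, Matrix.det_diagonal]
    exact abs_pos.2 (Finset.prod_ne_zero_iff.2 fun i _ => by positivity)
  set M : Matrix (Fin n) (Fin n) ℝ := Matrix.of fun i j => q.1 i j - q.2 j with hM
  have hMdet : M.det ≠ 0 := by
    intro h
    have : f q = |M.det| := rfl
    rw [this, h] at hpos; simp at hpos
  have hu : IsUnit M.det := isUnit_iff_ne_zero.2 hMdet
  set e : Y n ≃L[ℝ] Y n := (LinearEquiv.ofLinearMap (Matrix.vecMulLinear M⁻¹) (Matrix.vecMulLinear M) (by
    refine LinearMap.ext fun v => ?_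
    change Matrix.vecMul (Matrix.vecMul v M) M⁻¹ = v
    rw [Matrix.vecMul_vecMul, Matrix.mul_nonsing_inv M hu, Matrix.vecMul_one]) (by
    refine LinearMap.ext fun v => ?_
    change Matrix.vecMul (Matrix.vecMul v M⁻¹) M = v
    rw [Matrix.vecMul_vecMul, Matrix.nonsing_inv_mul M hu, Matrix.vecMul_one])).toContinuousLinearEquiv with he
  have es : ∀ c, e.symm c = ∑ k, c k • M k := by
    intro c
    change Matrix.vecMul c M = _
    exact Matrix.vecMul_eq_sum c M
  obtain ⟨hq1, hq2⟩ := hq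
  have box : ∀ p ∈ closure K, ‖e (p - q.2)‖ ≤ 1 := by
    intro p hp
    refine (pi_norm_le_iff_of_nonneg zero_le_one).2 fun i => ?_
    set c := e (p - q.2) with hc
    have hpc : p - q.2 = ∑ k, c k • M k := by rw [← es, hc]; simp
    have h1 : ((Function.update q.1 i p, q.2) : (Fin n → Y n) × Y n) ∈ (univ.pi fun _ : Fin n => closure K) ×ˢ closure K := by
      refine ⟨fun k _ => ?_, hq2⟩
      rcases eq_or_ne k i with rfl | h
      · simpa using hp
      · simpa [h] using hq1 k (mem_univ _)
    have h2 : f (Function.update q.1 i p, q.2) ≤ f q := hmax h1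
    have h3 : (Matrix.of fun k j : Fin n => Function.update q.1 i p k j - q.2 j) = M.updateRow i (∑ k, c k • M k) := by
      ext k j
      rw [← hpc]
      rcases eq_or_ne k i with rfl | h
      · simp
      · simp [h, Matrix.updateRow_ne h, hM]
    have h4 : f (Function.update q.1 i p, q.2) = |c i| * f q := by
      simp only [hf]
      rw [h3, Matrix.det_updateRow_sum, smul_eq_mul, abs_mul]
    rw [h4] at h2
    rw [Real.norm_eq_abs]
    nlinarith
  set z : Y n := e q.2 + (fun _ => (1:ℝ) / (2 * (n:ℝ)) : Y n) with hz
  refine ⟨e, z, ?_, ?_⟩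
  · have cl : Metric.ball z (1 / (2 * n)) ⊆ e '' (closure K) := by
      intro w hw
      refine ⟨e.symm w, ?_, by simp⟩
      set c : Y n := w - e q.2 with hc
      have hci : ∀ i, 0 ≤ c i ∧ c i ≤ 1 / n := by
        intro i
        have h1 : |w i - z i| < 1 / (2 * n) := by
          have := (norm_le_pi_norm (w - z) i).trans_lt (mem_ball_iff_norm.1 hw)
          exact this
        have h2 : z i = (e q.2) i + 1 / (2 * n) := rfl
        have h3 : c i = w i - (e q.2) i := rfl
        rw [abs_lt, h2] at h1
        have h4 : (1:ℝ) / n = 1 / (2 * n) + 1 / (2 * n) := by field_simp; norm_num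
        rw [h3, h4]
        constructor <;> linarith
      have hsum : ∑ i, c i ≤ 1 := by
        refine (Finset.sum_le_sum fun i _ => (hci i).2).trans ?_
        simp
        field_simp
        exact le_rfl
      have hw2 : e.symm w = q.2 + ∑ k, c k • M k := by
        rw [← es, hc, map_sub]; simp
      have hrow : ∀ k, M k = q.1 k - q.2 := fun k => rfl
      have hw3 : e.symm w = ∑ k, c k • q.1 k + (1 - ∑ k, c k) • q.2 := by
        rw [hw2]
        simp only [hrow, smul_sub, Finset.sum_sub_distrib, ← Finset.sum_smul, sub_smul, one_smul]
        abel
      rw [hw3]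
      have hcc := cK.closure
      have := hcc.sum_mem (t := (Finset.univ : Finset (Option (Fin n)))) (w := fun o => o.elim (1 - ∑ k, c k) c) (z := fun o => o.elim q.2 q.1)
        (by rintro (_ | i) _
            · simp only [Option.elim]; linarith
            · exact (hci i).1) (by rw [Fintype.sum_option]; simp) (by
            rintro (_ | i) _
            · exact hq2
            · exact hq1 i (mem_univ _))
      rw [Fintype.sum_option] at this
      simp only [Option.elim] at this
      rwa [add_comm]
    have h1 : Metric.ball z (1 / (2 * n)) ⊆ interior (e '' (closure K)) := interior_maximal cl isOpen_ball
    have h2 : interior (e '' (closure K)) = e '' K := by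
      have : e '' (closure K) = closure (e '' K) := e.toHomeomorph.image_closure K
      have cc2 : Convex ℝ (e '' K) := cK.linear_image e.toLinearMap
      rw [this, cc2.interior_closure_eq_interior_of_nonempty_interior]
      · exact (e.toHomeomorph.isOpenMap _ oK).interior_eq
      · have : interior (e '' K) = e '' K := (e.toHomeomorph.isOpenMap _ oK).interior_eq
        change (interior (e '' K)).Nonempty
        rw [this]; exact ⟨e x, x, hx, rfl⟩
    rwa [h2] at h1
  · intro p hp
    have h1 := box p (subset_closure hp)
    have e1 : e p - z = e (p - q.2) - (fun _ => (1:ℝ) / (2 * (n:ℝ)) : Y n) := by rw [hz, map_sub]; abel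
    rw [e1]
    refine (norm_sub_le _ _).trans_lt ?_
    have : ‖(fun _ : Fin n => (1:ℝ) / (2 * n))‖ ≤ 1 / 2 := by
      refine (pi_norm_le_iff_of_nonneg (by norm_num)).2 fun i => ?_
      rw [Real.norm_of_nonneg (by positivity), div_le_div_iff₀ (by positivity) (by positivity)]
      linarith
    linarith
end John

def e0L (m : ℕ) : Y (m + 1) ≃ₗ[ℝ] X m where
  toFun y := (y 0, fun j => y j.succ)
  invFun p := Fin.cons p.1 p.2
  map_add' _ _ := rfl
  map_smul' _ _ := rfl
  left_inv y := by
    funext j; refine Fin.cases ?_ (fun i => ?_) j <;> simp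
  right_inv p := by simp

def e0 (m : ℕ) : Y (m + 1) ≃L[ℝ] X m := (e0L m).toContinuousLinearEquiv

lemma e0_apply (y : Y (m + 1)) : e0 m y = (y 0, fun j => y j.succ) := rfl

lemma e0_norm (y : Y (m + 1)) : ‖e0 m y‖ = ‖y‖ := by
  apply le_antisymm
  · rw [e0_apply, Prod.norm_def, max_le_iff]
    exact ⟨norm_le_pi_norm y 0, (pi_norm_le_iff_of_nonneg (norm_nonneg _)).2 fun j => norm_le_pi_norm y j.succ⟩
  · refine (pi_norm_le_iff_of_nonneg (norm_nonneg _)).2 fun j => ?_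
    refine Fin.cases ?_ (fun i => ?_) j
    · exact norm_fst_le (e0 m y)
    · exact (norm_le_pi_norm (e0 m y).2 i).trans (norm_snd_le _)

lemma e0_mp : MeasurePreserving (e0 m) := by
  have := volume_preserving_piFinSuccAbove (fun _ : Fin (m + 1) => ℝ) 0
  have h : (e0 m : Y (m + 1) → X m) = MeasurableEquiv.piFinSuccAbove (fun _ : Fin (m + 1) => ℝ) 0 := by
    funext y
    rw [e0_apply]
    rfl
  rw [h]; exact this

end QBM

namespace QBM
set_option linter.unusedSectionVars false
set_option linter.style.longLine false
set_option linter.unusedVariables false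
set_option linter.unusedSimpArgs false
variable {m : ℕ}

lemma nroot {n : ℕ} (hn : n ≠ 0) {a : ℝ} (ha : 0 < a) : ∃ v, 0 < v ∧ v ^ n = a :=
  ⟨a ^ ((n:ℝ)⁻¹), by positivity, Real.rpow_inv_natCast_pow ha.le hn⟩

lemma t_red (hm : 1 ≤ m) (hB : BMp (Y m) m) {F K : Set (X m)} (P : Pair F K) {t s : ℝ} (ht : 1 < t) (hs : 0 < s)
    (h : volume.real (F + t • K) ≤ (1 + t + s) ^ (m + 1) * volume.real K) :
    volume.real (F + (1:ℝ) • K) ≤ (1 + 1 + s) ^ (m + 1) * volume.real K := by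
  have hX := BMp_succ hm hB
  obtain ⟨v, v0, hv⟩ := nroot (Nat.succ_ne_zero m) P.pos
  have p1 : 0 < volume.real (F + (1:ℝ) • K) := by
    have := hX F K P 1 one_pos
    have := P.pos
    refine lt_of_lt_of_le ?_ (hX F K P 1 one_pos)
    positivity
  obtain ⟨A, A0, hA⟩ := nroot (Nat.succ_ne_zero m) p1
  have e1 : F + t • K = (F + (1:ℝ) • K) + (t - 1) • K := by
    rw [add_assoc, ← P.cK.add_smul (by norm_num) (by linarith)]; congr 2; ring
  have t1 : 0 < t - 1 := by linarith
  have key := BM_gen (Nat.succ_ne_zero m) finrankX hX (P.bS 1) (P.oS one_pos).measurableSet (P.oK.smul₀ t1.ne')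
    (P.cK.smul (t - 1)) (P.bK.smul₀ (t - 1)) A0 (mul_pos t1 v0) hA.le (by
      rw [vol_smul finrankX t1.le, mul_pow, hv])
  rw [← e1] at key
  have k2 := key.trans h
  rw [← hv, ← mul_pow] at k2
  have k3 := le_of_pow_le_pow_left₀ (Nat.succ_ne_zero m) (by positivity) k2
  rw [← hA, ← hv, ← mul_pow]
  gcongr
  linarith

lemma stab_norm (hm : 1 ≤ m) (hB : BMp (Y m) m) (hS : Stp (Y m) m) {r R : ℝ} (hr : 0 < r) (hR : 0 < R) :
    ∃ C, 0 < C ∧ ∀ F K : Set (X m), Pair F K → Geo K 0 r R → ∀ t ε, 0 < t → 0 < ε →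
      volume.real (F + t • K) ≤ (1 + t + min t 1 * ε ^ 2) ^ (m + 1) * volume.real K →
      ∃ x : X m, volume.real (symmDiff F (x +ᵥ K)) ≤ C * volume.real K * ε := by
  obtain ⟨C, ε0, hC, hε0, H⟩ := main_norm hm hB hS hr hR
  set κ := (2 * R) ^ m * (2 * R) with hκ
  have κ0 : 0 < κ := by positivity
  set ρ := (2 * r) ^ m * (2 * r) with hρ
  have ρ0 : 0 < ρ := by positivity
  set A := Real.sqrt (4 ^ (m + 1) * κ) with hA
  have A0 : 0 < A := Real.sqrt_pos.2 (by positivity)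
  have A2 : A ^ 2 = 4 ^ (m + 1) * κ := Real.sq_sqrt (by positivity)
  set ε1 := min 1 (ε0 / A) with hε1
  have ε10 : 0 < ε1 := lt_min one_pos (by positivity)
  refine ⟨max (C * A / ρ) (2 / ε1), lt_max_of_lt_right (by positivity), fun F K P G t ε ht hε hv => ?_⟩
  have V0 := P.pos
  rcases lt_or_ge ε1 ε with h1 | h1
  · refine ⟨0, ?_⟩
    have := sd_le_add P.bF P.bK
    rw [P.vol] at this
    rw [zero_vadd]
    have h2 : 1 ≤ ε / ε1 := by rw [le_div_iff₀ ε10]; linarith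
    calc _ ≤ 2 * volume.real K * 1 := by linarith
      _ ≤ 2 * volume.real K * (ε / ε1) := by gcongr
      _ = 2 / ε1 * volume.real K * ε := by ring
      _ ≤ _ := by gcongr; exact le_max_right _ _
  · have small : ∀ t : ℝ, 0 < t → t ≤ 1 → volume.real (F + t • K) ≤ (1 + t + t * ε ^ 2) ^ (m + 1) * volume.real K →
        ∃ x : X m, volume.real (symmDiff F (x +ᵥ K)) ≤ max (C * A / ρ) (2 / ε1) * volume.real K * ε := by
      intro t ht ht1 hv
      have ε1' : ε ≤ 1 := h1.trans (min_le_left _ _)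
      have s1 : t * ε ^ 2 ≤ 1 := by
        have : ε ^ 2 ≤ 1 := pow_le_one₀ hε.le ε1'
        nlinarith
      have b1 : (1 + t + t * ε ^ 2) ^ (m + 1) ≤ (1 + t) ^ (m + 1) * (1 + (2 ^ (m + 1) - 1) * (t * ε ^ 2)) := by
        calc _ ≤ ((1 + t) * (1 + t * ε ^ 2)) ^ (m + 1) := by
              gcongr
              nlinarith [mul_nonneg ht.le (mul_nonneg ht.le (sq_nonneg ε))]
          _ = (1 + t) ^ (m + 1) * (1 + t * ε ^ 2) ^ (m + 1) := mul_pow _ _ _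
          _ ≤ _ := by gcongr; exact pow_one_add_le _ (by positivity) s1
      have b2 : (1 + t) ^ (m + 1) * ((2 ^ (m + 1) - 1) * (t * ε ^ 2)) ≤ 4 ^ (m + 1) * (t * ε ^ 2) := by
        have : (4:ℝ) ^ (m + 1) = 2 ^ (m + 1) * 2 ^ (m + 1) := by rw [← mul_pow]; norm_num
        rw [this, mul_assoc]
        have h3 : (1:ℝ) ≤ 2 ^ (m + 1) := one_le_pow₀ (by norm_num)
        have : 0 ≤ (2:ℝ) ^ (m + 1) - 1 := by linarith
        gcongr
        · linarith
        · linarith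
      have b3 : volume.real (F + t • K) ≤ (1 + t) ^ (m + 1) * volume.real K + t * (A * ε) ^ 2 := by
        calc _ ≤ _ := hv
          _ ≤ ((1 + t) ^ (m + 1) * (1 + (2 ^ (m + 1) - 1) * (t * ε ^ 2))) * volume.real K := by gcongr
          _ = (1 + t) ^ (m + 1) * volume.real K + ((1 + t) ^ (m + 1) * ((2 ^ (m + 1) - 1) * (t * ε ^ 2))) * volume.real K := by ring
          _ ≤ (1 + t) ^ (m + 1) * volume.real K + (4 ^ (m + 1) * (t * ε ^ 2)) * κ := by
              gcongr
              exact G.vol_le P.oK P.bK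
          _ = _ := by rw [mul_pow, A2]; ring
      obtain ⟨x, hx⟩ := H F K P G t (A * ε) ht ht1 (by positivity) (by
        have := h1.trans (min_le_right _ _)
        rw [le_div_iff₀ A0] at this; linarith) b3
      refine ⟨x, hx.trans ?_⟩
      have hge : ρ ≤ volume.real K := G.vol_ge P.oK P.bK
      have h2 : 1 ≤ volume.real K / ρ := by rw [le_div_iff₀ ρ0]; linarith
      calc C * (A * ε) = C * A * ε * 1 := by ring
        _ ≤ C * A * ε * (volume.real K / ρ) := by gcongr
        _ = C * A / ρ * volume.real K * ε := by ring
        _ ≤ _ := by gcongr; exact le_max_left _ _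
    rcases le_or_gt t 1 with h2 | h2
    · rw [min_eq_left h2] at hv
      exact small t ht h2 hv
    · rw [min_eq_right h2.le] at hv
      have := t_red hm hB P h2 (by positivity) hv
      exact small 1 one_pos le_rfl this

lemma BMp_Y_succ (hm : 1 ≤ m) (hB : BMp (Y m) m) : BMp (Y (m + 1)) (m + 1) :=
  BMp.transfer (e0 m) (mp_image _ e0_mp) (BMp_succ hm hB)

lemma Stp_Y_succ (hm : 1 ≤ m) (hB : BMp (Y m) m) (hS : Stp (Y m) m) : Stp (Y (m + 1)) (m + 1) := by
  obtain ⟨C, hC, H⟩ := stab_norm hm hB hS (r := 1 / (2 * ((m + 1 : ℕ) : ℝ))) (R := 2) (by positivity) (by norm_num)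
  refine ⟨C, hC, fun F K P t ε ht hε hv => ?_⟩
  obtain ⟨e, z, h1, h2⟩ := john (by lia) P.oK P.cK P.bK P.ne
  set d := |LinearMap.det (e : Y (m + 1) →ₗ[ℝ] Y (m + 1))| with hd
  have d0 : 0 < d := abs_pos.2 (LinearEquiv.isUnit_det' e.toLinearEquiv).ne_zero
  set E := e.trans (e0 m) with hE
  have he : ∀ S : Set (Y (m + 1)), volume.real (E '' S) = d * volume.real S := by
    intro S
    have : E '' S = e0 m '' (e '' S) := by rw [image_image]; rfl
    rw [this, mp_image _ e0_mp, Measure.real]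
    have := Measure.addHaar_image_linearMap volume (e : Y (m + 1) →ₗ[ℝ] Y (m + 1)) S
    have h3 : (e : Y (m + 1) → Y (m + 1)) '' S = (e : Y (m + 1) →ₗ[ℝ] Y (m + 1)) '' S := rfl
    rw [h3, this, ENNReal.toReal_mul, ENNReal.toReal_ofReal (abs_nonneg _)]; rfl
  refine stab_transfer E d0 he hv fun hv' => ?_
  set w := e0 m z
  have P' := P.image E he
  have P2 : Pair (E '' F) ((-w) +ᵥ (E '' K)) := 
    { bF := P'.bF, mF := P'.mF, oK := P'.oK.vadd _, cK := P'.cK.vadd _, bK := bdd_vadd P'.bK, 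
      ne := P'.ne.vadd_set, vol := by rw [vol_vadd]; exact P'.vol }
  have G : Geo ((-w) +ᵥ (E '' K)) 0 (1 / (2 * ((m + 1 : ℕ) : ℝ))) 2 := by
    refine ⟨by positivity, by norm_num, ?_, ?_⟩
    · intro p hp
      have hp' : ‖p‖ < 1 / (2 * ((m + 1 : ℕ) : ℝ)) := by
        have := mem_ball_iff_norm.1 hp
        rwa [show (((0:ℝ), (0 : Y m)) : X m) = 0 from rfl, sub_zero] at this
      have : z + (e0 m).symm p ∈ Metric.ball z (1 / (2 * ((m + 1 : ℕ) : ℝ))) := by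
        rw [mem_ball_iff_norm, add_sub_cancel_left, ← e0_norm, ContinuousLinearEquiv.apply_symm_apply]
        exact hp'
      obtain ⟨k, hk, hk2⟩ := h1 this
      refine ⟨E k, ⟨k, hk, rfl⟩, ?_⟩
      change -w + e0 m (e k) = p
      rw [hk2, map_add, ContinuousLinearEquiv.apply_symm_apply]; simp [w]
    · rintro _ ⟨_, ⟨k, hk, rfl⟩, rfl⟩
      change ‖-w + e0 m (e k)‖ < 2
      have := h2 k hk
      rw [← e0_norm, map_sub] at this
      rwa [neg_add_eq_sub]
  obtain ⟨x, hx⟩ := H _ _ P2 G t ε ht hε (by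
    rw [vol_vadd]
    refine le_trans (le_of_eq ?_) hv'
    have : E '' F + t • ((-w) +ᵥ (E '' K)) = (t • (-w)) +ᵥ (E '' F + t • (E '' K)) := by
      rw [← singleton_vadd, ← singleton_vadd, vadd_eq_add, vadd_eq_add, smul_add, smul_set_singleton]
      exact add_left_comm _ _ _
    rw [this, vol_vadd])
  refine ⟨x + (-w), ?_⟩
  rw [vol_vadd, vadd_vadd] at hx
  exact hx

theorem all_Y (n : ℕ) (hn : 1 ≤ n) : BMp (Y n) n ∧ Stp (Y n) n := by
  induction n, hn using Nat.le_induction with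
  | base => exact ⟨BMp_one, Stp_one⟩
  | succ n hn ih => exact ⟨BMp_Y_succ hn ih.1, Stp_Y_succ hn ih.1 ih.2⟩

end QBM

namespace QBM
set_option linter.unusedSectionVars false
set_option linter.style.longLine false
set_option linter.unusedVariables false
set_option linter.unusedSimpArgs false
variable {m : ℕ}

lemma final {n : ℕ} (hn : 1 ≤ n) :
    BMp (EuclideanSpace ℝ (Fin n)) n ∧ Stp (EuclideanSpace ℝ (Fin n)) n := by
  have h := all_Y n hn
  have mp : MeasurePreserving (EuclideanSpace.equiv (Fin n) ℝ : EuclideanSpace ℝ (Fin n) ≃L[ℝ] Y n) :=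
    PiLp.volume_preserving_ofLp (Fin n)
  exact ⟨BMp.transfer _ (mp_image _ mp) h.1, Stp.transfer _ (mp_image _ mp) h.2⟩

theorem qbm (n : ℕ) (hn : 1 ≤ n) :
    ∃ C : ℝ, 0 < C ∧
      ∀ F K : Set (EuclideanSpace ℝ (Fin n)),
        IsBounded F → IsBounded K → MeasurableSet F → Convex ℝ K →
        0 < volume F → volume F < ⊤ → 0 < volume K → volume K < ⊤ →
        C * min ((volume F).toReal ^ ((n : ℝ)⁻¹)) ((volume K).toReal ^ ((n : ℝ)⁻¹)) *
            (⨅ x : EuclideanSpace ℝ (Fin n),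
              (volume (symmDiff F
                ((fun y => x + (((volume F).toReal / (volume K).toReal) ^ ((n : ℝ)⁻¹)) • y) ''
                  K))).toReal / (volume F).toReal) ^ 2 ≤
          (volume (F + K)).toReal ^ ((n : ℝ)⁻¹) - (volume F).toReal ^ ((n : ℝ)⁻¹) -
            (volume K).toReal ^ ((n : ℝ)⁻¹) := by
  obtain ⟨hB, C, hC, hS⟩ := final hn
  have n0 : n ≠ 0 := by lia
  have fr : Module.finrank ℝ (EuclideanSpace ℝ (Fin n)) = n := by simp
  refine ⟨1 / C ^ 2, by positivity, fun F K bF bK mF cK F0 F1 K0 K1 => ?_⟩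
  have vF0 : 0 < (volume F).toReal := ENNReal.toReal_pos F0.ne' F1.ne
  have vK0 : 0 < (volume K).toReal := ENNReal.toReal_pos K0.ne' K1.ne
  rw [Real.div_rpow vF0.le vK0.le]
  set f := (volume F).toReal ^ ((n : ℝ)⁻¹) with hf
  set k := (volume K).toReal ^ ((n : ℝ)⁻¹) with hk
  set s := (volume (F + K)).toReal ^ ((n : ℝ)⁻¹) with hs
  have f0 : 0 < f := by positivity
  have k0 : 0 < k := by positivity
  have s0 : 0 ≤ s := by positivity
  have fn : f ^ n = (volume F).toReal := Real.rpow_inv_natCast_pow vF0.le n0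
  have kn : k ^ n = (volume K).toReal := Real.rpow_inv_natCast_pow vK0.le n0
  have sn : s ^ n = (volume (F + K)).toReal := Real.rpow_inv_natCast_pow ENNReal.toReal_nonneg n0
  have hfr : volume (frontier K) = 0 := cK.addHaar_frontier volume
  have hvint : volume (interior K) = volume K := measure_congr (interior_ae_eq_of_null_frontier hfr)
  have ine : (interior K).Nonempty := by
    refine nonempty_of_measure_ne_zero (μ := volume) ?_
    rw [hvint]; exact K0.ne'
  set L := (f / k) • interior K with hL
  have l0 : 0 < f / k := by positivity
  have vL : volume.real L = f ^ n := by
    rw [hL, vol_smul fr l0.le, Measure.real, hvint, ← kn, ← mul_pow, div_mul_cancel₀ _ k0.ne']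
  have bI : IsBounded (interior K) := bK.subset interior_subset
  have P : Pair F L :=
    { bF := bF, mF := mF, oK := isOpen_interior.smul₀ l0.ne', cK := cK.interior.smul _,
      bK := bI.smul₀ _, ne := ine.smul_set, vol := by rw [vL, fn]; rfl }
  have t0 : 0 < k / f := by positivity
  have tL : (k / f) • L = interior K := by
    rw [hL, smul_smul, show k / f * (f / k) = 1 by field_simp, one_smul]
  have sub : volume.real (F + (k / f) • L) ≤ s ^ n := by
    rw [tL, sn]
    exact mono (add_subset_add_left interior_subset) (bF.add bK)
  have hD : f + k ≤ s := by
    have h1 := (hB F L P _ t0).trans sub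
    rw [vL, ← mul_pow] at h1
    have h2 := le_of_pow_le_pow_left₀ n0 s0 h1
    have : (1 + k / f) * f = f + k := by field_simp
    linarith
  have hmin : min f k = f * min (k / f) 1 := by
    rw [mul_min_of_nonneg _ _ f0.le, mul_div_cancel₀ _ f0.ne', mul_one, min_comm]
  have m0 : 0 < min f k := lt_min f0 k0
  set α := ⨅ x : EuclideanSpace ℝ (Fin n),
              (volume (symmDiff F ((fun y => x + (f / k) • y) '' K))).toReal / (volume F).toReal with hα
  have α0 : 0 ≤ α := Real.iInf_nonneg fun x => by positivity
  have key : ∀ ε, 0 < ε → s ≤ f + k + min f k * ε ^ 2 → α ≤ C * ε := by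
    intro ε hε h
    obtain ⟨x, hx⟩ := hS F L P (k / f) ε t0 hε (by
      refine sub.trans ?_
      rw [vL, ← mul_pow]
      gcongr
      refine h.trans_eq ?_
      rw [hmin]; field_simp)
    have e1 : (fun y => x + (f / k) • y) '' K = x +ᵥ ((f / k) • K) := by
      change _ = (fun z => x + z) '' ((fun y => (f / k) • y) '' K)
      rw [image_image]
    have bA : IsBounded (x +ᵥ ((f / k) • K)) := bdd_vadd (bK.smul₀ _)
    have h3 : volume.real (symmDiff (x +ᵥ L) (x +ᵥ ((f / k) • K))) = 0 := by
      rw [sd_vadd, sd_nested (smul_set_mono interior_subset) P.oK.measurableSet (bK.smul₀ _), vL,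
        vol_smul fr l0.le, Measure.real, ← kn, ← mul_pow, div_mul_cancel₀ _ k0.ne', sub_self]
    have h4 := sd_tri bF (bdd_vadd (x := x) P.bK) bA
    rw [h3, add_zero] at h4
    have h5 : α ≤ _ := ciInf_le ⟨0, by rintro _ ⟨y, rfl⟩; positivity⟩ x
    refine h5.trans ?_
    rw [div_le_iff₀ vF0, e1]
    refine h4.trans (hx.trans_eq ?_)
    rw [vL, fn]; ring
  have fin : ∀ η, 0 < η → 1 / C ^ 2 * min f k * α ^ 2 ≤ s - f - k + η := by
    intro η hη
    have D0 : 0 < (s - f - k + η) / min f k := by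
      apply div_pos _ m0; linarith
    have hsq := Real.sq_sqrt D0.le
    have h1 := key (Real.sqrt ((s - f - k + η) / min f k)) (Real.sqrt_pos.2 D0) (by
      rw [hsq, mul_div_cancel₀ _ m0.ne']; linarith)
    have h2 : α ^ 2 ≤ C ^ 2 * ((s - f - k + η) / min f k) := by
      rw [← hsq, ← mul_pow]; gcongr
    calc 1 / C ^ 2 * min f k * α ^ 2 ≤ 1 / C ^ 2 * min f k * (C ^ 2 * ((s - f - k + η) / min f k)) := by gcongr
      _ = s - f - k + η := by field_simp
  exact le_of_forall_pos_le_add fin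

end QBM

/-- Quantitative Brunn–Minkowski inequality. -/
theorem quantitative_brunn_minkowski (n : ℕ) (hn : 1 ≤ n) :
    ∃ C : ℝ, 0 < C ∧
      ∀ F K : Set (EuclideanSpace ℝ (Fin n)),
        IsBounded F → IsBounded K → MeasurableSet F → Convex ℝ K →
        0 < volume F → volume F < ⊤ → 0 < volume K → volume K < ⊤ →
        C * min ((volume F).toReal ^ ((n : ℝ)⁻¹)) ((volume K).toReal ^ ((n : ℝ)⁻¹)) *
            (⨅ x : EuclideanSpace ℝ (Fin n),
              (volume (symmDiff F
                ((fun y => x + (((volume F).toReal / (volume K).toReal) ^ ((n : ℝ)⁻¹)) • y) ''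
                  K))).toReal / (volume F).toReal) ^ 2 ≤
          (volume (F + K)).toReal ^ ((n : ℝ)⁻¹) - (volume F).toReal ^ ((n : ℝ)⁻¹) -
            (volume K).toReal ^ ((n : ℝ)⁻¹) := by
  exact QBM.qbm n hn
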